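/- Let G be an e₁-gate graph with R ≥ 2 diagram elements, let N ∈ {1,…,R}, and let G^occ be a simple graph on vertex set [R] such that the subspace I(G,G^occ,N) is nonzero. Then there exists an e₁-gate graph G^□ with at most 7R² diagram elements such that: (1) λ_N^1(G^□) ≤ λ_N^1(G,G^occ)/R; and (2) for every b ∈ [0,1], if λ_N^1(G,G^occ) ≥ b then λ_N^1(G^□) ≥ b/(13R)⁹. (Occupancy Constraints Lemma.) -/

import Mathlib

open scoped Matrix

namespace GG

/-- `ω = e^{iπ/4}`. -/
noncomputable def omega : ℂ := Complex.exp (Real.pi * Complex.I / 4)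

/-- The cyclic shift on `ℂ⁸`: `S|j⟩ = |j+1 mod 8⟩`, i.e. `⟨i|S|j⟩ = [i = j+1]`. -/
noncomputable def S8 : Matrix (Fin 8) (Fin 8) ℂ :=
  Matrix.of fun i j => if i = j + 1 then 1 else 0

/-- `|ω⟩ = (1/√8) Σ_{j=0}^{7} ω^{−j} |j⟩`. -/
noncomputable def omegaVec : Fin 8 → ℂ :=
  fun j => ((1 : ℝ) / Real.sqrt 8 : ℝ) * omega ^ (-(j : ℤ))

/-- The Hadamard gate `H = (1/√2)[[1,1],[1,−1]]`. -/
noncomputable def Hmat : Matrix (Fin 2) (Fin 2) ℂ :=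
  ((1 : ℝ) / Real.sqrt 2 : ℝ) • (!![1, 1; 1, -1] : Matrix (Fin 2) (Fin 2) ℂ)

/-- The gate `T = diag(1, ω)`. -/
noncomputable def Tmat : Matrix (Fin 2) (Fin 2) ℂ := !![1, 0; 0, omega]

/-- The gates `U₁,…,U₈` of the circuit `C₀` (0-indexed):
`U₁ = U₂ = U₇ = U₈ = H`, `U₃ = U₅ = HT`, `U₄ = U₆ = (HT)†`. -/
noncomputable def gate : Fin 8 → Matrix (Fin 2) (Fin 2) ℂ :=
  ![Hmat, Hmat, Hmat * Tmat, (Hmat * Tmat)ᴴ, Hmat * Tmat, (Hmat * Tmat)ᴴ, Hmat, Hmat]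

/-- For a matrix `W` all of whose entries are `0` or integer powers of `ω`, the operator
`B(W)` obtained by replacing each entry `ω^k` by `S^k` (and each zero entry by the zero
block): since `(S^k)_{ij} = [i−j ≡ k (mod 8)]` and the powers `ω^0,…,ω^7` are distinct,
this is implemented by `B(W)_{(a,i),(b,j)} = [W a b = ω^{(i−j) mod 8}]`. -/
noncomputable def Bmat {κ : Type*} (W : Matrix κ κ ℂ) :
    Matrix (κ × Fin 8) (κ × Fin 8) ℂ :=
  Matrix.of fun p q => if W p.1 q.1 = omega ^ ((p.2 - q.2 : Fin 8) : ℕ) then 1 else 0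

/-- The vertex set of the graph `g₀`: `{0,1} × [8] × {0,…,7}`, a qubit register, a
clock register (labels `1,…,8`, represented by `Fin 8` with label `t ↔ index t−1` and
periodic convention `|9⟩ = |1⟩`), and an 8-level ancilla. -/
abbrev G0V := Fin 2 × Fin 8 × Fin 8

/-- `H_prop = Σ_{t=1}^{8}( (B(U_t)†)_{13} ⊗ (|t⟩⟨t+1|)_2 + (B(U_t))_{13} ⊗ (|t+1⟩⟨t|)_2 )`,
where `B(U_t)` is obtained from the matrix `−√2·U_t` by the substitution `ω^k ↦ S^k`. -/
noncomputable def Hprop0 : Matrix G0V G0V ℂ :=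
  Matrix.of fun p q => ∑ t : Fin 8,
    ((if p.2.1 = t ∧ q.2.1 = t + 1 then
        (Bmat ((-(Real.sqrt 2) : ℂ) • gate t))ᴴ (p.1, p.2.2) (q.1, q.2.2) else 0)
      + (if p.2.1 = t + 1 ∧ q.2.1 = t then
        Bmat ((-(Real.sqrt 2) : ℂ) • gate t) (p.1, p.2.2) (q.1, q.2.2) else 0))

/-- `H_penalty = 1 ⊗ 1 ⊗ (S³ + S⁴ + S⁵)`. -/
noncomputable def Hpen0 : Matrix G0V G0V ℂ :=
  Matrix.of fun p q =>
    if p.1 = q.1 ∧ p.2.1 = q.2.1 then (S8 ^ 3 + S8 ^ 4 + S8 ^ 5) p.2.2 q.2.2 else 0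

/-- The adjacency matrix `A(g₀) = H_prop + H_penalty` of the 128-vertex graph `g₀`. -/
noncomputable def Ag0 : Matrix G0V G0V ℂ := Hprop0 + Hpen0

/-- `e₁ = −1 − 3√2`. -/
noncomputable def e1 : ℝ := -1 - 3 * Real.sqrt 2

/-- Clock-register coefficients of the states `ψ_{z,0}`: the qubit register holds `|z⟩`
at clock labels `1,3,5,7` (indices `0,2,4,6`), `H|z⟩` at labels `2,8` (indices `1,7`),
and `HT|z⟩` at labels `4,6` (indices `3,5`). -/
noncomputable def clockCoef (z : Fin 2) (t : Fin 8) (x : Fin 2) : ℂ :=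
  if t = 0 ∨ t = 2 ∨ t = 4 ∨ t = 6 then (if x = z then 1 else 0)
  else if t = 1 ∨ t = 7 then Hmat x z
  else (Hmat * Tmat) x z

/-- The ground states `ψ_{z,a}` of `A(g₀)`:
`ψ_{z,0} = (1/√8)( |z⟩(|1⟩+|3⟩+|5⟩+|7⟩) + H|z⟩(|2⟩+|8⟩) + HT|z⟩(|4⟩+|6⟩) ) ⊗ |ω⟩` and
`ψ_{z,1} = (ψ_{z,0})^*` (entrywise complex conjugate). -/
noncomputable def psi (z a : Fin 2) : G0V → ℂ :=
  if a = 0 then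
    fun p => ((1 : ℝ) / Real.sqrt 8 : ℝ) * clockCoef z p.2.1 p.1 * omegaVec p.2.2
  else
    fun p => starRingEnd ℂ
      (((1 : ℝ) / Real.sqrt 8 : ℝ) * clockCoef z p.2.1 p.1 * omegaVec p.2.2)

end GG

namespace BH

variable {V : Type*} [Fintype V] [DecidableEq V]

/-- The operator `M` acting on the `w`-th factor of the `N`-fold tensor power
`(ℂ^V)^{⊗N}`, the latter identified with `ℂ^{V^N}`. -/
noncomputable def onFactor (N : ℕ) (M : Matrix V V ℂ) (w : Fin N) :
    Matrix (Fin N → V) (Fin N → V) ℂ :=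
  Matrix.of fun x y =>
    (if ∀ u, u ≠ w → x u = y u then (1 : ℂ) else 0) * M (x w) (y w)

/-- The Bose–Hubbard interaction term
`Σ_{k ∈ V} Σ_{w ≠ w'} (|k⟩⟨k|)^{(w)} (|k⟩⟨k|)^{(w')}`, a diagonal matrix whose diagonal
entry at a configuration `x : Fin N → V` counts the ordered pairs of distinct particles
sitting at a common vertex. -/
noncomputable def interaction (V : Type*) [DecidableEq V] (N : ℕ) :
    Matrix (Fin N → V) (Fin N → V) ℂ :=
  Matrix.of fun x y =>
    if x = y then
      (((Finset.univ : Finset (Fin N × Fin N)).filter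
          fun p => p.1 ≠ p.2 ∧ x p.1 = x p.2).card : ℂ)
    else 0

/-- The `N`-particle Bose–Hubbard Hamiltonian `H_G^N` (with hopping and interaction
strengths equal to `1`) for the graph with adjacency matrix `A`. -/
noncomputable def bhHam (A : Matrix V V ℂ) (N : ℕ) :
    Matrix (Fin N → V) (Fin N → V) ℂ :=
  (∑ w : Fin N, onFactor N A w) + interaction V N

/-- The bosonic (symmetric) subspace `Z_N(G)`: states invariant under every permutation
of the `N` tensor factors. -/
def symmStates (V : Type*) (N : ℕ) : Set ((Fin N → V) → ℂ) :=
  { ψ | ∀ σ : Equiv.Perm (Fin N), ∀ x : Fin N → V, ψ (x ∘ σ) = ψ x }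

/-- The ground energy (smallest eigenvalue) of the compression of a Hermitian matrix `H`
to a subspace given as a set `Z` of states: the infimum of the Rayleigh quotients
`⟨ψ, H ψ⟩` over unit vectors `ψ ∈ Z`. -/
noncomputable def groundEnergy {ι : Type*} [Fintype ι]
    (H : Matrix ι ι ℂ) (Z : Set (ι → ℂ)) : ℝ :=
  sInf { r : ℝ | ∃ ψ ∈ Z, dotProduct (star ψ) ψ = 1 ∧
    r = (dotProduct (star ψ) (H.mulVec ψ)).re }

/-- `μ(G)`: the smallest eigenvalue of the adjacency matrix `A = A(G)`. -/
noncomputable def mu (A : Matrix V V ℂ) : ℝ :=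
  groundEnergy A Set.univ

/-- `λ_N^1(G)`: the smallest eigenvalue of `H(G,N)`, the restriction of
`H_G^N − N μ(G)·1` to the symmetric subspace `Z_N(G)`. -/
noncomputable def lambda1 (A : Matrix V V ℂ) (N : ℕ) : ℝ :=
  groundEnergy (bhHam A N - ((N : ℂ) * (mu A : ℂ)) • 1) (symmStates V N)

end BH

namespace GG

/-- A node `(q, z, t)` of a gate diagram with `R` diagram elements. -/
abbrev GNode (R : ℕ) := Fin R × Fin 2 × Fin 8

/-- The vertex set `[R] × {0,1} × [8] × {0,…,7}` of a gate graph, grouped as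
(node, ancilla). -/
abbrev GGV (R : ℕ) := GNode R × Fin 8

/-- The term `(|u⟩+|v⟩)(⟨u|+⟨v|) ⊗ 1` contributed by an edge `{u, v}` of a gate
diagram. -/
noncomputable def edgeTerm {R : ℕ} (u v : GNode R) : Matrix (GGV R) (GGV R) ℂ :=
  Matrix.of fun p q =>
    if p.2 = q.2 then
      ((if p.1 = u then (1 : ℂ) else 0) + (if p.1 = v then (1 : ℂ) else 0))
        * ((if q.1 = u then (1 : ℂ) else 0) + (if q.1 = v then (1 : ℂ) else 0))
    else 0

lemma edgeTerm_symm {R : ℕ} (u v : GNode R) : edgeTerm u v = edgeTerm v u := by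
  funext p q
  simp only [edgeTerm, Matrix.of_apply]
  split_ifs <;> ring

/-- `h_ℰ = Σ_{{(q,z,t),(q',z',t')} ∈ ℰ} (|q,z,t⟩+|q',z',t'⟩)(⟨q,z,t|+⟨q',z',t'|) ⊗ 1`. -/
noncomputable def hE {R : ℕ} (E : Finset (Sym2 (GNode R))) : Matrix (GGV R) (GGV R) ℂ :=
  ∑ e ∈ E, Sym2.lift ⟨fun u v => edgeTerm u v, edgeTerm_symm⟩ e

/-- `h_𝒮 = Σ_{(q,z,t) ∈ 𝒮} |q,z,t⟩⟨q,z,t| ⊗ 1`. -/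
noncomputable def hS {R : ℕ} (S : Finset (GNode R)) : Matrix (GGV R) (GGV R) ℂ :=
  Matrix.of fun p q => if p.1 = q.1 ∧ p.1 ∈ S ∧ p.2 = q.2 then 1 else 0

/-- The adjacency matrix of the gate graph of a gate diagram:
`A(G) = 1 ⊗ A(g₀) + h_𝒮 + h_ℰ`. -/
noncomputable def AG {R : ℕ} (S : Finset (GNode R)) (E : Finset (Sym2 (GNode R))) :
    Matrix (GGV R) (GGV R) ℂ :=
  (Matrix.of fun p q : GGV R =>
    if p.1.1 = q.1.1 then Ag0 (p.1.2.1, p.1.2.2, p.2) (q.1.2.1, q.1.2.2, q.2) else 0)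
    + hS S + hE E

/-- Validity of a gate diagram: edges join distinct nodes, and each node carries at most
one edge or one self-loop and never both. -/
def ValidDiagram {R : ℕ} (S : Finset (GNode R)) (E : Finset (Sym2 (GNode R))) : Prop :=
  (∀ e ∈ E, ¬ e.IsDiag)
  ∧ (∀ v ∈ S, ∀ e ∈ E, v ∉ e)
  ∧ (∀ e ∈ E, ∀ e' ∈ E, e ≠ e' → ∀ v : GNode R, v ∈ e → v ∉ e')

/-- The single-particle state `ψ^q_{z,a} = |q⟩ ⊗ ψ_{z,a}`. -/
noncomputable def psiQ {R : ℕ} (q : Fin R) (z a : Fin 2) : GGV R → ℂ :=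
  fun p => (if p.1.1 = q then (1 : ℂ) else 0) * psi z a (p.1.2.1, p.1.2.2, p.2)

/-- The symmetrization `Sym(φ₁ ⊗ ⋯ ⊗ φ_N) = (1/√N!) Σ_{σ ∈ S_N} φ_{σ(1)} ⊗ ⋯ ⊗ φ_{σ(N)}`
of a product state. -/
noncomputable def symSt {ι : Type*} (N : ℕ) (φ : Fin N → (ι → ℂ)) : (Fin N → ι) → ℂ :=
  fun x => ((1 : ℝ) / Real.sqrt (N.factorial) : ℝ)
    * ∑ σ : Equiv.Perm (Fin N), ∏ w : Fin N, φ (σ w) (x w)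

/-- The subspace
`I(G,N) = span{ Sym(ψ^{q₁}_{z₁,a₁} ⊗ ⋯ ⊗ ψ^{q_N}_{z_N,a_N}) : q₁,…,q_N pairwise distinct }`. -/
noncomputable def Ispace (R N : ℕ) : Submodule ℂ ((Fin N → GGV R) → ℂ) :=
  Submodule.span ℂ
    { v | ∃ (z a : Fin N → Fin 2) (q : Fin N → Fin R),
        Function.Injective q ∧ v = symSt N (fun w => psiQ (q w) (z w) (a w)) }

end GG

namespace GG

/-- The subspace `I(G, G^occ, N)`: the span of the symmetrized product states
`Sym(ψ^{q₁}_{z₁,a₁} ⊗ ⋯ ⊗ ψ^{q_N}_{z_N,a_N})` where the diagram elements `q₁,…,q_N` are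
pairwise distinct and no two of them are joined by an edge of the occupancy-constraints
graph `G^occ`. -/
noncomputable def IoccSpace (R N : ℕ) (Gocc : SimpleGraph (Fin R)) :
    Submodule ℂ ((Fin N → GGV R) → ℂ) :=
  Submodule.span ℂ
    { v | ∃ (z a : Fin N → Fin 2) (q : Fin N → Fin R),
        Function.Injective q
          ∧ (∀ i j : Fin N, i ≠ j → ¬ Gocc.Adj (q i) (q j))
          ∧ v = symSt N (fun w => psiQ (q w) (z w) (a w)) }

/-- `λ_N^1(G, G^occ)`: the smallest eigenvalue of `H(G, G^occ, N)`, the compression of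
`H(G,N)` (i.e. of `H_G^N − N μ(G)·1`) to the subspace `I(G, G^occ, N)`. -/
noncomputable def lambdaOcc (R N : ℕ) (S : Finset (GNode R))
    (E : Finset (Sym2 (GNode R))) (Gocc : SimpleGraph (Fin R)) : ℝ :=
  BH.groundEnergy
    (BH.bhHam (AG S E) N - ((N : ℂ) * (BH.mu (AG S E) : ℂ)) • 1)
    ((IoccSpace R N Gocc : Set ((Fin N → GGV R) → ℂ)))

end GG

open GG

open scoped Matrix
open GG

namespace OCL

section lin
variable {ι κ : Type*} [Fintype ι] [Fintype κ]

/-- Squared norm. -/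
noncomputable def ns (v : ι → ℂ) : ℝ := ∑ i, Complex.normSq (v i)

/-- Real quadratic form of a matrix. -/
noncomputable def qf (M : Matrix ι ι ℂ) (v : ι → ℂ) : ℝ := (star v ⬝ᵥ (M *ᵥ v)).re

/-- Nonnegative quadratic form. -/
def nn (M : Matrix ι ι ℂ) : Prop := ∀ v, 0 ≤ qf M v

lemma ns_nonneg (v : ι → ℂ) : 0 ≤ ns v := Finset.sum_nonneg fun _ _ => Complex.normSq_nonneg _

lemma star_dot_self (v : ι → ℂ) : star v ⬝ᵥ v = (ns v : ℂ) := by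
  simp only [dotProduct, ns, Pi.star_apply, Complex.ofReal_sum]
  refine Finset.sum_congr rfl fun i _ => ?_
  rw [Complex.normSq_eq_conj_mul_self]; rfl

lemma qf_one [DecidableEq ι] (v : ι → ℂ) : qf (1 : Matrix ι ι ℂ) v = ns v := by
  simp [qf, star_dot_self]

lemma qf_add (M M' : Matrix ι ι ℂ) (v : ι → ℂ) : qf (M + M') v = qf M v + qf M' v := by
  simp [qf, Matrix.add_mulVec, dotProduct_add]

lemma qf_sub (M M' : Matrix ι ι ℂ) (v : ι → ℂ) : qf (M - M') v = qf M v - qf M' v := by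
  simp [qf, Matrix.sub_mulVec, dotProduct_sub]

lemma qf_smul (r : ℝ) (M : Matrix ι ι ℂ) (v : ι → ℂ) : qf ((r : ℂ) • M) v = r * qf M v := by
  simp [qf, Matrix.smul_mulVec, dotProduct_smul]

lemma qf_zero (v : ι → ℂ) : qf (0 : Matrix ι ι ℂ) v = 0 := by simp [qf]

lemma qf_sum {α : Type*} (s : Finset α) (f : α → Matrix ι ι ℂ) (v : ι → ℂ) :
    qf (∑ a ∈ s, f a) v = ∑ a ∈ s, qf (f a) v := by
  classical
  induction s using Finset.induction_on with
  | empty => simp [qf_zero]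
  | insert a s ha ih => rw [Finset.sum_insert ha, Finset.sum_insert ha, qf_add, ih]

lemma qf_comp (M : Matrix ι ι ℂ) (J : Matrix ι κ ℂ) (c : κ → ℂ) :
    qf (Jᴴ * M * J) c = qf M (J *ᵥ c) := by
  simp only [qf]
  rw [Matrix.star_mulVec, ← Matrix.dotProduct_mulVec, Matrix.mulVec_mulVec, Matrix.mulVec_mulVec,
    Matrix.mul_assoc]

lemma qf_conjT_mul (J : Matrix ι κ ℂ) (c : κ → ℂ) : qf (Jᴴ * J) c = ns (J *ᵥ c) := by
  classical
  have := qf_comp 1 J c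
  rw [Matrix.mul_one] at this
  rw [this, qf_one]

lemma qf_mul_conjT (J : Matrix ι κ ℂ) (v : ι → ℂ) : qf (J * Jᴴ) v = ns (Jᴴ *ᵥ v) := by
  have := qf_conjT_mul Jᴴ v
  rwa [Matrix.conjTranspose_conjTranspose] at this

lemma qf_apply (M : Matrix ι ι ℂ) (v : ι → ℂ) :
    qf M v = (∑ i, ∑ j, starRingEnd ℂ (v i) * M i j * v j).re := by
  simp only [qf, dotProduct, Matrix.mulVec, Finset.mul_sum, Pi.star_apply, mul_assoc]
  rfl

lemma qf_par (M : Matrix ι ι ℂ) (x y : ι → ℂ) :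
    qf M (x + y) + qf M (x - y) = 2 * qf M x + 2 * qf M y := by
  simp only [qf, Matrix.mulVec_add, Matrix.mulVec_sub, star_add, star_sub, dotProduct_add,
    dotProduct_sub, add_dotProduct, sub_dotProduct, Complex.add_re, Complex.sub_re]
  ring

lemma nn.par {M : Matrix ι ι ℂ} (h : nn M) (x y : ι → ℂ) :
    qf M (x + y) ≤ 2 * qf M x + 2 * qf M y := by
  have := h (x - y); have := qf_par M x y; linarith

lemma qf_neg_vec (M : Matrix ι ι ℂ) (x : ι → ℂ) : qf M (-x) = qf M x := by
  simp [qf, Matrix.mulVec_neg]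

lemma nn.par' {M : Matrix ι ι ℂ} (h : nn M) (x y : ι → ℂ) :
    qf M x ≤ 2 * qf M y + 2 * qf M (y - x) := by
  have := h.par y (-(y - x))
  rw [qf_neg_vec] at this
  simpa using this

lemma nn.add {M M' : Matrix ι ι ℂ} (h : nn M) (h' : nn M') : nn (M + M') := fun v => by
  rw [qf_add]; exact add_nonneg (h v) (h' v)

lemma nn.sum {α : Type*} {s : Finset α} {f : α → Matrix ι ι ℂ} (h : ∀ a ∈ s, nn (f a)) :
    nn (∑ a ∈ s, f a) := fun v => by
  rw [qf_sum]; exact Finset.sum_nonneg fun a ha => h a ha v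

lemma nn_conjT_mul (J : Matrix ι κ ℂ) : nn (Jᴴ * J) := fun v => by
  rw [qf_conjT_mul]; exact ns_nonneg _

lemma nn_proj {P : Matrix ι ι ℂ} (h1 : Pᴴ = P) (h2 : P * P = P) : nn P := fun v => by
  have := nn_conjT_mul P v
  rwa [h1, h2] at this

lemma ns_isometry [DecidableEq κ] {J : Matrix ι κ ℂ} (hJ : Jᴴ * J = 1) (c : κ → ℂ) :
    ns (J *ᵥ c) = ns c := by
  rw [← qf_conjT_mul, hJ, qf_one]

/-- Pythagoras for an isometry. -/
lemma ns_pyth [DecidableEq ι] [DecidableEq κ] {J : Matrix ι κ ℂ} (hJ : Jᴴ * J = 1) (v : ι → ℂ) :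
    ns (v - J *ᵥ (Jᴴ *ᵥ v)) = ns v - ns (Jᴴ *ᵥ v) := by
  have h : v - J *ᵥ (Jᴴ *ᵥ v) = (1 - J * Jᴴ) *ᵥ v := by
    rw [Matrix.sub_mulVec, Matrix.one_mulVec, Matrix.mulVec_mulVec]
  rw [h, ← qf_conjT_mul]
  have : (1 - J * Jᴴ)ᴴ * (1 - J * Jᴴ) = 1 - J * Jᴴ := by
    rw [Matrix.conjTranspose_sub, Matrix.conjTranspose_one, Matrix.conjTranspose_mul,
      Matrix.conjTranspose_conjTranspose, Matrix.sub_mul, Matrix.mul_sub, Matrix.mul_sub]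
    have : J * Jᴴ * (J * Jᴴ) = J * Jᴴ := by
      rw [Matrix.mul_assoc, ← Matrix.mul_assoc Jᴴ, hJ, Matrix.one_mul]
    rw [this]; simp
  rw [this, qf_sub, qf_one, qf_mul_conjT]

lemma ns_conj_le [DecidableEq ι] [DecidableEq κ] {J : Matrix ι κ ℂ} (hJ : Jᴴ * J = 1) (v : ι → ℂ) :
    ns (Jᴴ *ᵥ v) ≤ ns v := by
  have := ns_pyth hJ v
  have := ns_nonneg (v - J *ᵥ (Jᴴ *ᵥ v))
  linarith

lemma ns_zero_iff (v : ι → ℂ) : ns v = 0 ↔ v = 0 := by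
  simp only [ns]
  rw [Finset.sum_eq_zero_iff_of_nonneg (fun _ _ => Complex.normSq_nonneg _)]
  simp [funext_iff]

lemma ns_smul (r : ℂ) (v : ι → ℂ) : ns (r • v) = Complex.normSq r * ns v := by
  simp [ns, Finset.mul_sum]

lemma qf_smul_vec (M : Matrix ι ι ℂ) (r : ℂ) (v : ι → ℂ) :
    qf M (r • v) = Complex.normSq r * qf M v := by
  simp only [qf, Matrix.mulVec_smul, star_smul, smul_dotProduct, dotProduct_smul, smul_eq_mul]
  rw [← mul_assoc, show r * star r = (Complex.normSq r : ℂ) from Complex.mul_conj r]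
  simp

/-! ### ground energies -/

lemma ge_set_eq (H : Matrix ι ι ℂ) (Z : Set (ι → ℂ)) :
    BH.groundEnergy H Z = sInf {r : ℝ | ∃ ψ ∈ Z, ns ψ = 1 ∧ r = qf H ψ} := by
  unfold BH.groundEnergy
  congr 1
  ext r
  simp only [Set.mem_ofPred_eq, star_dot_self, qf]
  norm_cast

lemma ge_le {H : Matrix ι ι ℂ} {Z : Set (ι → ℂ)} {B : ℝ} (hB : ∀ ψ ∈ Z, ns ψ = 1 → B ≤ qf H ψ)
    {ψ : ι → ℂ} (h : ψ ∈ Z) (h1 : ns ψ = 1) : BH.groundEnergy H Z ≤ qf H ψ := by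
  rw [ge_set_eq]
  refine csInf_le ⟨B, ?_⟩ ⟨ψ, h, h1, rfl⟩
  rintro r ⟨φ, hφ, hφ1, rfl⟩
  exact hB φ hφ hφ1

lemma le_ge {H : Matrix ι ι ℂ} {Z : Set (ι → ℂ)} {B : ℝ} (hB : ∀ ψ ∈ Z, ns ψ = 1 → B ≤ qf H ψ)
    (hne : ∃ ψ ∈ Z, ns ψ = 1) : B ≤ BH.groundEnergy H Z := by
  rw [ge_set_eq]
  obtain ⟨ψ, h, h1⟩ := hne
  refine le_csInf ⟨_, ψ, h, h1, rfl⟩ ?_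
  rintro r ⟨φ, hφ, hφ1, rfl⟩
  exact hB φ hφ hφ1

/-- Normalization: scaling to a unit vector. -/
lemma exists_unit {v : ι → ℂ} (hv : v ≠ 0) : ∃ r : ℝ, 0 < r ∧ ns ((r : ℂ) • v) = 1 ∧
    r ^ 2 * ns v = 1 := by
  have h0 : 0 < ns v := lt_of_le_of_ne (ns_nonneg v) (fun h => hv ((ns_zero_iff v).1 h.symm))
  refine ⟨1 / Real.sqrt (ns v), by positivity, ?_, ?_⟩
  · rw [ns_smul, Complex.normSq_ofReal]
    have := Real.mul_self_sqrt h0.le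
    have h3 : Real.sqrt (ns v) ≠ 0 := by positivity
    field_simp
    nlinarith
  · have := Real.sq_sqrt h0.le
    rw [div_pow, this]; field_simp

/-- Homogeneous form of the ground energy lower bound. -/
lemma ge_homog {H : Matrix ι ι ℂ} {Z : Submodule ℂ (ι → ℂ)} {B b : ℝ}
    (hB : ∀ ψ ∈ Z, ns ψ = 1 → B ≤ qf H ψ) (hb : b ≤ BH.groundEnergy H (Z : Set (ι → ℂ)))
    {v : ι → ℂ} (hv : v ∈ Z) : b * ns v ≤ qf H v := by
  by_cases h0 : v = 0
  · subst h0; simp [ns, qf]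
  obtain ⟨r, hr, h1, h2⟩ := exists_unit h0
  have h3 := ge_le (Z := (Z : Set (ι → ℂ))) hB (Z.smul_mem (r : ℂ) hv) h1
  rw [qf_smul_vec, Complex.normSq_ofReal] at h3
  have h4 := hb.trans h3
  have : b * ns v * r ^ 2 ≤ qf H v * r ^ 2 := by
    have h5 : b * ns v * r ^ 2 = b * (r ^ 2 * ns v) := by ring
    rw [h5, h2]; nlinarith
  exact le_of_mul_le_mul_right this (by positivity)

/-- The minimum over all unit vectors is attained. -/
lemma ge_attained [Nonempty ι] (H : Matrix ι ι ℂ) :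
    ∃ ψ : ι → ℂ, ns ψ = 1 ∧ qf H ψ = BH.groundEnergy H Set.univ := by
  classical
  have hc1 : Continuous (fun ψ : ι → ℂ => ns ψ) := by
    unfold ns; exact continuous_finsetSum _ fun i _ => Complex.continuous_normSq.comp (continuous_apply i)
  have hc2 : Continuous (fun ψ : ι → ℂ => qf H ψ) := by
    unfold qf
    exact Complex.continuous_re.comp (Continuous.dotProduct continuous_star
      (Continuous.matrix_mulVec continuous_const continuous_id))
  have hK : IsCompact {ψ : ι → ℂ | ns ψ = 1} := by
    refine Metric.isCompact_of_isClosed_isBounded (isClosed_eq hc1 continuous_const) ?_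
    refine (Metric.isBounded_closedBall (x := (0 : ι → ℂ)) (r := 1)).subset ?_
    intro ψ hψ
    rw [mem_closedBall_zero_iff, pi_norm_le_iff_of_nonneg zero_le_one]
    intro i
    have h1 : Complex.normSq (ψ i) ≤ 1 := by
      rw [← (hψ : ns ψ = 1)]
      exact Finset.single_le_sum (f := fun i => Complex.normSq (ψ i))
        (fun _ _ => Complex.normSq_nonneg _) (Finset.mem_univ i)
    rw [Complex.normSq_eq_norm_sq] at h1
    nlinarith [norm_nonneg (ψ i)]
  have hne : {ψ : ι → ℂ | ns ψ = 1}.Nonempty := by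
    obtain ⟨i⟩ := ‹Nonempty ι›
    refine ⟨Pi.single i 1, ?_⟩
    simp only [Set.mem_ofPred_eq, ns]
    rw [Finset.sum_eq_single i] <;> simp +contextual
  obtain ⟨ψ, hψ, hmin⟩ := hK.exists_isMinOn hne hc2.continuousOn
  refine ⟨ψ, hψ, le_antisymm ?_ ?_⟩
  · exact le_ge (fun φ _ h => hmin h) ⟨ψ, trivial, hψ⟩
  · exact ge_le (B := qf H ψ) (fun φ _ h => hmin h) trivial hψ

end lin

end OCL

open scoped Matrix
open GG

namespace OCL

set_option linter.unusedSectionVars false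

section tens
variable {α β γ : Type*} [Fintype α] [Fintype β] [Fintype γ] [DecidableEq α] [DecidableEq β]
  {N : ℕ}

/-- Tensor product of matrices. -/
noncomputable def TT (M : Fin N → Matrix α β ℂ) : Matrix (Fin N → α) (Fin N → β) ℂ :=
  Matrix.of fun x y => ∏ w, M w (x w) (y w)

lemma TT_mul (M : Fin N → Matrix α β ℂ) (M' : Fin N → Matrix β γ ℂ) :
    TT M * TT M' = TT (fun w => M w * M' w) := by
  ext x z
  simp only [TT, Matrix.mul_apply, Matrix.of_apply]
  classical
  rw [Finset.prod_univ_sum, Fintype.piFinset_univ]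
  exact Finset.sum_congr rfl fun y _ => Finset.prod_mul_distrib.symm

lemma TT_conj (M : Fin N → Matrix α β ℂ) : (TT M)ᴴ = TT (fun w => (M w)ᴴ) := by
  ext x y
  simp [TT, Matrix.conjTranspose_apply]

lemma TT_one : TT (fun _ : Fin N => (1 : Matrix α α ℂ)) = 1 := by
  ext x y
  simp only [TT, Matrix.of_apply, Matrix.one_apply]
  rw [Finset.prod_ite_zero]
  simp [funext_iff]

lemma onFactor_eq (M : Matrix α α ℂ) (w : Fin N) :
    BH.onFactor N M w = TT (Function.update (fun _ => (1 : Matrix α α ℂ)) w M) := by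
  ext x y
  simp only [TT, BH.onFactor, Matrix.of_apply]
  rw [← Finset.mul_prod_erase Finset.univ _ (Finset.mem_univ w), Function.update_self, mul_comm]
  congr 1
  have : ∀ u ∈ Finset.univ.erase w, Function.update (fun _ => (1 : Matrix α α ℂ)) w M u (x u) (y u)
      = if x u = y u then 1 else 0 := by
    intro u hu
    rw [Function.update_of_ne (Finset.ne_of_mem_erase hu), Matrix.one_apply]
  rw [Finset.prod_congr rfl this, Finset.prod_ite_zero]
  simp

lemma onFactor_one (w : Fin N) : BH.onFactor N (1 : Matrix α α ℂ) w = 1 := by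
  rw [onFactor_eq, ← TT_one]; congr 1; ext; simp

lemma onFactor_add (M M' : Matrix α α ℂ) (w : Fin N) :
    BH.onFactor N (M + M') w = BH.onFactor N M w + BH.onFactor N M' w := by
  ext x y; simp [BH.onFactor, mul_add]

lemma onFactor_smul (r : ℂ) (M : Matrix α α ℂ) (w : Fin N) :
    BH.onFactor N (r • M) w = r • BH.onFactor N M w := by
  ext x y; simp [BH.onFactor]

/-- Resummation by resampling coordinate `w`. -/
lemma sum_resample {A : Type*} [AddCommMonoid A] (w : Fin N) (F : (Fin N → α) → A) :
    ∑ x : Fin N → α, ∑ v : α, F (Function.update x w v) = Fintype.card α • ∑ x, F x := by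
  have h1 : ∑ p : (Fin N → α) × α, F (Function.update p.1 w p.2) = ∑ p : (Fin N → α) × α, F p.1 := by
    refine Fintype.sum_bijective (fun p : (Fin N → α) × α => (Function.update p.1 w p.2, p.1 w))
      ?_ _ _ (fun p => rfl)
    refine Function.Involutive.bijective ?_
    rintro ⟨x, v⟩
    simp
  rw [Fintype.sum_prod_type, Fintype.sum_prod_type] at h1
  rw [h1]
  simp [Finset.sum_const, Finset.smul_sum]

/-- One-body quadratic form by slices. -/
lemma qf_onFactor_aux (M : Matrix α α ℂ) (w : Fin N) (ψ : (Fin N → α) → ℂ) :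
    (Fintype.card α : ℝ) * qf (BH.onFactor N M w) ψ
      = ∑ x : Fin N → α, qf M (fun v => ψ (Function.update x w v)) := by
  have key : ∀ x : Fin N → α, ∑ y, starRingEnd ℂ (ψ x) * BH.onFactor N M w x y * ψ y
      = ∑ v', starRingEnd ℂ (ψ x) * M (x w) v' * ψ (Function.update x w v') := by
    intro x
    symm
    refine Finset.sum_of_injOn (fun v' => Function.update x w v') ?_ (by simp) ?_ ?_
    · intro a _ b _ h
      have := congrFun h w
      simpa using this
    · intro y _ hy
      have : ¬ ∀ u, u ≠ w → x u = y u := by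
        intro h
        refine hy ⟨y w, by simp, ?_⟩
        ext u
        by_cases hu : u = w
        · subst hu; simp
        · simp [hu, h u hu]
      simp [BH.onFactor, this]
    · intro v' _
      have : ∀ u, u ≠ w → x u = Function.update x w v' u := by
        intro u hu; simp [hu]
      simp only [BH.onFactor, Matrix.of_apply, if_pos this]
      simp
  rw [qf_apply, Finset.sum_congr rfl (fun x _ => key x)]
  have h2 := sum_resample w (fun x : Fin N → α =>
    (∑ v', starRingEnd ℂ (ψ x) * M (x w) v' * ψ (Function.update x w v')))
  rw [nsmul_eq_mul] at h2
  have h3 := congrArg Complex.re h2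
  rw [Complex.mul_re] at h3
  simp only [Complex.natCast_re, Complex.natCast_im, zero_mul, sub_zero] at h3
  rw [← h3, Complex.re_sum]
  refine Finset.sum_congr rfl fun x _ => ?_
  rw [qf_apply]
  simp

lemma ns_resample (w : Fin N) (ψ : (Fin N → α) → ℂ) :
    (Fintype.card α : ℝ) * ns ψ = ∑ x : Fin N → α, ns (fun v => ψ (Function.update x w v)) := by
  rw [← qf_one, ← onFactor_one w, qf_onFactor_aux]
  simp [qf_one]

lemma nn_onFactor {M : Matrix α α ℂ} (h : nn M) (w : Fin N) : nn (BH.onFactor N M w) := by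
  intro ψ
  rcases isEmpty_or_nonempty α with he | he
  · have : IsEmpty (Fin N → α) := ⟨fun f => he.elim (f w)⟩
    rw [qf_apply]; simp
  have h1 := qf_onFactor_aux M w ψ
  have h2 : 0 ≤ ∑ x : Fin N → α, qf M (fun v => ψ (Function.update x w v)) :=
    Finset.sum_nonneg fun x _ => h _
  have h3 : (0 : ℝ) < Fintype.card α := by exact_mod_cast Fintype.card_pos
  rw [← h1] at h2
  exact nonneg_of_mul_nonneg_right h2 h3

/-- Monotonicity. -/
lemma qf_onFactor_mono {M M' : Matrix α α ℂ} (h : ∀ v, qf M v ≤ qf M' v) (w : Fin N)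
    (ψ : (Fin N → α) → ℂ) : qf (BH.onFactor N M w) ψ ≤ qf (BH.onFactor N M' w) ψ := by
  have h1 : nn (M' - M) := fun v => by rw [qf_sub]; linarith [h v]
  have h2 := nn_onFactor h1 w ψ
  have h3 : BH.onFactor N M' w = BH.onFactor N M w + BH.onFactor N (M' - M) w := by
    rw [← onFactor_add]; simp
  rw [h3, qf_add]; linarith

/-- Compression by an isometry. -/
lemma compress_onFactor {J : Matrix α β ℂ} (hJ : Jᴴ * J = 1) (M : Matrix α α ℂ) (w : Fin N) :
    (TT fun _ : Fin N => J)ᴴ * BH.onFactor N M w * (TT fun _ : Fin N => J)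
      = BH.onFactor N (Jᴴ * M * J) w := by
  rw [onFactor_eq, onFactor_eq, TT_conj, TT_mul, TT_mul]
  congr 1
  funext u
  by_cases hu : u = w
  · subst hu; simp
  · simp [hu, hJ]

lemma TT_isometry {J : Matrix α β ℂ} (hJ : Jᴴ * J = 1) :
    (TT fun _ : Fin N => J)ᴴ * (TT fun _ : Fin N => J) = 1 := by
  rw [TT_conj, TT_mul, hJ, TT_one]

/-- `1 - P^{⊗N} ≤ Σ_w (1 - P^{(w)})`. -/
lemma proj_union {P : Matrix α α ℂ} (h1 : Pᴴ = P) (h2 : P * P = P) (ψ : (Fin N → α) → ℂ) :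
    ns ψ - qf (TT fun _ : Fin N => P) ψ ≤ ∑ w : Fin N, (ns ψ - qf (BH.onFactor N P w) ψ) := by
  set Q : Finset (Fin N) → Matrix (Fin N → α) (Fin N → α) ℂ :=
    fun s => TT (fun w => if w ∈ s then P else 1) with hQ
  have hQh : ∀ s, (Q s)ᴴ = Q s := by
    intro s; simp only [hQ]; rw [TT_conj]; congr 1; funext w; split_ifs <;> simp [h1]
  have hQm : ∀ s t, Q s * Q t = Q (s ∪ t) := by
    intro s t; simp only [hQ]; rw [TT_mul]; congr 1; funext w
    by_cases hs : w ∈ s <;> by_cases ht : w ∈ t <;> simp [hs, ht, h2]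
  have hQw : ∀ w, Q {w} = BH.onFactor N P w := by
    intro w; rw [onFactor_eq]; simp only [hQ]; congr 1; funext u
    by_cases hu : u = w
    · subst hu; simp
    · simp [hu]
  have main : ∀ s : Finset (Fin N), ns ψ - qf (Q s) ψ ≤ ∑ w ∈ s, (ns ψ - qf (BH.onFactor N P w) ψ) := by
    intro s
    induction s using Finset.induction_on with
    | empty =>
      have : Q ∅ = 1 := by simp only [hQ]; simp [TT_one]
      rw [this, qf_one]; simp
    | insert w s hw ih =>
      rw [Finset.sum_insert hw]
      have e1 : Q (insert w s) = Q s * Q {w} := by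
        rw [hQm]; congr 1; rw [Finset.union_comm]; rfl
      have comm : Q s * Q {w} = Q {w} * Q s := by rw [hQm, hQm, Finset.union_comm]
      have idm : ∀ s, Q s * Q s = Q s := fun s => by rw [hQm, Finset.union_self]
      have hD : nn (1 - Q {w} - Q s + Q s * Q {w}) := by
        apply nn_proj
        · simp only [Matrix.conjTranspose_add, Matrix.conjTranspose_sub, Matrix.conjTranspose_one,
            Matrix.conjTranspose_mul, hQh, comm]
        · have e2 : 1 - Q {w} - Q s + Q s * Q {w} = (1 - Q s) * (1 - Q {w}) := by noncomm_ring
          have e3 : (1 - Q {w}) * (1 - Q s) = (1 - Q s) * (1 - Q {w}) := by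
            have : (1 - Q {w}) * (1 - Q s) = 1 - Q {w} - Q s + Q {w} * Q s := by noncomm_ring
            rw [this, ← comm, e2]
          have e4 : ∀ s, (1 - Q s) * (1 - Q s) = 1 - Q s := by
            intro s
            have : (1 - Q s) * (1 - Q s) = 1 - Q s - Q s + Q s * Q s := by noncomm_ring
            rw [this, idm]; abel
          rw [e2]
          calc (1 - Q s) * (1 - Q {w}) * ((1 - Q s) * (1 - Q {w}))
              = (1 - Q s) * ((1 - Q {w}) * (1 - Q s)) * (1 - Q {w}) := by simp only [Matrix.mul_assoc]
            _ = ((1 - Q s) * (1 - Q s)) * ((1 - Q {w}) * (1 - Q {w})) := by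
              rw [e3]; simp only [Matrix.mul_assoc]
            _ = _ := by rw [e4, e4]
      have := hD ψ
      rw [qf_add, qf_sub, qf_sub, qf_one, ← e1, hQw] at this
      linarith
  have := main Finset.univ
  simpa [hQ] using this

end tens

end OCL

open scoped Matrix
open GG

namespace OCL

section sym
set_option linter.unusedSectionVars false
variable {α β : Type*} [Fintype α] [Fintype β] [DecidableEq α] [DecidableEq β] {N : ℕ}

lemma symm_TT (J : Matrix α β ℂ) {c : (Fin N → β) → ℂ} (hc : c ∈ BH.symmStates β N) :
    (TT (fun _ : Fin N => J)) *ᵥ c ∈ BH.symmStates α N := by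
  intro σ x
  simp only [Matrix.mulVec, dotProduct, TT, Matrix.of_apply]
  refine Fintype.sum_equiv (Equiv.arrowCongr σ (Equiv.refl β)) _ _ ?_
  intro y
  have h1 : (Equiv.arrowCongr σ (Equiv.refl β)) y = y ∘ σ.symm := rfl
  rw [h1, hc]
  congr 1
  refine Fintype.prod_equiv σ _ _ ?_
  intro w
  simp

lemma symm_add {c d : (Fin N → β) → ℂ} (hc : c ∈ BH.symmStates β N) (hd : d ∈ BH.symmStates β N) :
    c + d ∈ BH.symmStates β N := fun σ x => by simp [hc σ x, hd σ x]

/-- Pair interaction energy. -/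
noncomputable def intPair (w w' : Fin N) (ψ : (Fin N → α) → ℂ) : ℝ :=
  ∑ x : Fin N → α, if x w = x w' then Complex.normSq (ψ x) else 0

lemma qf_diag {ι : Type*} [Fintype ι] [DecidableEq ι] (d : ι → ℝ) (v : ι → ℂ) :
    qf (Matrix.of fun x y => if x = y then (d x : ℂ) else 0) v = ∑ x, d x * Complex.normSq (v x) := by
  rw [qf_apply]
  simp only [Matrix.of_apply, mul_ite, mul_zero, ite_mul, zero_mul, Finset.sum_ite_eq,
    Finset.mem_univ, if_true, Complex.re_sum]
  refine Finset.sum_congr rfl fun x _ => ?_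
  rw [mul_comm _ (d x : ℂ), mul_assoc, ← Complex.normSq_eq_conj_mul_self]
  simp

lemma qf_interaction' (ψ : (Fin N → α) → ℂ) :
    qf (BH.interaction α N) ψ = ∑ x : Fin N → α, (((Finset.univ : Finset (Fin N × Fin N)).filter
          fun p => p.1 ≠ p.2 ∧ x p.1 = x p.2).card : ℝ) * Complex.normSq (ψ x) := by
  rw [← qf_diag]; simp [BH.interaction]

lemma qf_interaction (ψ : (Fin N → α) → ℂ) :
    qf (BH.interaction α N) ψ =
      ∑ p : Fin N × Fin N, if p.1 ≠ p.2 then intPair p.1 p.2 ψ else 0 := by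
  rw [qf_interaction']
  have : ∀ x : Fin N → α, (((Finset.univ : Finset (Fin N × Fin N)).filter
          fun p => p.1 ≠ p.2 ∧ x p.1 = x p.2).card : ℝ) * Complex.normSq (ψ x)
      = ∑ p : Fin N × Fin N, if p.1 ≠ p.2 then
          (if x p.1 = x p.2 then Complex.normSq (ψ x) else 0) else 0 := by
    intro x
    rw [Finset.card_filter]
    push_cast
    rw [Finset.sum_mul]
    refine Finset.sum_congr rfl fun p _ => ?_
    by_cases h1 : p.1 = p.2 <;> by_cases h2 : x p.1 = x p.2 <;> simp [h1, h2]
  rw [Finset.sum_congr rfl fun x _ => this x, Finset.sum_comm]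
  refine Finset.sum_congr rfl fun p _ => ?_
  split_ifs
  · rfl
  · simp

lemma intPair_nonneg (w w' : Fin N) (ψ : (Fin N → α) → ℂ) : 0 ≤ intPair w w' ψ :=
  Finset.sum_nonneg fun x _ => by split_ifs; exacts [Complex.normSq_nonneg _, le_rfl]

lemma nn_interaction : nn (BH.interaction α N) := fun ψ => by
  rw [qf_interaction]
  exact Finset.sum_nonneg fun p _ => by split_ifs; exacts [intPair_nonneg _ _ _, le_rfl]

lemma interaction_le (ψ : (Fin N → α) → ℂ) : qf (BH.interaction α N) ψ ≤ (N : ℝ) ^ 2 * ns ψ := by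
  rw [qf_interaction', ns, Finset.mul_sum]
  refine Finset.sum_le_sum fun x _ => ?_
  refine mul_le_mul_of_nonneg_right ?_ (Complex.normSq_nonneg _)
  have := Finset.card_filter_le (Finset.univ : Finset (Fin N × Fin N))
    (fun p => p.1 ≠ p.2 ∧ x p.1 = x p.2)
  simp only [Finset.card_univ, Fintype.card_prod, Fintype.card_fin] at this
  have h2 : (((Finset.univ : Finset (Fin N × Fin N)).filter
          fun p => p.1 ≠ p.2 ∧ x p.1 = x p.2).card : ℝ) ≤ ((N * N : ℕ) : ℝ) := by exact_mod_cast this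
  push_cast at h2
  nlinarith

/-- Replace coordinates `w`, `w'`. -/
def upd2 (w w' : Fin N) (x : Fin N → β) (a b : β) : Fin N → β :=
  Function.update (Function.update x w a) w' b

lemma sum_upd2 (w w' : Fin N) (F : (Fin N → β) → ℝ) :
    ∑ x : Fin N → β, ∑ a, ∑ b, F (upd2 w w' x a b) = (Fintype.card β : ℝ) ^ 2 * ∑ x, F x := by
  unfold upd2
  have h1 := sum_resample w (fun x : Fin N → β => ∑ b, F (Function.update x w' b))
  have h2 := sum_resample w' F
  rw [h1, h2]
  simp only [nsmul_eq_mul]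
  ring

lemma TT_pair_apply {w w' : Fin N} (hw : w ≠ w') (g : β → ℂ) (c : (Fin N → β) → ℂ) (l : Fin N → β) :
    (TT (fun u : Fin N => if u ∈ ({w, w'} : Finset (Fin N)) then
      (Matrix.of fun _ m => g m : Matrix β β ℂ) else 1) *ᵥ c) l
      = ∑ p : β × β, g p.1 * g p.2 * c (upd2 w w' l p.1 p.2) := by
  simp only [Matrix.mulVec, dotProduct]
  have hval : ∀ l' : Fin N → β, TT (fun u : Fin N => if u ∈ ({w, w'} : Finset (Fin N)) then
      (Matrix.of fun _ m => g m : Matrix β β ℂ) else 1) l l'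
      = (if ∀ u, u ≠ w → u ≠ w' → l u = l' u then (1 : ℂ) else 0) * (g (l' w) * g (l' w')) := by
    intro l'
    simp only [TT, Matrix.of_apply]
    rw [← Finset.prod_sdiff (Finset.subset_univ ({w, w'} : Finset (Fin N)))]
    congr 1
    · have : ∀ u ∈ Finset.univ \ ({w, w'} : Finset (Fin N)),
          (if u ∈ ({w, w'} : Finset (Fin N)) then
            (Matrix.of fun _ m => g m : Matrix β β ℂ) else 1) (l u) (l' u)
          = if l u = l' u then 1 else 0 := by
        intro u hu
        rw [if_neg (Finset.mem_sdiff.1 hu).2, Matrix.one_apply]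
      rw [Finset.prod_congr rfl this, Finset.prod_ite_zero]
      simp
    · rw [Finset.prod_pair hw]
      simp
  symm
  refine Finset.sum_of_injOn (fun p : β × β => upd2 w w' l p.1 p.2) ?_ (by simp) ?_ ?_
  · rintro ⟨a, b⟩ _ ⟨a', b'⟩ _ h
    have h1 := congrFun h w
    have h2 := congrFun h w'
    simp only [upd2] at h1 h2
    simp [hw] at h1 h2
    simp [h1, h2]
  · intro y _ hy
    rw [hval]
    have : ¬ ∀ u, u ≠ w → u ≠ w' → l u = y u := by
      intro h
      refine hy ⟨(y w, y w'), by simp, ?_⟩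
      ext u
      simp only [upd2]
      by_cases hu' : u = w'
      · subst hu'; simp
      · by_cases hu : u = w
        · subst hu; simp [hu']
        · simp [hu, hu', h u hu hu']
    simp [this]
  · rintro ⟨a, b⟩ _
    rw [hval]
    have : ∀ u, u ≠ w → u ≠ w' → l u = upd2 w w' l a b u := by
      intro u hu hu'
      simp [upd2, hu, hu']
    simp only [if_pos this]
    simp [upd2, hw]

/-- The pair interaction on lifted states, in terms of coefficients. -/
lemma intPair_TT {J : Matrix α β ℂ} (hJ : Jᴴ * J = 1) {w w' : Fin N} (hw : w ≠ w')
    (c : (Fin N → β) → ℂ) :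
    (Fintype.card β : ℝ) ^ 2 * intPair w w' ((TT fun _ : Fin N => J) *ᵥ c)
      = ∑ l : Fin N → β, ∑ k : α,
        Complex.normSq (∑ p : β × β, J k p.1 * J k p.2 * c (upd2 w w' l p.1 p.2)) := by
  classical
  rw [Finset.sum_comm]
  set s : Finset (Fin N) := {w, w'} with hs
  have h1 : intPair w w' ((TT fun _ : Fin N => J) *ᵥ c) = ∑ k : α, qf (TT (fun u : Fin N =>
      if u ∈ s then (Matrix.single k k (1 : ℂ)) else 1)) ((TT fun _ : Fin N => J) *ᵥ c) := by
    set ψ := (TT fun _ : Fin N => J) *ᵥ c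
    have : ∀ k, TT (fun u : Fin N => if u ∈ s then (Matrix.single k k (1 : ℂ)) else 1)
        = Matrix.of fun x y : Fin N → α => if x = y then
          (((if x w = k ∧ x w' = k then 1 else 0 : ℝ)) : ℂ) else 0 := by
      intro k
      ext x y
      simp only [TT, Matrix.of_apply]
      rw [← Finset.prod_sdiff (Finset.subset_univ s)]
      have e1 : ∀ u ∈ Finset.univ \ s, (if u ∈ s then Matrix.single k k (1 : ℂ) else 1) (x u) (y u)
          = if x u = y u then 1 else 0 := by
        intro u hu
        rw [if_neg (Finset.mem_sdiff.1 hu).2, Matrix.one_apply]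
      rw [Finset.prod_congr rfl e1, Finset.prod_ite_zero, hs, Finset.prod_pair hw]
      simp only [Finset.mem_insert, Finset.mem_singleton, true_or, or_true, if_true,
        Matrix.single_apply]
      by_cases hxy : x = y
      · subst hxy
        by_cases ha : k = x w
        · by_cases hb : k = x w'
          · simp [← ha, ← hb]
          · have hb' : ¬ x w' = k := fun h => hb h.symm
            simp [hb, hb']
        · have ha' : ¬ x w = k := fun h => ha h.symm
          simp [ha, ha']
      · rw [if_neg hxy]
        by_contra hcon
        apply hxy
        funext u
        have hne := hcon
        by_cases hu : u ∈ s
        · rw [hs] at hu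
          simp only [Finset.mem_insert, Finset.mem_singleton] at hu
          rcases hu with rfl | rfl
          · by_contra hne2
            apply hcon
            by_cases q1 : k = x u
            · have : ¬ (k = y u) := fun h => hne2 (q1.symm.trans h)
              simp [this]
            · simp [q1]
          · by_contra hne2
            apply hcon
            by_cases q1 : k = x u
            · have : ¬ (k = y u) := fun h => hne2 (q1.symm.trans h)
              simp [this]
            · simp [q1]
        · by_contra hne2
          apply hcon
          rw [if_neg]
          · simp
          · intro hh
            exact hne2 (hh u (by rw [← hs]; simp [hu]))
    simp_rw [this, qf_diag]
    rw [Finset.sum_comm]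
    unfold intPair
    refine Finset.sum_congr rfl fun x _ => ?_
    rw [← Finset.sum_mul]
    by_cases hx : x w = x w'
    · rw [if_pos hx, ← hx]; simp
    · rw [if_neg hx]
      have : ∀ k ∈ (Finset.univ : Finset α), (if x w = k ∧ x w' = k then (1 : ℝ) else 0) = 0 := by
        intro k _
        rw [if_neg]
        rintro ⟨h, h'⟩
        exact hx (h.trans h'.symm)
      rw [Finset.sum_eq_zero this, zero_mul]
  rw [h1, Finset.mul_sum]
  refine Finset.sum_congr rfl fun k _ => ?_
  have h2 : ∀ l, (∑ p : β × β, J k p.1 * J k p.2 * c (upd2 w w' l p.1 p.2))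
    = (TT (fun u : Fin N => if u ∈ s then
      (Matrix.of fun _ m => J k m : Matrix β β ℂ) else 1) *ᵥ c) l := fun l =>
    (TT_pair_apply hw (J k) c l).symm
  simp_rw [h2]
  change _ = ns _
  rw [← qf_conjT_mul, ← qf_comp, TT_conj, TT_conj, TT_mul, TT_mul, TT_mul]
  have h3 : ((Fintype.card β : ℝ) ^ 2 : ℝ) = ((Fintype.card β : ℝ) ^ 2) := rfl
  rw [← qf_smul]
  congr 1
  ext l l'
  simp only [TT, Matrix.smul_apply, Matrix.of_apply, smul_eq_mul]
  have h4 : (((Fintype.card β : ℝ) ^ 2 : ℝ) : ℂ) = ∏ u : Fin N, (if u ∈ s then (Fintype.card β : ℂ) else 1) := by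
    rw [Finset.prod_ite_mem, Finset.univ_inter, hs, Finset.prod_pair hw]
    push_cast; ring
  rw [h4, ← Finset.prod_mul_distrib]
  refine Finset.prod_congr rfl fun u _ => ?_
  by_cases hu : u ∈ s
  · simp only [if_pos hu, Matrix.mul_apply, Matrix.conjTranspose_apply, Matrix.of_apply,
      Matrix.single_apply, Finset.sum_const, nsmul_eq_mul, Finset.card_univ]
    congr 1
    rw [Finset.sum_eq_single k]
    · rw [Finset.sum_eq_single k]
      · simp
      · intro b _ hb
        simp [hb.symm]
      · simp
    · intro b _ hb
      simp [hb.symm]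
    · simp
  · simp only [if_neg hu, Matrix.mul_one, Matrix.conjTranspose_one, hJ, one_mul]

/-- From a two-body inequality to the pair interaction. -/
lemma intPair_lower {J : Matrix α β ℂ} (hJ : Jᴴ * J = 1) {w w' : Fin N} (hw : w ≠ w')
    {conf : β → β → Prop} [∀ a b, Decidable (conf a b)] {g : ℝ}
    (h2 : ∀ f : β → β → ℂ, (∀ a b, f a b = f b a) →
      g * (∑ p : β × β, if conf p.1 p.2 then Complex.normSq (f p.1 p.2) else 0)
        ≤ ∑ k : α, Complex.normSq (∑ p : β × β, J k p.1 * J k p.2 * f p.1 p.2))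
    {c : (Fin N → β) → ℂ} (hc : c ∈ BH.symmStates β N) :
    g * (∑ l : Fin N → β, if conf (l w) (l w') then Complex.normSq (c l) else 0)
      ≤ intPair w w' ((TT fun _ : Fin N => J) *ᵥ c) := by
  rcases isEmpty_or_nonempty β with he | he
  · have : IsEmpty (Fin N → β) := ⟨fun f => he.elim (f w)⟩
    simpa using intPair_nonneg _ _ _
  have hcard : (0 : ℝ) < (Fintype.card β : ℝ) ^ 2 := by
    have : (0 : ℝ) < Fintype.card β := by exact_mod_cast Fintype.card_pos
    positivity
  refine le_of_mul_le_mul_left ?_ hcard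
  rw [intPair_TT hJ hw]
  have h3 := sum_upd2 w w' (fun l : Fin N → β => if conf (l w) (l w') then Complex.normSq (c l) else 0)
  have h4 : (Fintype.card β : ℝ) ^ 2 * (g * (∑ l : Fin N → β, if conf (l w) (l w') then Complex.normSq (c l) else 0))
     = ∑ l : Fin N → β, g * (∑ p : β × β, if conf p.1 p.2 then Complex.normSq (c (upd2 w w' l p.1 p.2)) else 0) := by
    rw [mul_left_comm, ← h3, Finset.mul_sum]
    refine Finset.sum_congr rfl fun l _ => ?_
    rw [Fintype.sum_prod_type]
    simp [upd2, hw]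
  rw [h4]
  refine Finset.sum_le_sum fun l _ => ?_
  refine h2 (fun a b => c (upd2 w w' l a b)) ?_
  intro a b
  rw [← hc (Equiv.swap w w')]
  congr 1
  funext u
  simp only [upd2, Function.comp]
  by_cases h1 : u = w
  · subst h1; simp [hw]
  · by_cases h2 : u = w'
    · subst h2; simp [hw]
    · rw [Equiv.swap_apply_of_ne_of_ne h1 h2]; simp [h1, h2]

/-- No interaction energy on nonconflicting coefficients. -/
lemma int_zero {J : Matrix α β ℂ} {conf : β → β → Prop}
    (h0 : ∀ k a b, ¬ conf a b → J k a * J k b = 0) {c : (Fin N → β) → ℂ}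
    (hc : ∀ l, (∃ w w', w ≠ w' ∧ conf (l w) (l w')) → c l = 0) :
    qf (BH.interaction α N) ((TT fun _ : Fin N => J) *ᵥ c) = 0 := by
  rw [qf_interaction]
  refine Finset.sum_eq_zero fun p _ => ?_
  split_ifs with hp
  · refine Finset.sum_eq_zero fun x _ => ?_
    split_ifs with hx
    · rw [map_eq_zero]
      simp only [Matrix.mulVec, dotProduct]
      refine Finset.sum_eq_zero fun l _ => ?_
      by_cases hl : conf (l p.1) (l p.2)
      · rw [hc l ⟨_, _, hp, hl⟩, mul_zero]
      · have : TT (fun _ : Fin N => J) x l = 0 := by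
          simp only [TT, Matrix.of_apply]
          rw [← Finset.prod_sdiff (Finset.subset_univ ({p.1, p.2} : Finset (Fin N))),
            Finset.prod_pair hp, hx, h0 _ _ _ hl, mul_zero]
        rw [this, zero_mul]
    · rfl
  · rfl

end sym

end OCL

open scoped Matrix
open GG

namespace OCL

lemma omega_prim : IsPrimitiveRoot omega 8 := by
  have := Complex.isPrimitiveRoot_exp 8 (by norm_num)
  convert this using 1
  unfold omega
  congr 1
  push_cast; ring

lemma omega8 : omega ^ 8 = 1 := omega_prim.pow_eq_one

lemma omega_eq : omega = ((Real.sqrt 2 / 2 : ℝ) : ℂ) + ((Real.sqrt 2 / 2 : ℝ) : ℂ) * Complex.I := by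
  unfold omega
  rw [show (Real.pi : ℂ) * Complex.I / 4 = ((Real.pi / 4 : ℝ) : ℂ) * Complex.I by push_cast; ring,
    Complex.exp_mul_I, ← Complex.ofReal_cos, ← Complex.ofReal_sin, Real.cos_pi_div_four,
    Real.sin_pi_div_four]

lemma omega2 : omega ^ 2 = Complex.I := by
  have h : (Real.sqrt 2) * (Real.sqrt 2) = 2 := Real.mul_self_sqrt (by norm_num)
  apply Complex.ext
  · simp [omega_eq, pow_two]
  · simp [omega_eq, pow_two]; nlinarith

lemma omega4 : omega ^ 4 = -1 := by
  rw [show (4 : ℕ) = 2 * 2 from rfl, pow_mul, omega2, Complex.I_sq]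

/-- The character of `ℤ/8`. -/
noncomputable def ch (d : Fin 8) : ℂ := omega ^ (d : ℕ)

lemma ch_inj {a b : Fin 8} (h : ch a = ch b) : a = b :=
  Fin.ext (omega_prim.pow_inj a.2 b.2 h)

lemma ch_zero : ch 0 = 1 := by simp [ch]

lemma ch_add (a b : Fin 8) : ch (a + b) = ch a * ch b := by
  simp only [ch, ← pow_add, Fin.val_add]
  conv_rhs => rw [← Nat.mod_add_div (a.val + b.val) 8, pow_add, pow_mul, omega8, one_pow, mul_one]

lemma ch_normSq (a : Fin 8) : Complex.normSq (ch a) = 1 := by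
  have h : ‖ch a‖ = 1 := by
    have : ‖omega‖ = 1 := omega_prim.norm'_eq_one (by norm_num)
    simp [ch, this]
  rw [Complex.normSq_eq_norm_sq, h]; norm_num

lemma ch_mul_conj (a : Fin 8) : ch a * starRingEnd ℂ (ch a) = 1 := by
  rw [Complex.mul_conj, ch_normSq]; simp

lemma ch_neg (a : Fin 8) : ch (-a) = starRingEnd ℂ (ch a) := by
  have h1 : ch a * ch (-a) = 1 := by rw [← ch_add]; simp [ch_zero]
  have h2 := ch_mul_conj a
  have h3 : ch a ≠ 0 := fun h => by simp [h] at h1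
  exact mul_left_cancel₀ h3 (h1.trans h2.symm)

lemma fin8_mul_add (k a b : Fin 8) : k * (a + b) = k * a + k * b := by
  revert k a b; decide
lemma fin8_add_mul (k a b : Fin 8) : (a + b) * k = a * k + b * k := by
  revert k a b; decide
lemma fin8_mul_neg (k a : Fin 8) : k * (-a) = -(k * a) := by
  revert k a; decide

lemma ch_orth (d : Fin 8) : ∑ k : Fin 8, ch (k * d) = if d = 0 then 8 else 0 := by
  split_ifs with h
  · subst h; simp [ch_zero]
  · have h1 : ch d * ∑ k : Fin 8, ch (k * d) = ∑ k : Fin 8, ch (k * d) := by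
      rw [Finset.mul_sum]
      refine Fintype.sum_equiv (Equiv.addRight 1) _ _ ?_
      intro k
      rw [Equiv.coe_addRight, fin8_add_mul, ch_add, mul_comm]
      congr 2
      revert d; decide
    have h2 : ch d ≠ 1 := fun h' => h (ch_inj (h'.trans ch_zero.symm))
    have h3 : (ch d - 1) * ∑ k : Fin 8, ch (k * d) = 0 := by rw [sub_mul, h1]; ring
    rcases mul_eq_zero.1 h3 with h4 | h4
    · exact absurd (sub_eq_zero.1 h4) h2
    · exact h4

/-- `1/√8`. -/
noncomputable def s8 : ℂ := ((1 : ℝ) / Real.sqrt 8 : ℝ)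

lemma s8_sq : s8 * s8 = 1 / 8 := by
  unfold s8
  rw [← Complex.ofReal_mul]
  have h : (Real.sqrt 8) * (Real.sqrt 8) = 8 := Real.mul_self_sqrt (by norm_num)
  have : (1 / Real.sqrt 8) * (1 / Real.sqrt 8) = 1 / 8 := by
    rw [div_mul_div_comm, h]; norm_num
  rw [this]; push_cast; rfl

lemma s8_conj : starRingEnd ℂ s8 = s8 := by unfold s8; exact Complex.conj_ofReal _

lemma s8_normSq : Complex.normSq s8 = 1 / 8 := by
  have : (Complex.normSq s8 : ℂ) = ((1 / 8 : ℝ) : ℂ) := by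
    rw [← Complex.mul_conj, s8_conj, s8_sq]; push_cast; rfl
  exact_mod_cast this

/-- Fourier transform in the ancilla. -/
noncomputable def ft (k : Fin 8) (a : Fin 8 → ℂ) : ℂ := s8 * ∑ j, ch (k * j) * a j

lemma parseval (m : Fin 8) (a b : Fin 8 → ℂ) :
    ∑ j, starRingEnd ℂ (a (j + m)) * b j
      = ∑ k, ch (k * m) * (starRingEnd ℂ (ft k a) * ft k b) := by
  have h1 : ∀ k, ch (k * m) * (starRingEnd ℂ (ft k a) * ft k b)
      = ∑ i, ∑ j, (1 / 8) * (starRingEnd ℂ (a i) * b j) * ch (k * (m + -i + j)) := by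
    intro k
    simp only [ft, map_mul, map_sum, s8_conj]
    rw [show ∀ A B C : ℂ, A * (s8 * B * (s8 * C)) = (s8 * s8) * (A * (B * C)) by intros; ring, s8_sq,
      Finset.sum_mul_sum, Finset.mul_sum, Finset.mul_sum]
    refine Finset.sum_congr rfl fun i _ => ?_
    rw [Finset.mul_sum, Finset.mul_sum]
    refine Finset.sum_congr rfl fun j _ => ?_
    rw [← ch_neg, fin8_mul_add, fin8_mul_add, ch_add, ch_add, fin8_mul_neg]
    ring
  simp_rw [h1]
  rw [Finset.sum_comm]
  have h2 : ∀ i : Fin 8, ∑ k, ∑ j, (1 / 8) * (starRingEnd ℂ (a i) * b j) * ch (k * (m + -i + j))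
      = starRingEnd ℂ (a i) * b (i - m) := by
    intro i
    rw [Finset.sum_comm]
    simp_rw [← Finset.mul_sum, ch_orth]
    rw [Finset.sum_eq_single (i - m)]
    · have : m + -i + (i - m) = 0 := by abel
      rw [if_pos this]; ring
    · intro j _ hj
      rw [if_neg]
      · ring
      · intro h
        apply hj
        have : j = (m + -i + j) + (i - m) := by abel
        rw [this, h]; simp
    · simp
  simp_rw [h2]
  refine Fintype.sum_equiv (Equiv.addRight m) _ _ ?_
  intro j; simp

lemma parseval_ns (a : Fin 8 → ℂ) :
    ∑ j, Complex.normSq (a j) = ∑ k, Complex.normSq (ft k a) := by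
  have := parseval 0 a a
  simp only [add_zero, mul_zero, ch_zero, one_mul, ← Complex.normSq_eq_conj_mul_self] at this
  exact_mod_cast this

end OCL

open scoped Matrix
open GG

namespace OCL

lemma poincare8 (f : Fin 8 → ℝ) :
    (1 / 4) * (∑ t, f t ^ 2 - (∑ t, f t) ^ 2 / 8) ≤ ∑ t : Fin 8, (f (t + 1) - f t) ^ 2 := by
  have h : ∑ t : Fin 8, (f (t + 1) - f t) ^ 2 - (1 / 4) * (∑ t, f t ^ 2 - (∑ t, f t) ^ 2 / 8) =
      (57/32)*((1)*f 0 + (-31/57)*f 1 + (1/57)*f 2 + (1/57)*f 3 + (1/57)*f 4 + (1/57)*f 5 + (1/57)*f 6 + (-31/57)*f 7)^2 +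
      (143/114)*((1)*f 1 + (-217/286)*f 2 + (1/26)*f 3 + (1/26)*f 4 + (1/26)*f 5 + (1/26)*f 6 + (-113/286)*f 7)^2 +
      (1211/1144)*((1)*f 2 + (-1067/1211)*f 3 + (11/173)*f 4 + (11/173)*f 5 + (11/173)*f 6 + (-375/1211)*f 7)^2 +
      (1159/1211)*((1)*f 3 + (-4417/4636)*f 4 + (7/76)*f 5 + (7/76)*f 6 + (-1073/4636)*f 7)^2 +
      (16797/18544)*((1)*f 4 + (-16531/16797)*f 5 + (61/509)*f 6 + (-2279/16797)*f 7)^2 +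
      (29869/33594)*((1)*f 5 + (-495/502)*f 6 + (-7/502)*f 7)^2 +
      (1785/2008)*((1)*f 6 + (-1)*f 7)^2 := by
    simp only [Fin.sum_univ_eight]
    simp only [show (0 : Fin 8) + 1 = 1 from rfl, show (1 : Fin 8) + 1 = 2 from rfl,
      show (2 : Fin 8) + 1 = 3 from rfl, show (3 : Fin 8) + 1 = 4 from rfl,
      show (4 : Fin 8) + 1 = 5 from rfl, show (5 : Fin 8) + 1 = 6 from rfl,
      show (6 : Fin 8) + 1 = 7 from rfl, show (7 : Fin 8) + 1 = 0 from rfl]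
    ring
  have h2 : 0 ≤ ∑ t : Fin 8, (f (t + 1) - f t) ^ 2 - (1 / 4) * (∑ t, f t ^ 2 - (∑ t, f t) ^ 2 / 8) := by
    rw [h]; positivity
  linarith

lemma poincare8C (f : Fin 8 → ℂ) :
    (1 / 4) * (∑ t, Complex.normSq (f t) - Complex.normSq (∑ t, f t) / 8)
      ≤ ∑ t : Fin 8, Complex.normSq (f (t + 1) - f t) := by
  have h1 := poincare8 (fun t => (f t).re)
  have h2 := poincare8 (fun t => (f t).im)
  have e : ∀ z : ℂ, Complex.normSq z = z.re ^ 2 + z.im ^ 2 := fun z => by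
    rw [Complex.normSq_apply]; ring
  simp only [e, Finset.sum_add_distrib, Complex.re_sum, Complex.im_sum, Complex.sub_re,
    Complex.sub_im]
  linarith

/-- Exponent table: `-√2 U_t` has entries `ω^(mt t x z)`. -/
def mt : Fin 8 → Fin 2 → Fin 2 → Fin 8 :=
  ![![![4, 4], ![4, 0]], ![![4, 4], ![4, 0]], ![![4, 5], ![4, 1]], ![![4, 4], ![3, 7]],
    ![![4, 5], ![4, 1]], ![![4, 4], ![3, 7]], ![![4, 4], ![4, 0]], ![![4, 4], ![4, 0]]]

lemma sqrt2_mul_inv : (Real.sqrt 2 : ℂ) * ((1 / Real.sqrt 2 : ℝ) : ℂ) = 1 := by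
  rw [← Complex.ofReal_mul, mul_one_div_cancel (by positivity)]; simp

lemma sqrt2_Hmat : (Real.sqrt 2 : ℂ) • Hmat = !![1, 1; 1, -1] := by
  have h := sqrt2_mul_inv
  unfold Hmat
  ext i j
  simp only [Matrix.smul_apply, smul_eq_mul, Complex.real_smul, ← mul_assoc, h, one_mul]

lemma ch4 : ch 4 = -1 := omega4
lemma ch5 : ch 5 = -omega := by
  have : ch 5 = omega ^ 5 := rfl
  rw [this, show (5 : ℕ) = 4 + 1 from rfl, pow_add, omega4]; ring
lemma ch1 : ch 1 = omega := by simp [ch]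
lemma conj_omega : starRingEnd ℂ omega = omega ^ 7 := by
  rw [← ch1, ← ch_neg, ch1]; rfl
lemma ch3 : ch 3 = omega ^ 3 := rfl
lemma ch7 : ch 7 = omega ^ 7 := rfl

lemma om7 : omega ^ 7 = - omega ^ 3 := by
  rw [show (7 : ℕ) = 4 + 3 from rfl, pow_add, omega4]; ring

lemma sqrt2_HT : (Real.sqrt 2 : ℂ) • (Hmat * Tmat) = !![1, omega; 1, -omega] := by
  rw [← Matrix.smul_mul, sqrt2_Hmat, Tmat]
  ext i j; fin_cases i <;> fin_cases j <;> simp [Matrix.mul_apply, Fin.sum_univ_two]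

lemma sqrt2_HTc : (Real.sqrt 2 : ℂ) • (Hmat * Tmat)ᴴ = !![1, 1; omega ^ 7, - omega ^ 7] := by
  have : (Real.sqrt 2 : ℂ) • (Hmat * Tmat)ᴴ = ((Real.sqrt 2 : ℂ) • (Hmat * Tmat))ᴴ := by
    rw [Matrix.conjTranspose_smul]; simp
  rw [this, sqrt2_HT]
  ext i j; fin_cases i <;> fin_cases j <;> simp [Matrix.conjTranspose_apply, conj_omega]

lemma gate_ch (t : Fin 8) (x z : Fin 2) : (-(Real.sqrt 2) : ℂ) * gate t x z = ch (mt t x z) := by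
  have h1 : ∀ i j, (-(Real.sqrt 2) : ℂ) * Hmat i j = ch (![![4, 4], ![4, 0]] i j) := by
    intro i j
    have := congrFun (congrFun sqrt2_Hmat i) j
    rw [Matrix.smul_apply, smul_eq_mul] at this
    rw [neg_mul, this]
    fin_cases i <;> fin_cases j <;> simp [ch4, ch_zero]
  have h2 : ∀ i j, (-(Real.sqrt 2) : ℂ) * (Hmat * Tmat) i j = ch (![![4, 5], ![4, 1]] i j) := by
    intro i j
    have := congrFun (congrFun sqrt2_HT i) j
    rw [Matrix.smul_apply, smul_eq_mul] at this
    rw [neg_mul, this]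
    fin_cases i <;> fin_cases j <;> simp [ch4, ch5, ch1]
  have h3 : ∀ i j, (-(Real.sqrt 2) : ℂ) * (Hmat * Tmat)ᴴ i j = ch (![![4, 4], ![3, 7]] i j) := by
    intro i j
    have := congrFun (congrFun sqrt2_HTc i) j
    rw [Matrix.smul_apply, smul_eq_mul] at this
    rw [neg_mul, this]
    fin_cases i <;> fin_cases j <;> simp [ch4, ch3, ch7, om7]
  fin_cases t
  exacts [h1 x z, h1 x z, h2 x z, h3 x z, h2 x z, h3 x z, h1 x z, h1 x z]

/-- Hopping half. -/
noncomputable def K0 : Matrix G0V G0V ℂ :=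
  Matrix.of fun p q => if p.2.1 = q.2.1 + 1 ∧ mt q.2.1 p.1 q.1 = p.2.2 - q.2.2 then 1 else 0

lemma Hprop0_eq : Hprop0 = K0 + K0ᴴ := by
  have hB : ∀ t x z i j, Bmat ((-(Real.sqrt 2) : ℂ) • gate t) (x, i) (z, j)
      = if mt t x z = i - j then (1 : ℂ) else 0 := by
    intro t x z i j
    have h := gate_ch t x z
    simp only [Bmat, Matrix.of_apply]
    refine if_congr ⟨fun h' => ch_inj (h.symm.trans h'), fun h' => h.trans (by rw [h']; rfl)⟩ rfl rfl
  ext ⟨x, s, i⟩ ⟨z, t, j⟩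
  simp only [Hprop0, Matrix.of_apply, K0, Matrix.add_apply, Matrix.conjTranspose_apply,
    Finset.sum_add_distrib, hB]
  rw [add_comm]
  congr 1
  · rw [Finset.sum_eq_single t]
    · by_cases h : s = t + 1 <;> simp [h]
    · intro b _ hb; simp [hb.symm]
    · simp
  · rw [Finset.sum_eq_single s]
    · by_cases h : t = s + 1 <;> simp [h]
    · intro b _ hb; simp [hb.symm]
    · simp

lemma qf_conjT {ι : Type*} [Fintype ι] (M : Matrix ι ι ℂ) (v : ι → ℂ) : qf Mᴴ v = qf M v := by
  unfold qf
  have : star (star v ⬝ᵥ (M *ᵥ v)) = star v ⬝ᵥ (Mᴴ *ᵥ v) := by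
    rw [← Matrix.star_dotProduct_star, star_star, Matrix.star_mulVec, dotProduct_comm,
      ← dotProduct_comm, Matrix.dotProduct_mulVec]
  rw [← this]; simp

/-- Fourier coefficients in the ancilla. -/
noncomputable def fv (v : G0V → ℂ) (k : Fin 8) (x : Fin 2) (t : Fin 8) : ℂ :=
  ft k (fun j => v (x, t, j))

noncomputable def Fk (k : Fin 8) (u : Fin 2 → Fin 8 → ℂ) : ℂ :=
  ∑ t, ∑ z, ∑ x, ch (k * mt t x z) * (starRingEnd ℂ (u x (t + 1)) * u z t)

noncomputable def nu (u : Fin 2 → Fin 8 → ℂ) : ℝ := ∑ t, ∑ x, Complex.normSq (u x t)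

noncomputable def pen (k : Fin 8) : ℝ := (ch (k * 3) + ch (k * 4) + ch (k * 5)).re

lemma ns_fv (v : G0V → ℂ) : ns v = ∑ k, nu (fv v k) := by
  simp only [ns, nu, Fintype.sum_prod_type, fv]
  have e : ∀ x t, ∑ j, Complex.normSq (v (x, t, j)) = ∑ k, Complex.normSq (ft k fun j => v (x, t, j)) :=
    fun x t => parseval_ns (fun j => v (x, t, j))
  simp only [e]
  rw [show (∑ x : Fin 2, ∑ t : Fin 8, ∑ k : Fin 8, Complex.normSq (ft k fun j => v (x, t, j)))
    = ∑ t : Fin 8, ∑ x : Fin 2, ∑ k : Fin 8, Complex.normSq (ft k fun j => v (x, t, j)) from Finset.sum_comm]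
  rw [show (∑ k : Fin 8, ∑ t : Fin 8, ∑ x : Fin 2, Complex.normSq (ft k fun j => v (x, t, j)))
    = ∑ t : Fin 8, ∑ k : Fin 8, ∑ x : Fin 2, Complex.normSq (ft k fun j => v (x, t, j)) from Finset.sum_comm]
  exact Finset.sum_congr rfl fun t _ => Finset.sum_comm

lemma qf_K0 (v : G0V → ℂ) : qf K0 v = ∑ k, (Fk k (fv v k)).re := by
  rw [qf_apply, ← Complex.re_sum]
  congr 1
  rw [Finset.sum_comm]
  have h1 : ∀ z t, ∑ j, ∑ p, starRingEnd ℂ (v p) * K0 p (z, t, j) * v (z, t, j)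
      = ∑ x, ∑ j, starRingEnd ℂ (v (x, t + 1, j + mt t x z)) * v (z, t, j) := by
    intro z t
    rw [Finset.sum_comm' (t' := Finset.univ) (s' := fun _ => Finset.univ) (by simp)]
    simp only [Fintype.sum_prod_type]
    refine Finset.sum_congr rfl fun x _ => ?_
    rw [Finset.sum_eq_single (t + 1)]
    · rw [Finset.sum_comm]
      refine Finset.sum_congr rfl fun j _ => ?_
      rw [Finset.sum_eq_single (j + mt t x z)]
      · simp [K0]
      · intro i _ hi
        have : mt t x z ≠ i - j := fun h => hi (by rw [h]; abel)
        simp [K0, this]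
      · simp
    · intro s _ hs; simp [K0, hs]
    · simp
  have h3 : ∀ z t x, ∑ j, starRingEnd ℂ (v (x, t + 1, j + mt t x z)) * v (z, t, j)
      = ∑ k, ch (k * mt t x z) * (starRingEnd ℂ (ft k fun j => v (x, t + 1, j)) *
        ft k fun j => v (z, t, j)) :=
    fun z t x => parseval (mt t x z) (fun j => v (x, t + 1, j)) (fun j => v (z, t, j))
  have h2 : ∑ q : G0V, ∑ p, starRingEnd ℂ (v p) * K0 p q * v q
      = ∑ z, ∑ t, ∑ x, ∑ k, ch (k * mt t x z) * (starRingEnd ℂ (ft k fun j => v (x, t + 1, j)) *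
        ft k fun j => v (z, t, j)) := by
    rw [Fintype.sum_prod_type]
    refine Finset.sum_congr rfl fun z _ => ?_
    rw [Fintype.sum_prod_type]
    refine Finset.sum_congr rfl fun t _ => ?_
    rw [h1]
    exact Finset.sum_congr rfl fun x _ => h3 z t x
  rw [h2]
  simp only [Fk, fv]
  rw [Finset.sum_comm]
  rw [show (∑ k : Fin 8, ∑ t : Fin 8, ∑ z : Fin 2, ∑ x : Fin 2, ch (k * mt t x z) *
    ((starRingEnd ℂ) (ft k fun j => v (x, t + 1, j)) * ft k fun j => v (z, t, j))) =
    ∑ t : Fin 8, ∑ k : Fin 8, ∑ z : Fin 2, ∑ x : Fin 2, ch (k * mt t x z) *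
    ((starRingEnd ℂ) (ft k fun j => v (x, t + 1, j)) * ft k fun j => v (z, t, j)) from Finset.sum_comm]
  refine Finset.sum_congr rfl fun t _ => ?_
  rw [Finset.sum_comm' (s := (Finset.univ : Finset (Fin 8))) (t' := Finset.univ) (s' := fun _ => Finset.univ) (by simp)]
  refine Finset.sum_congr rfl fun z _ => ?_
  rw [Finset.sum_comm]

open scoped Fin.NatCast in
lemma S8_pow (m : ℕ) (i j : Fin 8) : (S8 ^ m) i j = if i = j + ((m : ℕ) : Fin 8) then 1 else 0 := by
  induction m generalizing i with
  | zero => simp [Matrix.one_apply]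
  | succ m ih =>
    rw [pow_succ', Matrix.mul_apply, Finset.sum_eq_single (j + ((m : ℕ) : Fin 8))]
    · rw [ih]; simp [S8, add_assoc]
    · intro b _ hb; rw [ih, if_neg hb, mul_zero]
    · simp

open scoped Fin.NatCast in
lemma qf_Hpen0 (v : G0V → ℂ) : qf Hpen0 v = ∑ k, pen k * nu (fv v k) := by
  have h0 : ∀ m : ℕ, ∀ x t, ∑ i, ∑ j, starRingEnd ℂ (v (x, t, i)) * (S8 ^ m) i j * v (x, t, j)
      = ∑ k, ch (k * ((m : ℕ) : Fin 8)) * (Complex.normSq (fv v k x t) : ℂ) := by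
    intro m x t
    rw [Finset.sum_comm]
    have := parseval ((m : ℕ) : Fin 8) (fun j => v (x, t, j)) (fun j => v (x, t, j))
    simp only [← Complex.normSq_eq_conj_mul_self] at this
    simp only [fv]
    rw [← this]
    refine Finset.sum_congr rfl fun j _ => ?_
    rw [Finset.sum_eq_single (j + ((m : ℕ) : Fin 8))]
    · rw [S8_pow, if_pos rfl, mul_one]
    · intro b _ hb; rw [S8_pow, if_neg hb]; simp
    · simp
  have h1 : ∑ i, ∑ j, starRingEnd ℂ (v i) * Hpen0 i j * v j
      = ∑ x, ∑ t, ∑ k, (ch (k * 3) + ch (k * 4) + ch (k * 5)) * (Complex.normSq (fv v k x t) : ℂ) := by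
    rw [Fintype.sum_prod_type]
    refine Finset.sum_congr rfl fun x _ => ?_
    rw [Fintype.sum_prod_type]
    refine Finset.sum_congr rfl fun t _ => ?_
    have : ∀ i, ∑ j, starRingEnd ℂ (v (x, t, i)) * Hpen0 (x, t, i) j * v j
        = ∑ j, starRingEnd ℂ (v (x, t, i)) * (S8 ^ 3 + S8 ^ 4 + S8 ^ 5) i j * v (x, t, j) := by
      intro i
      rw [Fintype.sum_prod_type, Finset.sum_eq_single x]
      · rw [Fintype.sum_prod_type, Finset.sum_eq_single t]
        · simp [Hpen0]
        · intro s _ hs; simp [Hpen0, hs.symm]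
        · simp
      · intro s _ hs; simp [Hpen0, hs.symm]
      · simp
    simp_rw [this, Matrix.add_apply, mul_add, add_mul, Finset.sum_add_distrib]
    rw [h0 3 x t, h0 4 x t, h0 5 x t]
    rfl
  rw [qf_apply, h1]
  simp only [Complex.re_sum]
  have h2 : ∀ k x t, ((ch (k * 3) + ch (k * 4) + ch (k * 5)) * (Complex.normSq (fv v k x t) : ℂ)).re
      = pen k * Complex.normSq (fv v k x t) := by
    intro k x t; rw [Complex.re_mul_ofReal]; rfl
  simp_rw [h2, nu, Finset.mul_sum]
  rw [Finset.sum_comm]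
  rw [Finset.sum_comm (s := (Finset.univ : Finset (Fin 8))) (t := (Finset.univ : Finset (Fin 8)))]
  refine Finset.sum_congr rfl fun t _ => ?_
  rw [Finset.sum_comm]

lemma qf_Ag0 (v : G0V → ℂ) :
    qf Ag0 v = ∑ k, (2 * (Fk k (fv v k)).re + pen k * nu (fv v k)) := by
  rw [Ag0, qf_add, Hprop0_eq, qf_add, qf_conjT, qf_K0, qf_Hpen0, Finset.sum_add_distrib,
    ← Finset.mul_sum]
  ring

end OCL

open scoped Matrix
open GG

namespace OCL

lemma unit_cross (c a b : ℂ) (hc : Complex.normSq c = 1) :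
    -(Complex.normSq a + Complex.normSq b) ≤ 2 * (c * (starRingEnd ℂ a * b)).re := by
  have h := Complex.normSq_nonneg (a + c * b)
  rw [Complex.normSq_add, Complex.normSq_mul, hc] at h
  have h2 : (a * starRingEnd ℂ (c * b)).re = (c * (starRingEnd ℂ a * b)).re := by
    rw [← Complex.conj_re]; congr 1; simp; ring
  rw [h2] at h; linarith

lemma form_generic (k : Fin 8) (u : Fin 2 → Fin 8 → ℂ) : -4 * nu u ≤ 2 * (Fk k u).re := by
  have h1 : ∑ t : Fin 8, ∑ z : Fin 2, ∑ x : Fin 2,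
      -(Complex.normSq (u x (t + 1)) + Complex.normSq (u z t)) = -4 * nu u := by
    have h2 : ∑ t : Fin 8, ∑ x, Complex.normSq (u x (t + 1)) = nu u :=
      Fintype.sum_equiv (Equiv.addRight 1) _ _ (fun t => rfl)
    have h3 : ∀ t : Fin 8, ∑ z : Fin 2, ∑ x : Fin 2,
      -(Complex.normSq (u x (t + 1)) + Complex.normSq (u z t))
      = -2 * ∑ x, Complex.normSq (u x (t + 1)) - 2 * ∑ x, Complex.normSq (u x t) := by
      intro t; simp only [Fin.sum_univ_two]; ring
    simp_rw [h3]
    rw [Finset.sum_sub_distrib, ← Finset.mul_sum, ← Finset.mul_sum, h2]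
    unfold nu; ring
  rw [← h1, Fk]
  simp only [Complex.re_sum, Finset.mul_sum]
  exact Finset.sum_le_sum fun t _ => Finset.sum_le_sum fun z _ => Finset.sum_le_sum fun x _ =>
    unit_cross _ _ _ (ch_normSq _)

lemma ch_re0 : (ch 0).re = 1 := by simp [ch_zero]
lemma ch_re1 : (ch 1).re = Real.sqrt 2 / 2 := by simp [ch1, omega_eq]
lemma ch_re2 : (ch 2).re = 0 := by
  have : ch 2 = omega ^ 2 := rfl
  rw [this, omega2]; simp
lemma ch_add4 (a : Fin 8) : (ch (a + 4)).re = -(ch a).re := by rw [ch_add, ch4]; simp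
lemma ch_reneg (a : Fin 8) : (ch (-a)).re = (ch a).re := by rw [ch_neg]; simp
lemma ch_re3 : (ch 3).re = -(Real.sqrt 2 / 2) := by
  have := ch_add4 (-1); rw [ch_reneg, ch_re1] at this; exact this
lemma ch_re4 : (ch 4).re = -1 := by have := ch_add4 0; rw [ch_re0] at this; exact this
lemma ch_re5 : (ch 5).re = -(Real.sqrt 2 / 2) := by
  have := ch_add4 1; rw [ch_re1] at this; exact this
lemma ch_re6 : (ch 6).re = 0 := by have := ch_add4 2; rw [ch_re2] at this; simpa using this
lemma ch_re7 : (ch 7).re = Real.sqrt 2 / 2 := by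
  have := ch_reneg 1; rw [ch_re1] at this; exact this

lemma pen1 : pen 1 = -1 - Real.sqrt 2 := by
  have : pen 1 = (ch 3).re + (ch 4).re + (ch 5).re := by simp [pen]
  rw [this, ch_re3, ch_re4, ch_re5]; ring
lemma pen7 : pen 7 = -1 - Real.sqrt 2 := by
  have : pen 7 = (ch 5).re + (ch 4).re + (ch 3).re := by simp only [pen, Complex.add_re]; rfl
  rw [this, ch_re3, ch_re4, ch_re5]; ring

lemma pen_ge (k : Fin 8) (h1 : k ≠ 1) (h7 : k ≠ 7) : -1 ≤ pen k := by
  have hs : (1 : ℝ) ≤ Real.sqrt 2 := Real.one_le_sqrt.2 (by norm_num)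
  have e : ∀ k, pen k = (ch (k * 3)).re + (ch (k * 4)).re + (ch (k * 5)).re := fun k => rfl
  rw [e]
  fin_cases k
  · change -1 ≤ (ch 0).re + (ch 0).re + (ch 0).re; rw [ch_re0]; norm_num
  · exact absurd rfl h1
  · change -1 ≤ (ch 6).re + (ch 0).re + (ch 2).re; rw [ch_re0, ch_re6, ch_re2]; norm_num
  · change -1 ≤ (ch 1).re + (ch 4).re + (ch 7).re; rw [ch_re1, ch_re4, ch_re7]; linarith
  · change -1 ≤ (ch 4).re + (ch 0).re + (ch 4).re; rw [ch_re0, ch_re4]; norm_num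
  · change -1 ≤ (ch 7).re + (ch 4).re + (ch 1).re; rw [ch_re1, ch_re4, ch_re7]; linarith
  · change -1 ≤ (ch 2).re + (ch 0).re + (ch 6).re; rw [ch_re0, ch_re6, ch_re2]; norm_num
  · exact absurd rfl h7

/-- The unitaries `W(t)` of the clock history. -/
noncomputable def Wm (t : Fin 8) : Matrix (Fin 2) (Fin 2) ℂ := Matrix.of fun x z => clockCoef z t x

lemma Hmat_herm : Hmatᴴ = Hmat := by
  unfold Hmat
  ext i j; fin_cases i <;> fin_cases j <;> simp [Matrix.conjTranspose_apply]

lemma Hmat_sq : Hmat * Hmat = 1 := by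
  have h := sqrt2_Hmat
  have h2 : ((Real.sqrt 2 : ℂ) • Hmat) * ((Real.sqrt 2 : ℂ) • Hmat) = (2 : ℂ) • (1 : Matrix (Fin 2) (Fin 2) ℂ) := by
    rw [h]; ext i j; fin_cases i <;> fin_cases j <;> simp [Matrix.mul_apply, Fin.sum_univ_two] <;> norm_num
  rw [Matrix.smul_mul, Matrix.mul_smul, smul_smul] at h2
  have h3 : (Real.sqrt 2 : ℂ) * (Real.sqrt 2 : ℂ) = 2 := by
    rw [← Complex.ofReal_mul, Real.mul_self_sqrt (by norm_num)]; simp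
  rw [h3] at h2
  exact smul_right_injective _ (by norm_num : (2 : ℂ) ≠ 0) h2

lemma Tmat_unit : Tmatᴴ * Tmat = 1 := by
  have h := ch_mul_conj 1
  rw [ch1] at h
  unfold Tmat
  ext i j; fin_cases i <;> fin_cases j <;>
    simp [Matrix.mul_apply, Fin.sum_univ_two, Matrix.conjTranspose_apply, mul_comm, h]

lemma HT_unit : (Hmat * Tmat)ᴴ * (Hmat * Tmat) = 1 := by
  rw [Matrix.conjTranspose_mul, Matrix.mul_assoc, ← Matrix.mul_assoc Hmatᴴ, Hmat_herm, Hmat_sq,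
    Matrix.one_mul, Tmat_unit]

lemma Wm_eq : Wm = ![1, Hmat, 1, Hmat * Tmat, 1, Hmat * Tmat, 1, Hmat] := by
  have h1 : ∀ t : Fin 8, t = 0 ∨ t = 2 ∨ t = 4 ∨ t = 6 → Wm t = 1 := by
    intro t ht
    ext x z
    rw [Matrix.one_apply]
    exact if_pos ht
  have h2 : ∀ t : Fin 8, ¬ (t = 0 ∨ t = 2 ∨ t = 4 ∨ t = 6) → (t = 1 ∨ t = 7) → Wm t = Hmat := by
    intro t ht ht'
    ext x z
    exact (if_neg ht).trans (if_pos ht')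
  have h3 : ∀ t : Fin 8, ¬ (t = 0 ∨ t = 2 ∨ t = 4 ∨ t = 6) → ¬ (t = 1 ∨ t = 7) → Wm t = Hmat * Tmat := by
    intro t ht ht'
    ext x z
    exact (if_neg ht).trans (if_neg ht')
  funext t
  fin_cases t
  exacts [h1 0 (by decide), h2 1 (by decide) (by decide), h1 2 (by decide), h3 3 (by decide) (by decide),
    h1 4 (by decide), h3 5 (by decide) (by decide), h1 6 (by decide), h2 7 (by decide) (by decide)]

lemma Wm_unit (t : Fin 8) : (Wm t)ᴴ * Wm t = 1 := by
  rw [Wm_eq]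
  have h1 : Hmatᴴ * Hmat = 1 := by rw [Hmat_herm, Hmat_sq]
  have h0 : (1 : Matrix (Fin 2) (Fin 2) ℂ)ᴴ * 1 = 1 := by simp
  fin_cases t
  exacts [h0, h1, h0, HT_unit, h0, HT_unit, h0, h1]

lemma Wm_unit' (t : Fin 8) : Wm t * (Wm t)ᴴ = 1 := mul_eq_one_comm.1 (Wm_unit t)

lemma Wm_step (t : Fin 8) : gate t * Wm t = Wm (t + 1) := by
  rw [Wm_eq]
  have a0 : Hmat * (1 : Matrix (Fin 2) (Fin 2) ℂ) = Hmat := Matrix.mul_one _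
  have a1 : (Hmat * Tmat) * (1 : Matrix (Fin 2) (Fin 2) ℂ) = Hmat * Tmat := Matrix.mul_one _
  fin_cases t
  exacts [a0, Hmat_sq, a1, HT_unit, a1, HT_unit, a0, Hmat_sq]

lemma dot_conj_re (a b : Fin 2 → ℂ) : ns (a - b) = ns a + ns b - 2 * (star a ⬝ᵥ b).re := by
  simp only [ns, Pi.sub_apply, Complex.normSq_sub, Finset.sum_sub_distrib, Finset.sum_add_distrib,
    dotProduct, Complex.re_sum, Finset.mul_sum]
  congr 1
  refine Finset.sum_congr rfl fun i _ => ?_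
  congr 1
  rw [← Complex.conj_re]; congr 1; simp

/-- Rotated amplitudes. -/
noncomputable def rot (u : Fin 2 → Fin 8 → ℂ) (t : Fin 8) : Fin 2 → ℂ := (Wm t)ᴴ *ᵥ (fun x => u x t)

lemma ns_rot (u : Fin 2 → Fin 8 → ℂ) (t : Fin 8) : ns (rot u t) = ∑ x, Complex.normSq (u x t) := by
  unfold rot
  rw [ns_isometry (by rw [Matrix.conjTranspose_conjTranspose, Wm_unit'])]; rfl

lemma nu_rot (u : Fin 2 → Fin 8 → ℂ) : nu u = ∑ t, ns (rot u t) := by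
  simp_rw [ns_rot]; rfl

lemma Fk_one (u : Fin 2 → Fin 8 → ℂ) :
    (Fk 1 u).re = - Real.sqrt 2 * ∑ t, (star (rot u (t + 1)) ⬝ᵥ rot u t).re := by
  have h : Fk 1 u = (-(Real.sqrt 2) : ℂ) * ∑ t, (star (rot u (t + 1)) ⬝ᵥ rot u t) := by
    rw [Fk, Finset.mul_sum]
    refine Finset.sum_congr rfl fun t _ => ?_
    have e : star (rot u (t + 1)) ⬝ᵥ rot u t
        = star (fun x => u x (t + 1)) ⬝ᵥ (gate t *ᵥ (fun x => u x t)) := by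
      rw [rot, rot, ← Wm_step, Matrix.star_mulVec, Matrix.conjTranspose_conjTranspose,
        ← Matrix.dotProduct_mulVec, Matrix.mulVec_mulVec, Matrix.mul_assoc, Wm_unit', Matrix.mul_one]
    rw [e]
    simp only [dotProduct, Matrix.mulVec, Finset.mul_sum]
    rw [Finset.sum_comm]
    refine Finset.sum_congr rfl fun z _ => Finset.sum_congr rfl fun x _ => ?_
    rw [one_mul, ← gate_ch]
    simp only [Pi.star_apply, RCLike.star_def]
    ring
  rw [h, ← Complex.re_sum]
  rw [show (-(Real.sqrt 2) : ℂ) = ((-Real.sqrt 2 : ℝ) : ℂ) by push_cast; rfl, Complex.re_ofReal_mul]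

lemma form_one (u : Fin 2 → Fin 8 → ℂ) :
    2 * (Fk 1 u).re + pen 1 * nu u - e1 * nu u = Real.sqrt 2 * ∑ t, ns (rot u (t + 1) - rot u t) := by
  have h2 : ∑ t : Fin 8, ns (rot u (t + 1)) = nu u := by
    rw [nu_rot]; exact Fintype.sum_equiv (Equiv.addRight 1) _ _ (fun t => rfl)
  simp_rw [dot_conj_re, Finset.sum_sub_distrib, Finset.sum_add_distrib, h2, ← nu_rot, ← Finset.mul_sum]
  rw [Fk_one, pen1, e1]; ring

noncomputable def cj (u : Fin 2 → Fin 8 → ℂ) : Fin 2 → Fin 8 → ℂ := fun x t => starRingEnd ℂ (u x t)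

lemma nu_cj (u : Fin 2 → Fin 8 → ℂ) : nu (cj u) = nu u := by simp [nu, cj]

lemma Fk_seven (u : Fin 2 → Fin 8 → ℂ) : (Fk 7 u).re = (Fk 1 (cj u)).re := by
  rw [← Complex.conj_re (Fk 7 u)]
  congr 1
  simp only [Fk, map_sum, map_mul, cj]
  refine Finset.sum_congr rfl fun t _ => Finset.sum_congr rfl fun z _ => Finset.sum_congr rfl fun x _ => ?_
  rw [← ch_neg]
  congr 2
  generalize mt t x z = m
  revert m; decide

lemma form_seven (u : Fin 2 → Fin 8 → ℂ) :
    2 * (Fk 7 u).re + pen 7 * nu u - e1 * nu u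
      = Real.sqrt 2 * ∑ t, ns (rot (cj u) (t + 1) - rot (cj u) t) := by
  rw [← form_one, Fk_seven, nu_cj, pen7, pen1]

lemma rot_gap (u : Fin 2 → Fin 8 → ℂ) :
    (1 / 5) * (nu u - ∑ z, Complex.normSq (s8 * ∑ t, rot u t z))
      ≤ Real.sqrt 2 * ∑ t, ns (rot u (t + 1) - rot u t) := by
  have h := fun z => poincare8C (fun t => rot u t z)
  have h' := Finset.sum_le_sum (fun z (_ : z ∈ (Finset.univ : Finset (Fin 2))) => h z)
  have e1 : ∑ z : Fin 2, ∑ t : Fin 8, Complex.normSq (rot u (t + 1) z - rot u t z)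
      = ∑ t, ns (rot u (t + 1) - rot u t) := by
    rw [Finset.sum_comm]; rfl
  have e2 : nu u = ∑ z : Fin 2, ∑ t, Complex.normSq (rot u t z) := by
    rw [nu_rot, Finset.sum_comm]; rfl
  rw [e1, ← Finset.mul_sum, Finset.sum_sub_distrib, ← e2, ← Finset.sum_div] at h'
  simp_rw [Complex.normSq_mul, s8_normSq, ← Finset.mul_sum]
  have hs : (1 : ℝ) ≤ Real.sqrt 2 := Real.one_le_sqrt.2 (by norm_num)
  have h0 : 0 ≤ ∑ t, ns (rot u (t + 1) - rot u t) := Finset.sum_nonneg fun _ _ => ns_nonneg _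
  nlinarith

lemma sqrt2_bd : (1.41 : ℝ) ≤ Real.sqrt 2 := by
  apply Real.le_sqrt_of_sq_le; norm_num

/-- Ground state matrix of `g₀`. -/
noncomputable def J1 : Matrix G0V (Fin 2 × Fin 2) ℂ := Matrix.of fun p l => psi l.1 l.2 p

lemma omegaVec_eq (j : Fin 8) : omegaVec j = s8 * ch (-j) := by
  unfold omegaVec
  rw [show (((1 : ℝ) / Real.sqrt 8 : ℝ) : ℂ) = s8 from rfl]
  congr 1
  have h0 : omega ≠ 0 := omega_prim.ne_zero (by norm_num)
  have h1 : ch j * ch (-j) = 1 := by rw [← ch_add]; simp [ch_zero]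
  rw [zpow_neg, zpow_natCast]
  have h2 : omega ^ (j : ℕ) ≠ 0 := pow_ne_zero _ h0
  exact (eq_inv_of_mul_eq_one_right h1).symm

lemma psi0 (z : Fin 2) (x : Fin 2) (t j : Fin 8) :
    psi z 0 (x, t, j) = s8 * Wm t x z * (s8 * ch (-j)) := by
  rw [← omegaVec_eq]; simp [psi, s8, Wm]

lemma psi1 (z : Fin 2) (x : Fin 2) (t j : Fin 8) :
    psi z 1 (x, t, j) = s8 * starRingEnd ℂ (Wm t x z) * (s8 * ch j) := by
  have : psi z 1 (x, t, j) = starRingEnd ℂ (psi z 0 (x, t, j)) := by simp [psi]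
  rw [this, psi0]
  simp only [map_mul, s8_conj, ← ch_neg, neg_neg]

lemma overlap0 (v : G0V → ℂ) (z : Fin 2) :
    (J1ᴴ *ᵥ v) (z, 0) = s8 * ∑ t, rot (fv v 1) t z := by
  simp only [Matrix.mulVec, dotProduct, Matrix.conjTranspose_apply, J1, Matrix.of_apply,
    Fintype.sum_prod_type, psi0, rot, fv, ft, Finset.mul_sum]
  rw [Finset.sum_comm]
  refine Finset.sum_congr rfl fun t _ => Finset.sum_congr rfl fun x _ => Finset.sum_congr rfl fun j _ => ?_
  simp only [RCLike.star_def, map_mul, s8_conj, ← ch_neg, neg_neg, one_mul]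
  ring

lemma overlap1 (v : G0V → ℂ) (z : Fin 2) :
    starRingEnd ℂ ((J1ᴴ *ᵥ v) (z, 1)) = s8 * ∑ t, rot (cj (fv v 7)) t z := by
  simp only [Matrix.mulVec, dotProduct, Matrix.conjTranspose_apply, J1, Matrix.of_apply,
    Fintype.sum_prod_type, psi1, rot, fv, ft, Finset.mul_sum, cj, map_sum]
  rw [Finset.sum_comm]
  refine Finset.sum_congr rfl fun t _ => Finset.sum_congr rfl fun x _ => Finset.sum_congr rfl fun j _ => ?_
  have h7 : -((7 : Fin 8) * j) = j := by revert j; decide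
  simp only [RCLike.star_def, map_mul, s8_conj, ← ch_neg, neg_neg, Complex.conj_conj, h7]
  ring

lemma ns_overlap (v : G0V → ℂ) : ns (J1ᴴ *ᵥ v) =
    ∑ z, Complex.normSq (s8 * ∑ t, rot (fv v 1) t z)
      + ∑ z, Complex.normSq (s8 * ∑ t, rot (cj (fv v 7)) t z) := by
  simp_rw [← overlap0, ← overlap1, Complex.normSq_conj]
  rw [← Finset.sum_add_distrib, ns, Fintype.sum_prod_type]
  refine Finset.sum_congr rfl fun z _ => ?_
  rw [Fin.sum_univ_two]

/-- Spectral gap of `g₀` above the ground space. -/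
lemma g0_gap (v : G0V → ℂ) :
    (1 / 5) * (ns v - ns (J1ᴴ *ᵥ v)) ≤ qf Ag0 v - e1 * ns v := by
  rw [qf_Ag0, ns_overlap]
  rw [show e1 * ns v = ∑ k, e1 * nu (fv v k) by rw [ns_fv, Finset.mul_sum], ns_fv v,
    ← Finset.sum_sub_distrib]
  set Q1 := ∑ z, Complex.normSq (s8 * ∑ t, rot (fv v 1) t z) with hQ1
  set Q7 := ∑ z, Complex.normSq (s8 * ∑ t, rot (cj (fv v 7)) t z) with hQ7
  have hk : ∀ k : Fin 8, (1 / 5) * (nu (fv v k) - ((if k = 1 then Q1 else 0) + if k = 7 then Q7 else 0))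
      ≤ 2 * (Fk k (fv v k)).re + pen k * nu (fv v k) - e1 * nu (fv v k) := by
    intro k
    by_cases h1 : k = 1
    · subst h1
      rw [form_one]; simpa only [if_pos, if_neg (show ¬ ((1 : Fin 8) = 7) by decide), add_zero] using rot_gap (fv v 1)
    by_cases h7 : k = 7
    · subst h7
      rw [form_seven]; simpa only [if_pos, if_neg (show ¬ ((7 : Fin 8) = 1) by decide), zero_add, nu_cj] using rot_gap (cj (fv v 7))
    · have a := form_generic k (fv v k)
      have b := pen_ge k h1 h7
      have c : 0 ≤ nu (fv v k) :=
        Finset.sum_nonneg fun _ _ => Finset.sum_nonneg fun _ _ => Complex.normSq_nonneg _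
      have d := sqrt2_bd
      simp only [h1, h7, if_false, e1]
      nlinarith [mul_nonneg (by linarith : (0:ℝ) ≤ pen k + 1) c,
        mul_nonneg (by linarith : (0:ℝ) ≤ Real.sqrt 2 - 1.41) c]
  have := Finset.sum_le_sum (fun k (_ : k ∈ (Finset.univ : Finset (Fin 8))) => hk k)
  rw [← Finset.mul_sum, Finset.sum_sub_distrib, Finset.sum_add_distrib, Finset.sum_ite_eq',
    Finset.sum_ite_eq', if_pos (Finset.mem_univ _), if_pos (Finset.mem_univ _)] at this
  exact this

lemma fv_J1 (c : Fin 2 × Fin 2 → ℂ) (k : Fin 8) (x : Fin 2) (t : Fin 8) :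
    fv (J1 *ᵥ c) k x t = (if k = 1 then s8 * ∑ z, Wm t x z * c (z, 0) else 0)
      + (if k = 7 then s8 * ∑ z, starRingEnd ℂ (Wm t x z) * c (z, 1) else 0) := by
  have h : ∀ j, (J1 *ᵥ c) (x, t, j) = (s8 * ch (-j)) * (s8 * ∑ z, Wm t x z * c (z, 0))
      + (s8 * ch j) * (s8 * ∑ z, starRingEnd ℂ (Wm t x z) * c (z, 1)) := by
    intro j
    simp only [Matrix.mulVec, dotProduct, J1, Matrix.of_apply, Fintype.sum_prod_type,
      Fin.sum_univ_two, psi0, psi1]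
    ring
  simp only [fv, ft, h]
  have e1 : ∑ j, ch (k * j) * ch (-j) = if k = 1 then 8 else 0 := by
    have := ch_orth (k - 1)
    rw [if_congr (sub_eq_zero (a := k) (b := 1)) rfl rfl] at this
    rw [← this]
    refine Finset.sum_congr rfl fun j _ => ?_
    rw [← ch_add]; congr 1; clear this; revert j k; decide
  have e2 : ∑ j, ch (k * j) * ch j = if k = 7 then 8 else 0 := by
    have := ch_orth (k + 1)
    have hk : ∀ k : Fin 8, (k + 1 = 0) ↔ (k = 7) := by decide
    rw [if_congr (hk k) rfl rfl] at this
    rw [← this]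
    refine Finset.sum_congr rfl fun j _ => ?_
    rw [← ch_add]; congr 1; clear this e1; revert j k; decide
  generalize s8 * ∑ z, Wm t x z * c (z, 0) = A
  generalize s8 * ∑ z, starRingEnd ℂ (Wm t x z) * c (z, 1) = B
  have : s8 * ∑ j, ch (k * j) * (s8 * ch (-j) * A + s8 * ch j * B)
      = (s8 * s8) * (∑ j, ch (k * j) * ch (-j)) * A + (s8 * s8) * (∑ j, ch (k * j) * ch j) * B := by
    rw [Finset.mul_sum, Finset.mul_sum, Finset.sum_mul, Finset.mul_sum, Finset.sum_mul,
      ← Finset.sum_add_distrib]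
    refine Finset.sum_congr rfl fun j _ => ?_
    ring
  rw [this, e1, e2, s8_sq]
  split_ifs <;> ring

lemma rot_J1_0 (c : Fin 2 × Fin 2 → ℂ) (t : Fin 8) :
    rot (fv (J1 *ᵥ c) 1) t = fun z => s8 * c (z, 0) := by
  have h : (fun x => fv (J1 *ᵥ c) 1 x t) = Wm t *ᵥ (fun z => s8 * c (z, 0)) := by
    funext x
    rw [fv_J1]
    simp only [if_true, Matrix.mulVec, dotProduct]
    rw [if_neg (by decide), add_zero, Finset.mul_sum]
    refine Finset.sum_congr rfl fun j _ => ?_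
    ring
  rw [rot, h, Matrix.mulVec_mulVec, Wm_unit, Matrix.one_mulVec]

lemma rot_J1_1 (c : Fin 2 × Fin 2 → ℂ) (t : Fin 8) :
    rot (cj (fv (J1 *ᵥ c) 7)) t = fun z => s8 * starRingEnd ℂ (c (z, 1)) := by
  have h : (fun x => cj (fv (J1 *ᵥ c) 7) x t) = Wm t *ᵥ (fun z => s8 * starRingEnd ℂ (c (z, 1))) := by
    funext x
    rw [cj, fv_J1]
    simp only [if_true, Matrix.mulVec, dotProduct]
    rw [if_neg (by decide), zero_add, Finset.mul_sum, map_sum]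
    refine Finset.sum_congr rfl fun j _ => ?_
    simp only [map_mul, s8_conj, Complex.conj_conj]
    ring
  rw [rot, h, Matrix.mulVec_mulVec, Wm_unit, Matrix.one_mulVec]

lemma g0_ground (c : Fin 2 × Fin 2 → ℂ) : qf Ag0 (J1 *ᵥ c) = e1 * ns (J1 *ᵥ c) := by
  have : qf Ag0 (J1 *ᵥ c) - e1 * ns (J1 *ᵥ c) = 0 := by
    rw [qf_Ag0, ns_fv, Finset.mul_sum, ← Finset.sum_sub_distrib]
    refine Finset.sum_eq_zero fun k _ => ?_
    by_cases h1 : k = 1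
    · subst h1
      rw [form_one]; simp [rot_J1_0, ns]
    by_cases h7 : k = 7
    · subst h7
      rw [form_seven]; simp [rot_J1_1, ns]
    · have h : fv (J1 *ᵥ c) k = fun _ _ => 0 := by
        funext x t; rw [fv_J1]; simp [h1, h7]
      rw [h]; simp [Fk, nu]
  linarith

lemma J1_iso : J1ᴴ * J1 = 1 := by
  have h : ∀ c, (J1ᴴ * J1) *ᵥ c = (1 : Matrix (Fin 2 × Fin 2) (Fin 2 × Fin 2) ℂ) *ᵥ c := by
    intro c
    rw [← Matrix.mulVec_mulVec, Matrix.one_mulVec]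
    have e : ∀ y : ℂ, s8 * ∑ _t : Fin 8, s8 * y = y := by
      intro y
      rw [Finset.sum_const, Finset.card_univ, Fintype.card_fin, nsmul_eq_mul]
      have := s8_sq
      linear_combination (8 * y) * this
    funext ⟨z, a⟩
    have h01 : a = 0 ∨ a = 1 := by revert a; decide
    rcases h01 with rfl | rfl
    · rw [overlap0]; simp_rw [rot_J1_0]; rw [e]
    · have := overlap1 (J1 *ᵥ c) z
      simp_rw [rot_J1_1] at this
      rw [e] at this
      exact (starRingEnd ℂ).injective this
  ext i j
  have := congrFun (h (Pi.single j 1)) i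
  simpa using this

end OCL

open scoped Matrix
open GG

namespace OCL

lemma three_modes (A B D : ℂ) :
    ∑ j : Fin 8, Complex.normSq (ch (-(j * 2)) * A + B + ch (j * 2) * D)
      = 8 * (Complex.normSq A + Complex.normSq B + Complex.normSq D) := by
  have o2 : ∑ j : Fin 8, ch (j * 2) = 0 := by rw [ch_orth]; simp
  have o4 : ∑ j : Fin 8, ch (j * 4) = 0 := by rw [ch_orth]; simp
  have o2' : ∑ j : Fin 8, starRingEnd ℂ (ch (j * 2)) = 0 := by rw [← map_sum, o2, map_zero]
  have o4' : ∑ j : Fin 8, starRingEnd ℂ (ch (j * 4)) = 0 := by rw [← map_sum, o4, map_zero]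
  have e : ∀ j : Fin 8, (Complex.normSq (ch (-(j * 2)) * A + B + ch (j * 2) * D) : ℂ)
      = (A * starRingEnd ℂ A + B * starRingEnd ℂ B + D * starRingEnd ℂ D)
        + ch (j * 2) * (B * starRingEnd ℂ A + D * starRingEnd ℂ B)
        + starRingEnd ℂ (ch (j * 2)) * (A * starRingEnd ℂ B + B * starRingEnd ℂ D)
        + ch (j * 4) * (D * starRingEnd ℂ A) + starRingEnd ℂ (ch (j * 4)) * (A * starRingEnd ℂ D) := by
    intro j
    have h4 : ch (j * 4) = ch (j * 2) * ch (j * 2) := by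
      rw [← ch_add, ← fin8_mul_add]; rfl
    have hy := ch_mul_conj (j * 2)
    rw [← Complex.mul_conj, h4, ch_neg]
    simp only [map_add, map_mul, Complex.conj_conj]
    generalize ch (j * 2) = y at hy ⊢
    generalize starRingEnd ℂ y = y' at hy ⊢
    linear_combination (A * starRingEnd ℂ A + D * starRingEnd ℂ D) * hy
  have : ((∑ j : Fin 8, Complex.normSq (ch (-(j * 2)) * A + B + ch (j * 2) * D) : ℝ) : ℂ)
      = ((8 * (Complex.normSq A + Complex.normSq B + Complex.normSq D) : ℝ) : ℂ) := by
    rw [Complex.ofReal_sum]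
    simp_rw [e, Finset.sum_add_distrib, ← Finset.sum_mul, o2, o4, o2', o4']
    simp only [Finset.sum_const, Finset.card_univ, Fintype.card_fin, nsmul_eq_mul]
    push_cast
    simp only [← Complex.mul_conj]
    ring
  exact_mod_cast this

abbrev F4 := (Fin 2 × Fin 2) → (Fin 2 × Fin 2) → ℂ

noncomputable def QA (W : Matrix (Fin 2) (Fin 2) ℂ) (f : F4) (x : Fin 2) : ℂ :=
  ∑ z, ∑ z', W x z * W x z' * f (z, 0) (z', 0)
noncomputable def QB (W : Matrix (Fin 2) (Fin 2) ℂ) (f : F4) (x : Fin 2) : ℂ :=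
  2 * ∑ z, ∑ z', W x z * starRingEnd ℂ (W x z') * f (z, 0) (z', 1)
noncomputable def QD (W : Matrix (Fin 2) (Fin 2) ℂ) (f : F4) (x : Fin 2) : ℂ :=
  ∑ z, ∑ z', starRingEnd ℂ (W x z) * starRingEnd ℂ (W x z') * f (z, 1) (z', 1)
noncomputable def QQ (W : Matrix (Fin 2) (Fin 2) ℂ) (f : F4) : ℝ :=
  ∑ x, (Complex.normSq (QA W f x) + Complex.normSq (QB W f x) + Complex.normSq (QD W f x))

lemma QQ_eq (f : F4) (hf : ∀ a b, f a b = f b a) :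
    ∑ k : G0V, Complex.normSq (∑ p : (Fin 2 × Fin 2) × (Fin 2 × Fin 2), J1 k p.1 * J1 k p.2 * f p.1 p.2)
      = (1 / 512) * ∑ t, QQ (Wm t) f := by
  have h : ∀ x t j, ∑ p : (Fin 2 × Fin 2) × (Fin 2 × Fin 2), J1 (x, t, j) p.1 * J1 (x, t, j) p.2 * f p.1 p.2
      = (1 / 64) * (ch (-(j * 2)) * QA (Wm t) f x + QB (Wm t) f x + ch (j * 2) * QD (Wm t) f x) := by
    intro x t j
    have h2 : ch (j * 2) = ch j * ch j := by rw [← ch_add]; congr 1; revert j; decide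
    have h2' : ch (-(j * 2)) = ch (-j) * ch (-j) := by rw [← ch_add]; congr 1; clear h2; revert j; decide
    have h1 : ch j * ch (-j) = 1 := by rw [← ch_add]; simp [ch_zero]
    have hs := s8_sq
    have p0 : ∀ z, J1 (x, t, j) (z, 0) = (1 / 8) * (Wm t x z * ch (-j)) := by
      intro z
      have : J1 (x, t, j) (z, 0) = psi z 0 (x, t, j) := rfl
      rw [this, psi0, ← hs]; ring
    have p1 : ∀ z, J1 (x, t, j) (z, 1) = (1 / 8) * (starRingEnd ℂ (Wm t x z) * ch j) := by
      intro z
      have : J1 (x, t, j) (z, 1) = psi z 1 (x, t, j) := rfl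
      rw [this, psi1, ← hs]; ring
    simp only [Fintype.sum_prod_type, Fin.sum_univ_two, p0, p1, QA, QB, QD, h2, h2']
    rw [hf (0, 1) (0, 0), hf (0, 1) (1, 0), hf (1, 1) (0, 0), hf (1, 1) (1, 0)]
    generalize ch j = y at *
    generalize ch (-j) = y' at *
    linear_combination (1 / 32) * (Wm t x 0 * starRingEnd ℂ (Wm t x 0) * f (0, 0) (0, 1)
      + Wm t x 0 * starRingEnd ℂ (Wm t x 1) * f (0, 0) (1, 1)
      + Wm t x 1 * starRingEnd ℂ (Wm t x 0) * f (1, 0) (0, 1)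
      + Wm t x 1 * starRingEnd ℂ (Wm t x 1) * f (1, 0) (1, 1)) * h1
  rw [Fintype.sum_prod_type]
  simp_rw [Fintype.sum_prod_type (f := fun q : Fin 8 × Fin 8 => Complex.normSq (∑ p : (Fin 2 × Fin 2) × (Fin 2 × Fin 2), J1 (_, q) p.1 * J1 (_, q) p.2 * f p.1 p.2))]
  simp_rw [h, Complex.normSq_mul, ← Finset.mul_sum, three_modes]
  rw [Finset.sum_comm]
  simp only [QQ, ← Finset.mul_sum]
  rw [← mul_assoc]
  congr 1
  rw [show (1 / 64 : ℂ) = ((1 / 64 : ℝ) : ℂ) by push_cast; rfl, Complex.normSq_ofReal]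
  norm_num

lemma QQ_smul (s : ℝ) (V : Matrix (Fin 2) (Fin 2) ℂ) (f : F4) :
    QQ ((s : ℂ) • V) f = s ^ 4 * QQ V f := by
  have hA : ∀ x, QA ((s : ℂ) • V) f x = ((s ^ 2 : ℝ) : ℂ) * QA V f x := by
    intro x
    simp only [QA, Fin.sum_univ_two, Matrix.smul_apply, smul_eq_mul]; push_cast; ring
  have hB : ∀ x, QB ((s : ℂ) • V) f x = ((s ^ 2 : ℝ) : ℂ) * QB V f x := by
    intro x
    simp only [QB, Fin.sum_univ_two, Matrix.smul_apply, smul_eq_mul, map_mul, Complex.conj_ofReal]; push_cast; ring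
  have hD : ∀ x, QD ((s : ℂ) • V) f x = ((s ^ 2 : ℝ) : ℂ) * QD V f x := by
    intro x
    simp only [QD, Fin.sum_univ_two, Matrix.smul_apply, smul_eq_mul, map_mul, Complex.conj_ofReal]; push_cast; ring
  simp only [QQ, hA, hB, hD, Complex.normSq_mul, Complex.normSq_ofReal, Finset.mul_sum]
  refine Finset.sum_congr rfl fun x _ => ?_
  ring

lemma par_low (u v : ℂ) : 2 * Complex.normSq v ≤ Complex.normSq (u + v) + Complex.normSq (u - v) := by
  simp only [Complex.normSq_apply, Complex.add_re, Complex.add_im, Complex.sub_re, Complex.sub_im]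
  nlinarith [sq_nonneg u.re, sq_nonneg u.im]

lemma twist (p q : ℂ) : (1 / 2) * (Complex.normSq p + Complex.normSq q)
    ≤ Complex.normSq (p + q) + Complex.normSq (starRingEnd ℂ omega * p + omega * q) := by
  have h : Complex.normSq (starRingEnd ℂ omega * p + omega * q) = Complex.normSq (p + Complex.I * q) := by
    have h1 : omega * (starRingEnd ℂ omega * p + omega * q) = p + Complex.I * q := by
      have := ch_mul_conj 1
      rw [ch1] at this
      rw [← omega2]; linear_combination p * this
    have hn : Complex.normSq omega = 1 := by rw [← ch1]; exact ch_normSq 1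
    rw [← h1, Complex.normSq_mul, hn, one_mul]
  rw [h]
  simp only [Complex.normSq_apply, Complex.add_re, Complex.add_im, Complex.mul_re, Complex.mul_im,
    Complex.I_re, Complex.I_im]
  nlinarith [sq_nonneg (p.re + (2/3) * (q.re - q.im)), sq_nonneg (p.im + (2/3) * (q.re + q.im)),
    sq_nonneg q.re, sq_nonneg q.im]

/-- Two particles on the same copy of `g₀` interact. -/
lemma local_int (f : F4) (hf : ∀ a b, f a b = f b a) :
    (1 / 512) * ∑ p : (Fin 2 × Fin 2) × (Fin 2 × Fin 2), Complex.normSq (f p.1 p.2)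
      ≤ ∑ k : G0V, Complex.normSq
        (∑ p : (Fin 2 × Fin 2) × (Fin 2 × Fin 2), J1 k p.1 * J1 k p.2 * f p.1 p.2) := by
  rw [QQ_eq f hf]
  refine mul_le_mul_of_nonneg_left ?_ (by norm_num)
  have hs : ∀ M : Matrix (Fin 2) (Fin 2) ℂ, QQ M f = (1 / 4) * QQ ((Real.sqrt 2 : ℂ) • M) f := by
    intro M
    rw [QQ_smul]
    have : Real.sqrt 2 ^ 4 = 4 := by
      rw [show (4 : ℕ) = 2 * 2 from rfl, pow_mul, Real.sq_sqrt (by norm_num)]; norm_num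
    rw [this]; ring
  have hH := hs Hmat
  rw [sqrt2_Hmat] at hH
  have hT := hs (Hmat * Tmat)
  rw [sqrt2_HT] at hT
  have hsum : ∑ t, QQ (Wm t) f = 4 * QQ 1 f + 2 * QQ Hmat f + 2 * QQ (Hmat * Tmat) f := by
    rw [Wm_eq, Fin.sum_univ_eight]
    simp only [Matrix.cons_val]
    ring
  rw [hsum, hH, hT]
  have h1 : QQ 1 f = Complex.normSq (f (0,0) (0,0)) + Complex.normSq (f (1,0) (1,0))
      + 4 * Complex.normSq (f (0,0) (0,1)) + 4 * Complex.normSq (f (1,0) (1,1))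
      + Complex.normSq (f (0,1) (0,1)) + Complex.normSq (f (1,1) (1,1)) := by
    have n2 : Complex.normSq 2 = 4 := by
      rw [show (2 : ℂ) = ((2 : ℝ) : ℂ) by norm_num, Complex.normSq_ofReal]; norm_num
    simp only [QQ, QA, QB, QD, Fin.sum_univ_two, Matrix.one_apply]
    simp only [if_pos, if_neg (show ¬ ((0 : Fin 2) = 1) by decide),
      if_neg (show ¬ ((1 : Fin 2) = 0) by decide), map_one, map_zero, mul_zero, zero_mul, one_mul,
      add_zero, zero_add, Complex.normSq_mul, n2]
    ring
  have n4 : ∀ y : ℂ, Complex.normSq (2 * y) = 4 * Complex.normSq y := by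
    intro y
    rw [show (2 : ℂ) = ((2 : ℝ) : ℂ) by norm_num, Complex.normSq_mul, Complex.normSq_ofReal]; norm_num
  have h2 : 8 * Complex.normSq (f (0,0) (1,0)) + 8 * Complex.normSq (f (0,0) (1,1) + f (1,0) (0,1))
      + 8 * Complex.normSq (f (0,1) (1,1)) ≤ QQ !![1, 1; 1, -1] f := by
    have a := par_low (f (0,0) (0,0) + f (1,0) (1,0)) (2 * f (0,0) (1,0))
    have b := par_low (2 * (f (0,0) (0,1) + f (1,0) (1,1))) (2 * (f (0,0) (1,1) + f (1,0) (0,1)))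
    have d := par_low (f (0,1) (0,1) + f (1,1) (1,1)) (2 * f (0,1) (1,1))
    rw [n4] at a b d
    refine le_trans (by linarith) (le_of_le_of_eq (add_le_add (add_le_add a b) d) ?_)
    simp only [QQ, QA, QB, QD, Fin.sum_univ_two, Matrix.of_apply, Matrix.cons_val, map_one, map_neg]
    rw [hf (1, 0) (0, 0), hf (1, 1) (0, 1)]
    ring_nf
  have h3 : 8 * Complex.normSq (starRingEnd ℂ omega * f (0,0) (1,1) + omega * f (1,0) (0,1))
      ≤ QQ !![1, omega; 1, -omega] f := by
    have hc := ch_mul_conj 1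
    rw [ch1] at hc
    have b := par_low (2 * (f (0,0) (0,1) + f (1,0) (1,1)))
      (2 * (starRingEnd ℂ omega * f (0,0) (1,1) + omega * f (1,0) (0,1)))
    rw [n4] at b
    have hB0 : QB !![1, omega; 1, -omega] f 0 = 2 * (f (0,0) (0,1) + f (1,0) (1,1)) +
        2 * (starRingEnd ℂ omega * f (0,0) (1,1) + omega * f (1,0) (0,1)) := by
      simp only [QB, Fin.sum_univ_two, Matrix.of_apply, Matrix.cons_val, map_one]
      linear_combination 2 * f (1,0) (1,1) * hc
    have hB1 : QB !![1, omega; 1, -omega] f 1 = 2 * (f (0,0) (0,1) + f (1,0) (1,1)) -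
        2 * (starRingEnd ℂ omega * f (0,0) (1,1) + omega * f (1,0) (0,1)) := by
      simp only [QB, Fin.sum_univ_two, Matrix.of_apply, Matrix.cons_val, map_one, map_neg]
      linear_combination 2 * f (1,0) (1,1) * hc
    rw [QQ, Fin.sum_univ_two, hB0, hB1]
    have p := fun x => Complex.normSq_nonneg (QA !![1, omega; 1, -omega] f x)
    have q := fun x => Complex.normSq_nonneg (QD !![1, omega; 1, -omega] f x)
    linarith [p 0, p 1, q 0, q 1]
  have h4 := twist (f (0,0) (1,1)) (f (1,0) (0,1))
  simp only [Fintype.sum_prod_type, Fin.sum_univ_two]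
  rw [hf (0, 1) (0, 0), hf (0, 1) (1, 0), hf (1, 1) (0, 0), hf (1, 1) (1, 0), hf (1, 0) (0, 0),
    hf (1, 1) (0, 1)]
  have nng := fun a b => Complex.normSq_nonneg (f a b)
  rw [h1]
  linarith [nng (0,0) (0,0), nng (0,0) (1,0), nng (0,0) (0,1), nng (0,0) (1,1), nng (1,0) (1,0),
    nng (1,0) (0,1), nng (1,0) (1,1), nng (0,1) (0,1), nng (0,1) (1,1), nng (1,1) (1,1)]

end OCL

open scoped Matrix
open GG
namespace OCL

section gg
variable {R : ℕ}

noncomputable def A0 (R : ℕ) : Matrix (GGV R) (GGV R) ℂ := Matrix.of fun p q : GGV R =>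
    if p.1.1 = q.1.1 then Ag0 (p.1.2.1, p.1.2.2, p.2) (q.1.2.1, q.1.2.2, q.2) else 0

lemma AG_eq (S : Finset (GNode R)) (E : Finset (Sym2 (GNode R))) : AG S E = A0 R + hS S + hE E := rfl

def blk (v : GGV R → ℂ) (q : Fin R) : G0V → ℂ := fun g => v ((q, g.1, g.2.1), g.2.2)

def gEquiv (R : ℕ) : Fin R × G0V ≃ GGV R where
  toFun p := ((p.1, p.2.1, p.2.2.1), p.2.2.2)
  invFun p := (p.1.1, (p.1.2.1, p.1.2.2, p.2))
  left_inv _ := rfl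
  right_inv _ := rfl

lemma sum_ggv {A : Type*} [AddCommMonoid A] (F : GGV R → A) :
    ∑ p, F p = ∑ q : Fin R, ∑ g : G0V, F ((q, g.1, g.2.1), g.2.2) := by
  rw [← (gEquiv R).sum_comp, Fintype.sum_prod_type]; rfl

lemma ns_blk (v : GGV R → ℂ) : ns v = ∑ q, ns (blk v q) := by
  simp only [ns]; rw [sum_ggv]; rfl

lemma qf_A0 (v : GGV R → ℂ) : qf (A0 R) v = ∑ q, qf Ag0 (blk v q) := by
  simp only [qf_apply]
  rw [sum_ggv, Complex.re_sum]
  refine Finset.sum_congr rfl fun q _ => ?_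
  congr 1
  refine Finset.sum_congr rfl fun g _ => ?_
  rw [sum_ggv, Finset.sum_eq_single q]
  · simp [A0, blk]
  · intro b _ hb
    exact Finset.sum_eq_zero fun g _ => by simp [A0, Ne.symm hb]
  · simp

/-- node mass -/
noncomputable def mm (v : GGV R → ℂ) (u : GNode R) : ℝ := ∑ j, Complex.normSq (v (u, j))
lemma mm_nonneg (v : GGV R → ℂ) (u) : 0 ≤ mm v u := Finset.sum_nonneg fun _ _ => Complex.normSq_nonneg _

lemma ns_mm (v : GGV R → ℂ) : ns v = ∑ u, mm v u := by
  simp only [ns, mm]; rw [Fintype.sum_prod_type]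

lemma conj_mul_self_re (z : ℂ) : (starRingEnd ℂ z * z).re = Complex.normSq z := by
  rw [← Complex.normSq_eq_conj_mul_self, Complex.ofReal_re]

lemma qf_hS (S : Finset (GNode R)) (v : GGV R → ℂ) : qf (hS S) v = ∑ u ∈ S, mm v u := by
  have h : ∀ p : GGV R, ∑ q : GGV R, starRingEnd ℂ (v p) * hS S p q * v q
      = if p.1 ∈ S then starRingEnd ℂ (v p) * v p else 0 := by
    intro p
    rw [Finset.sum_eq_single p]
    · simp [hS]
    · intro b _ hb
      have : ¬ (p.1 = b.1 ∧ p.1 ∈ S ∧ p.2 = b.2) := fun h => hb (Prod.ext h.1.symm h.2.2.symm)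
      simp [hS, this]
    · simp
  rw [qf_apply]
  simp only [h]
  rw [Complex.re_sum, Fintype.sum_prod_type, ← Finset.sum_filter_add_sum_filter_not Finset.univ (· ∈ S)]
  rw [Finset.sum_eq_zero (s := Finset.univ.filter (¬ · ∈ S)), add_zero]
  · simp only [Finset.filter_univ_mem]
    refine Finset.sum_congr rfl fun u hu => ?_
    simp only [mm, if_pos hu, conj_mul_self_re]
  · intro u hu
    have : u ∉ S := by simpa using hu
    simp [this]

noncomputable def nE (v : GGV R → ℂ) : Sym2 (GNode R) → ℝ :=
  Sym2.lift ⟨fun u w => ∑ j, Complex.normSq (v (u, j) + v (w, j)), fun u w => by simp only [add_comm]⟩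

lemma nE_mk (v : GGV R → ℂ) (u w : GNode R) : nE v s(u, w) = ∑ j, Complex.normSq (v (u, j) + v (w, j)) := rfl

lemma nE_nonneg (v : GGV R → ℂ) (e) : 0 ≤ nE v e := by
  induction e using Sym2.ind with | _ u w =>
  rw [nE_mk]; exact Finset.sum_nonneg fun _ _ => Complex.normSq_nonneg _

lemma qf_edgeTerm (u w : GNode R) (v : GGV R → ℂ) :
    qf (edgeTerm u w) v = ∑ j, Complex.normSq (v (u, j) + v (w, j)) := by
  have h : edgeTerm u w = ∑ j : Fin 8, (Matrix.of fun (_ : Unit) (p : GGV R) => if p.2 = j then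
      ((if p.1 = u then (1 : ℂ) else 0) + (if p.1 = w then (1 : ℂ) else 0)) else 0)ᴴ *
      (Matrix.of fun (_ : Unit) (p : GGV R) => if p.2 = j then
      ((if p.1 = u then (1 : ℂ) else 0) + (if p.1 = w then (1 : ℂ) else 0)) else 0) := by
    ext p q
    simp only [Matrix.sum_apply, Matrix.mul_apply, Matrix.conjTranspose_apply, Matrix.of_apply, edgeTerm,
      Finset.univ_unique, Finset.sum_singleton]
    rw [Finset.sum_eq_single p.2]
    · by_cases hpq : p.2 = q.2
      · rw [if_pos hpq, if_pos rfl, if_pos hpq.symm]; congr 1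
        split_ifs <;> simp
      · rw [if_neg hpq, if_neg (Ne.symm hpq)]; simp
    · intro b _ hb; rw [if_neg (Ne.symm hb)]; simp
    · simp
  rw [h, qf_sum]
  refine Finset.sum_congr rfl fun j _ => ?_
  rw [qf_conjT_mul]
  simp only [ns, Finset.univ_unique, Finset.sum_singleton, Matrix.mulVec, dotProduct, Matrix.of_apply]
  congr 1
  rw [Fintype.sum_prod_type]
  simp [add_mul, Finset.sum_add_distrib]

lemma qf_hE (E : Finset (Sym2 (GNode R))) (v : GGV R → ℂ) : qf (hE E) v = ∑ e ∈ E, nE v e := by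
  rw [hE, qf_sum]
  refine Finset.sum_congr rfl fun e _ => ?_
  induction e using Sym2.ind with | _ u w => exact qf_edgeTerm u w v

lemma nn_hS (S : Finset (GNode R)) : nn (hS S) := fun v => by
  rw [qf_hS]; exact Finset.sum_nonneg fun _ _ => mm_nonneg _ _
lemma nn_hE (E : Finset (Sym2 (GNode R))) : nn (hE E) := fun v => by
  rw [qf_hE]; exact Finset.sum_nonneg fun _ _ => nE_nonneg _ _

lemma normSq_add_le (x y : ℂ) : Complex.normSq (x + y) ≤ 2 * Complex.normSq x + 2 * Complex.normSq y := by
  simp only [Complex.normSq_apply, Complex.add_re, Complex.add_im]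
  nlinarith [sq_nonneg (x.re - y.re), sq_nonneg (x.im - y.im)]

lemma nE_le (v : GGV R → ℂ) (e : Sym2 (GNode R)) (he : ¬ e.IsDiag) :
    nE v e ≤ 2 * ∑ u, if u ∈ e then mm v u else 0 := by
  induction e using Sym2.ind with | _ u w =>
  have huw : u ≠ w := by simpa using he
  have h1 : ∑ x, (if x ∈ s(u, w) then mm v x else 0) = mm v u + mm v w := by
    rw [← Finset.sum_filter]
    have : (Finset.univ.filter fun x => x ∈ s(u, w)) = {u, w} := by ext; simp
    rw [this, Finset.sum_pair huw]
  rw [h1, nE_mk, mm, mm, mul_add, Finset.mul_sum, Finset.mul_sum, ← Finset.sum_add_distrib]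
  exact Finset.sum_le_sum fun j _ => normSq_add_le _ _

lemma diag_le {S : Finset (GNode R)} {E : Finset (Sym2 (GNode R))} (h : ValidDiagram S E) (v : GGV R → ℂ) :
    qf (hS S + hE E) v ≤ 2 * ns v := by
  obtain ⟨h1, h2, h3⟩ := h
  rw [qf_add, qf_hS, qf_hE]
  have hE' : ∑ e ∈ E, nE v e ≤ ∑ e ∈ E, 2 * ∑ u, if u ∈ e then mm v u else 0 :=
    Finset.sum_le_sum fun e he => nE_le v e (h1 e he)
  have hS' : ∑ u ∈ S, mm v u = ∑ u, if u ∈ S then mm v u else 0 := by simp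
  rw [← Finset.mul_sum, Finset.sum_comm] at hE'
  have key : ∀ u, (if u ∈ S then mm v u else 0) + 2 * ∑ e ∈ E, (if u ∈ e then mm v u else 0) ≤ 2 * mm v u := by
    intro u
    have hm := mm_nonneg v u
    by_cases hu : u ∈ S
    · rw [if_pos hu, Finset.sum_eq_zero]
      · linarith
      · intro e he; rw [if_neg (h2 u hu e he)]
    · rw [if_neg hu]
      by_cases hx : ∃ e ∈ E, u ∈ e
      · obtain ⟨e, he, hue⟩ := hx
        rw [Finset.sum_eq_single_of_mem e he, if_pos hue]
        · linarith
        · intro e' he' hne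
          rw [if_neg (h3 e he e' he' (Ne.symm hne) u hue)]
      · rw [Finset.sum_eq_zero]
        · linarith
        · intro e he; rw [if_neg (fun h => hx ⟨e, he, h⟩)]
  have := Finset.sum_le_sum fun u (_ : u ∈ Finset.univ) => key u
  rw [Finset.sum_add_distrib, ← Finset.mul_sum, ← Finset.mul_sum, ← ns_mm] at this
  linarith

/-! ### the ground space of the disconnected graph -/

abbrev LL (R : ℕ) := (Fin R × Fin 2) × Fin 2

noncomputable def J0 (R : ℕ) : Matrix (GGV R) (LL R) ℂ := Matrix.of fun p l => psiQ l.1.1 l.1.2 l.2 p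

def cb (c : LL R → ℂ) (q : Fin R) : Fin 2 × Fin 2 → ℂ := fun l => c ((q, l.1), l.2)

lemma J0_apply (u : GNode R) (j : Fin 8) (l : LL R) :
    J0 R (u, j) l = if u.1 = l.1.1 then J1 (u.2.1, u.2.2, j) (l.1.2, l.2) else 0 := by
  simp [J0, psiQ, J1]

lemma sum_LL {A : Type*} [AddCommMonoid A] (F : LL R → A) :
    ∑ l, F l = ∑ q, ∑ l : Fin 2 × Fin 2, F ((q, l.1), l.2) := by
  simp only [Fintype.sum_prod_type]

lemma ns_cb (c : LL R → ℂ) : ns c = ∑ q, ns (cb c q) := by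
  simp only [ns]; rw [sum_LL]; rfl

lemma blk_J0 (c : LL R → ℂ) (q : Fin R) : blk (J0 R *ᵥ c) q = J1 *ᵥ cb c q := by
  ext g
  simp only [blk, Matrix.mulVec, dotProduct, J0_apply]
  rw [sum_LL, Finset.sum_eq_single q]
  · simp [cb]
  · intro b _ hb; exact Finset.sum_eq_zero fun _ _ => by simp [Ne.symm hb]
  · simp

lemma cb_J0 (v : GGV R → ℂ) (q : Fin R) : cb ((J0 R)ᴴ *ᵥ v) q = J1ᴴ *ᵥ blk v q := by
  ext g
  simp only [cb, Matrix.mulVec, dotProduct, Matrix.conjTranspose_apply]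
  rw [sum_ggv, Finset.sum_eq_single q]
  · simp [blk, J0_apply]
  · intro b _ hb; exact Finset.sum_eq_zero fun _ _ => by simp [J0_apply, hb]
  · simp

lemma J0_iso : (J0 R)ᴴ * J0 R = 1 := by
  ext l l'
  have h := congrFun (cb_J0 (J0 R *ᵥ Pi.single l' 1) l.1.1) (l.1.2, l.2)
  rw [blk_J0, Matrix.mulVec_mulVec, Matrix.mulVec_mulVec, J1_iso, Matrix.one_mulVec] at h
  have h1 : cb (((J0 R)ᴴ * J0 R) *ᵥ Pi.single l' 1) l.1.1 (l.1.2, l.2) = ((J0 R)ᴴ * J0 R) l l' := by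
    simp [cb]
  rw [← h1, h]
  simp only [cb, Matrix.one_apply, Pi.single_apply]

lemma A0_gap (v : GGV R → ℂ) : (1 / 5) * (ns v - ns ((J0 R)ᴴ *ᵥ v)) ≤ qf (A0 R) v - e1 * ns v := by
  rw [qf_A0, ns_cb, ns_blk, Finset.mul_sum, ← Finset.sum_sub_distrib, Finset.mul_sum, ← Finset.sum_sub_distrib]
  refine Finset.sum_le_sum fun q _ => ?_
  rw [cb_J0]; exact g0_gap _

lemma A0_ground (c : LL R → ℂ) : qf (A0 R) (J0 R *ᵥ c) = e1 * ns (J0 R *ᵥ c) := by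
  rw [qf_A0, ns_blk, Finset.mul_sum]
  refine Finset.sum_congr rfl fun q _ => ?_
  rw [blk_J0]; exact g0_ground _

lemma J0_even (c : LL R → ℂ) (q : Fin R) (z : Fin 2) (t : Fin 8) (ht : t = 0 ∨ t = 2 ∨ t = 4 ∨ t = 6) (j : Fin 8) :
    (J0 R *ᵥ c) ((q, z, t), j) = s8 * s8 * (ch (-j) * c ((q, z), 0) + ch j * c ((q, z), 1)) := by
  have h := congrFun (blk_J0 c q) (z, t, j)
  have h1 : blk (J0 R *ᵥ c) q (z, t, j) = (J0 R *ᵥ c) ((q, z, t), j) := rfl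
  rw [← h1, h]
  have hW : ∀ z', Wm t z z' = if z = z' then 1 else 0 := by
    intro z'; simp [Wm, clockCoef, ht]
  simp only [Matrix.mulVec, dotProduct, J1, Matrix.of_apply, Fintype.sum_prod_type, Fin.sum_univ_two, psi0, psi1, hW, cb]
  fin_cases z <;> simp <;> ring

lemma sum_modes (x y : ℂ) : ∑ j : Fin 8, Complex.normSq (s8 * s8 * (ch (-j) * x + ch j * y))
    = (1 / 8) * (Complex.normSq x + Complex.normSq y) := by
  have h : ∀ j : Fin 8, Complex.normSq (s8 * s8 * (ch (-j) * x + ch j * y))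
      = (1 / 64) * Complex.normSq (ch (-(j * 2)) * 0 + x + ch (j * 2) * y) := by
    intro j
    have h2 : ch (j * 2) = ch j * ch j := by rw [← ch_add]; congr 1; revert j; decide
    have h1 : ch (-j) * ch j = 1 := by rw [← ch_add]; simp [ch_zero]
    have h3 : s8 * s8 * (ch (-j) * x + ch j * y) = s8 * s8 * (ch (-j) * (ch (-(j * 2)) * 0 + x + ch (j * 2) * y)) := by
      rw [h2]; linear_combination (- s8 * s8 * ch j * y) * h1
    rw [h3, map_mul, map_mul, map_mul, s8_normSq, ch_normSq]; ring
  simp_rw [h]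
  rw [← Finset.mul_sum, three_modes]
  simp; ring

end gg
end OCL

open scoped Matrix
open GG
namespace OCL

/-! ### path Poincaré inequality -/

lemma normSq_sum_le (m : ℕ) (f : ℕ → ℂ) :
    Complex.normSq (∑ k ∈ Finset.range m, f k) ≤ m * ∑ k ∈ Finset.range m, Complex.normSq (f k) := by
  simp only [Complex.normSq_eq_norm_sq]
  calc ‖∑ k ∈ Finset.range m, f k‖ ^ 2 ≤ (∑ k ∈ Finset.range m, ‖f k‖) ^ 2 := by
        gcongr; exact norm_sum_le _ _
    _ ≤ _ := by
        have := sq_sum_le_card_mul_sum_sq (s := Finset.range m) (f := fun k => ‖f k‖)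
        simpa using this

lemma path_poincare (m : ℕ) (u : ℕ → ℂ) :
    (m + 1) * ∑ i ∈ Finset.range (m + 1), Complex.normSq (u i)
      - Complex.normSq (∑ i ∈ Finset.range (m + 1), u i)
      ≤ (m + 1 : ℝ) ^ 3 * ∑ i ∈ Finset.range m, Complex.normSq (u (i + 1) - u i) := by
  set D := ∑ i ∈ Finset.range m, Complex.normSq (u (i + 1) - u i) with hD
  have hD0 : 0 ≤ D := Finset.sum_nonneg fun _ _ => Complex.normSq_nonneg _
  have h1 : ∀ i ∈ Finset.range (m + 1), Complex.normSq (u i - u 0) ≤ (m + 1) * D := by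
    intro i hi
    have hi' : i ≤ m := by simpa [Nat.lt_succ_iff] using hi
    rw [← Finset.sum_range_sub]
    refine (normSq_sum_le i _).trans ?_
    have : ∑ k ∈ Finset.range i, Complex.normSq (u (k + 1) - u k) ≤ D :=
      Finset.sum_le_sum_of_subset_of_nonneg (Finset.range_mono hi') fun _ _ _ => Complex.normSq_nonneg _
    have h3 : (i : ℝ) ≤ m + 1 := by
      have : (i : ℝ) ≤ m := by exact_mod_cast hi'
      linarith
    exact mul_le_mul h3 this (Finset.sum_nonneg fun _ _ => Complex.normSq_nonneg _) (by positivity)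
  have h2 : (m + 1) * ∑ i ∈ Finset.range (m + 1), Complex.normSq (u i)
      - Complex.normSq (∑ i ∈ Finset.range (m + 1), u i) =
      (m + 1) * ∑ i ∈ Finset.range (m + 1), Complex.normSq (u i - u 0)
      - Complex.normSq (∑ i ∈ Finset.range (m + 1), (u i - u 0)) := by
    rw [Finset.sum_sub_distrib]
    generalize u 0 = w
    simp only [Complex.normSq_sub, Finset.sum_sub_distrib, Finset.sum_add_distrib, ← Finset.sum_mul, ← Finset.mul_sum,
      ← Complex.re_sum, Finset.sum_const, Finset.card_range, nsmul_eq_mul]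
    generalize ∑ i ∈ Finset.range (m + 1), u i = s
    simp only [Complex.normSq_apply, Complex.mul_re, Complex.mul_im, map_mul, Complex.conj_re, Complex.conj_im, map_natCast,
      Complex.natCast_re, Complex.natCast_im]
    push_cast
    ring
  rw [h2]
  have h3 := Finset.sum_le_sum h1
  simp only [Finset.sum_const, Finset.card_range, nsmul_eq_mul] at h3
  push_cast at h3
  have h4 := Complex.normSq_nonneg (∑ i ∈ Finset.range (m + 1), (u i - u 0))
  have h5 : (m + 1 : ℝ) * ∑ i ∈ Finset.range (m + 1), Complex.normSq (u i - u 0) ≤ (m + 1) * ((m + 1) * ((m + 1) * D)) := by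
    gcongr
  nlinarith

lemma chain_ineq (m : ℕ) (κ : Fin (m + 1) → ℂ) :
    (m + 1) * ∑ i, Complex.normSq (κ i) - Complex.normSq (∑ i : Fin (m + 1), (-1) ^ (i : ℕ) * κ i)
      ≤ (m + 1 : ℝ) ^ 3 * ∑ i : Fin m, Complex.normSq (κ i.castSucc + κ i.succ) := by
  let u : ℕ → ℂ := fun i => if h : i < m + 1 then (-1) ^ i * κ ⟨i, h⟩ else 0
  have hu : ∀ i : Fin (m + 1), u i = (-1) ^ (i : ℕ) * κ i := fun i => by simp only [u]; rw [dif_pos i.2]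
  have h := path_poincare m u
  rw [← Fin.sum_univ_eq_sum_range (fun i => Complex.normSq (u i)), ← Fin.sum_univ_eq_sum_range u,
    ← Fin.sum_univ_eq_sum_range (fun i => Complex.normSq (u (i + 1) - u i))] at h
  have h1 : ∀ i : Fin m, Complex.normSq (u (i + 1) - u i) = Complex.normSq (κ i.castSucc + κ i.succ) := by
    intro i
    have a := hu i.castSucc
    have b := hu i.succ
    simp only [Fin.val_castSucc, Fin.val_succ] at a b
    rw [a, b, show (-1 : ℂ) ^ ((i : ℕ) + 1) * κ i.succ - (-1) ^ (i : ℕ) * κ i.castSucc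
      = (-1) ^ ((i : ℕ) + 1) * (κ i.castSucc + κ i.succ) by ring]
    simp
  simp only [h1, hu] at h
  simpa using h

/-! ### the gadget -/

structure Gad (R R' m : ℕ) (conf : Fin R → Fin R → Prop) where
  pos : Fin R × Fin 2 → Fin (m + 1) → Fin R' × Fin 2
  inj : ∀ l i l' i', pos l i = pos l' i' → l = l' ∧ i = i'
  cf : ∀ l l', (∃ i i', (pos l i).1 = (pos l' i').1) ↔ conf l.1 l'.1
  A : Fin R → Fin R'
  B : Fin R → Fin R'
  i2 : Fin (m + 1)
  hi2 : (i2 : ℕ) = 2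
  hA : ∀ q z, pos (q, z) 0 = (A q, z)
  hB : ∀ q z, pos (q, z) i2 = (B q, z)

namespace Gad
variable {R R' m : ℕ} {conf : Fin R → Fin R → Prop} (g : Gad R R' m conf)

def InR (σ : Fin R' × Fin 2) : Prop := ∃ l i, g.pos l i = σ

open Classical in
lemma sum_pos {A : Type*} [AddCommMonoid A] (F : Fin R' × Fin 2 → A) :
    ∑ σ, F σ = (∑ l, ∑ i, F (g.pos l i)) + ∑ σ with ¬ g.InR σ, F σ := by
  rw [← Finset.sum_filter_add_sum_filter_not Finset.univ g.InR]
  congr 1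
  rw [← Fintype.sum_prod_type (f := fun p : (Fin R × Fin 2) × Fin (m + 1) => F (g.pos p.1 p.2))]
  have : (Finset.univ.filter g.InR) = Finset.univ.image (fun p : (Fin R × Fin 2) × Fin (m + 1) => g.pos p.1 p.2) := by
    ext σ; simp [InR]
  rw [this, Finset.sum_image]
  intro p _ p' _ h
  have := g.inj _ _ _ _ h
  exact Prod.ext this.1 this.2

noncomputable def rn (m : ℕ) : ℂ := ((1 / Real.sqrt (m + 1) : ℝ) : ℂ)
lemma rn_normSq (m : ℕ) : Complex.normSq (rn m) = 1 / (m + 1) := by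
  rw [rn, Complex.normSq_ofReal]
  have : Real.sqrt (m + 1) * Real.sqrt (m + 1) = m + 1 := Real.mul_self_sqrt (by positivity)
  rw [div_mul_div_comm, this]; ring
lemma rn_conj (m : ℕ) : starRingEnd ℂ (rn m) = rn m := Complex.conj_ofReal _

noncomputable def C0 (σ : Fin R' × Fin 2) (l : Fin R × Fin 2) : ℂ :=
  ∑ i, if g.pos l i = σ then rn m * (-1) ^ (i : ℕ) else 0

noncomputable def CC : Matrix (LL R') (LL R) ℂ := Matrix.of fun s l => if s.2 = l.2 then g.C0 s.1 l.1 else 0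

lemma C0_pos (l i l') : g.C0 (g.pos l i) l' = if l' = l then rn m * (-1) ^ (i : ℕ) else 0 := by
  unfold C0
  split_ifs with h
  · subst h
    rw [Finset.sum_eq_single i]
    · simp
    · intro b _ hb; rw [if_neg]; intro h; exact hb (g.inj _ _ _ _ h).2
    · simp
  · exact Finset.sum_eq_zero fun b _ => if_neg fun h' => h (g.inj _ _ _ _ h').1

lemma C0_not {σ} (h : ¬ g.InR σ) (l) : g.C0 σ l = 0 :=
  Finset.sum_eq_zero fun b _ => if_neg fun h' => h ⟨l, b, h'⟩

lemma CC_mulVec (c : LL R → ℂ) (σ a) : (g.CC *ᵥ c) (σ, a) = ∑ l, g.C0 σ l * c (l, a) := by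
  simp only [Matrix.mulVec, dotProduct, CC, Matrix.of_apply]
  rw [Fintype.sum_prod_type]
  refine Finset.sum_congr rfl fun l _ => ?_
  simp

lemma CC_pos (c : LL R → ℂ) (l i a) : (g.CC *ᵥ c) (g.pos l i, a) = rn m * (-1) ^ (i : ℕ) * c (l, a) := by
  rw [CC_mulVec]; simp [C0_pos]

lemma CC_not (c : LL R → ℂ) {σ} (h : ¬ g.InR σ) (a) : (g.CC *ᵥ c) (σ, a) = 0 := by
  rw [CC_mulVec]; simp [g.C0_not h]

lemma CCH (κ : LL R' → ℂ) (l a) : (g.CCᴴ *ᵥ κ) (l, a) = rn m * ∑ i : Fin (m + 1), (-1) ^ (i : ℕ) * κ (g.pos l i, a) := by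
  classical
  simp only [Matrix.mulVec, dotProduct, CC, Matrix.conjTranspose_apply, Matrix.of_apply]
  rw [Fintype.sum_prod_type, g.sum_pos]
  rw [Finset.sum_eq_zero (s := Finset.univ.filter _), add_zero]
  · rw [Finset.sum_eq_single l]
    · rw [Finset.mul_sum]
      refine Finset.sum_congr rfl fun i _ => ?_
      rw [Finset.sum_eq_single a]
      · simp [C0_pos, rn_conj, mul_assoc]
      · intro b _ hb; simp [hb]
      · simp
    · intro b _ hb
      refine Finset.sum_eq_zero fun i _ => Finset.sum_eq_zero fun a' _ => ?_
      simp [C0_pos, Ne.symm hb]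
    · simp
  · intro σ hσ
    have : ¬ g.InR σ := by simpa using hσ
    simp [g.C0_not this]

lemma rn_mul (m : ℕ) : rn m * rn m * (m + 1) = 1 := by
  have h : rn m * rn m = ((Complex.normSq (rn m) : ℝ) : ℂ) := by rw [← Complex.mul_conj, rn_conj]
  rw [h, rn_normSq]
  push_cast
  have : (m + 1 : ℂ) ≠ 0 := by exact_mod_cast Nat.succ_ne_zero m
  field_simp

lemma CC_iso : g.CCᴴ * g.CC = 1 := by
  refine Matrix.ext_iff_mulVec.2 fun c => ?_
  rw [← Matrix.mulVec_mulVec, Matrix.one_mulVec]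
  ext ⟨l, a⟩
  rw [CCH]
  simp only [CC_pos]
  have : ∀ i : Fin (m + 1), (-1 : ℂ) ^ (i : ℕ) * (rn m * (-1) ^ (i : ℕ) * c (l, a)) = rn m * c (l, a) := by
    intro i
    have : (-1 : ℂ) ^ (i : ℕ) * (-1) ^ (i : ℕ) = 1 := by rw [← mul_pow]; simp
    linear_combination (rn m * c (l, a)) * this
  simp only [this, Finset.sum_const, Finset.card_univ, Fintype.card_fin, nsmul_eq_mul]
  push_cast
  linear_combination c (l, a) * rn_mul m

open Classical in
noncomputable def Lk (κ : LL R' → ℂ) : ℝ :=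
  ∑ a, ((∑ l, ∑ i : Fin m, Complex.normSq (κ (g.pos l i.castSucc, a) + κ (g.pos l i.succ, a)))
    + ∑ σ with ¬ g.InR σ, Complex.normSq (κ (σ, a)))

lemma Lk_gap (κ : LL R' → ℂ) : ns κ - ns (g.CCᴴ *ᵥ κ) ≤ (m + 1 : ℝ) ^ 2 * g.Lk κ := by
  classical
  have h1 : ns κ = ∑ a, ((∑ l, ∑ i, Complex.normSq (κ (g.pos l i, a))) + ∑ σ with ¬ g.InR σ, Complex.normSq (κ (σ, a))) := by
    simp only [ns]
    rw [Fintype.sum_prod_type, Finset.sum_comm]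
    refine Finset.sum_congr rfl fun a _ => ?_
    rw [g.sum_pos]
  have h2 : ns (g.CCᴴ *ᵥ κ) = ∑ a, ∑ l, (1 / (m + 1 : ℝ)) * Complex.normSq (∑ i : Fin (m + 1), (-1) ^ (i : ℕ) * κ (g.pos l i, a)) := by
    simp only [ns]
    rw [Fintype.sum_prod_type, Finset.sum_comm]
    simp only [CCH, map_mul, rn_normSq]
  rw [h1, h2, Lk, Finset.mul_sum, ← Finset.sum_sub_distrib]
  refine Finset.sum_le_sum fun a _ => ?_
  have h3 : ∀ l, (∑ i, Complex.normSq (κ (g.pos l i, a))) - (1 / (m + 1 : ℝ)) * Complex.normSq (∑ i : Fin (m + 1), (-1) ^ (i : ℕ) * κ (g.pos l i, a))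
      ≤ (m + 1 : ℝ) ^ 2 * ∑ i : Fin m, Complex.normSq (κ (g.pos l i.castSucc, a) + κ (g.pos l i.succ, a)) := by
    intro l
    have h := chain_ineq m (fun i => κ (g.pos l i, a))
    have hm : (0 : ℝ) < m + 1 := by positivity
    rw [← mul_le_mul_iff_right₀ hm]
    refine le_trans (le_of_eq ?_) (h.trans (le_of_eq ?_))
    · field_simp
    · ring
  have h4 := Finset.sum_le_sum fun l (_ : l ∈ Finset.univ) => h3 l
  rw [Finset.sum_sub_distrib, ← Finset.mul_sum, ← Finset.mul_sum] at h4
  rw [← Finset.mul_sum]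
  have h5 : 0 ≤ ∑ σ with ¬ g.InR σ, Complex.normSq (κ (σ, a)) := Finset.sum_nonneg fun _ _ => Complex.normSq_nonneg _
  have h6 : (1 : ℝ) ≤ (m + 1 : ℝ) ^ 2 := one_le_pow₀ (by linarith [(Nat.cast_nonneg m : (0 : ℝ) ≤ m)])
  nlinarith

lemma Lk_zero (c : LL R → ℂ) : g.Lk (g.CC *ᵥ c) = 0 := by
  unfold Lk
  refine Finset.sum_eq_zero fun a _ => ?_
  rw [Finset.sum_eq_zero, Finset.sum_eq_zero, add_zero]
  · intro σ hσ
    have : ¬ g.InR σ := by simpa using hσ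
    rw [g.CC_not c this]; simp
  · intro l _
    refine Finset.sum_eq_zero fun i _ => ?_
    rw [CC_pos, CC_pos]
    simp only [Fin.val_castSucc, Fin.val_succ]
    rw [show rn m * (-1) ^ (i : ℕ) * c (l, a) + rn m * (-1) ^ ((i : ℕ) + 1) * c (l, a) = 0 by ring]; simp

end Gad
end OCL

open scoped Matrix
open GG
namespace OCL
namespace Gad
variable {R R' m : ℕ} {conf : Fin R → Fin R → Prop} (g : Gad R R' m conf)

def nd (σ : Fin R' × Fin 2) (t : Fin 8) : GNode R' := (σ.1, σ.2, t)

lemma nd_inj {σ σ' : Fin R' × Fin 2} {t t'} (h : nd σ t = nd σ' t') : σ = σ' ∧ t = t' := by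
  simp only [nd, Prod.mk.injEq] at h
  exact ⟨Prod.ext h.1 h.2.1, h.2.2⟩

def dn (l : Fin R × Fin 2) (i : Fin m) : GNode R' := nd (g.pos l i.castSucc) (if (i : ℕ) = 2 then 4 else 2)
def up (l : Fin R × Fin 2) (i : Fin m) : GNode R' := nd (g.pos l i.succ) 0
def hst (u : GNode R) : GNode R' := (if u.2.2 = 2 then g.B u.1 else g.A u.1, u.2.1, u.2.2)

lemma hst_nd (u : GNode R) : (u.2.2 = 2 ∧ g.hst u = nd (g.pos (u.1, u.2.1) g.i2) u.2.2) ∨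
    (u.2.2 ≠ 2 ∧ g.hst u = nd (g.pos (u.1, u.2.1) 0) u.2.2) := by
  by_cases h : u.2.2 = 2
  · left; exact ⟨h, by simp [hst, h, nd, g.hB]⟩
  · right; exact ⟨h, by simp [hst, h, nd, g.hA]⟩

lemma dn_inj {l i l' i'} (h : g.dn l i = g.dn l' i') : l = l' ∧ i = i' := by
  obtain ⟨h1, h2⟩ := nd_inj h
  obtain ⟨h3, h4⟩ := g.inj _ _ _ _ h1
  exact ⟨h3, Fin.castSucc_injective _ h4⟩

lemma up_inj {l i l' i'} (h : g.up l i = g.up l' i') : l = l' ∧ i = i' := by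
  obtain ⟨h1, h2⟩ := nd_inj h
  obtain ⟨h3, h4⟩ := g.inj _ _ _ _ h1
  exact ⟨h3, Fin.succ_injective _ h4⟩

lemma dn_ne_up {l i l' i'} : g.dn l i ≠ g.up l' i' := by
  intro h
  have := (nd_inj h).2
  split_ifs at this <;> revert this <;> decide

lemma hst_inj : Function.Injective g.hst := by
  intro u u' h
  rcases g.hst_nd u with ⟨a, b⟩ | ⟨a, b⟩ <;> rcases g.hst_nd u' with ⟨a', b'⟩ | ⟨a', b'⟩ <;> rw [b, b'] at h
  all_goals
    obtain ⟨h1, h2⟩ := nd_inj h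
    first
    | exact absurd (h2.symm.trans a) a'
    | exact absurd (h2.trans a') a
    | have h3 := (g.inj _ _ _ _ h1).1
      simp only [Prod.mk.injEq] at h3
      exact Prod.ext h3.1 (Prod.ext h3.2 h2)

lemma hst_ne_dn {u l i} : g.hst u ≠ g.dn l i := by
  intro h
  rcases g.hst_nd u with ⟨a, b⟩ | ⟨a, b⟩ <;> rw [b] at h <;> obtain ⟨h1, h2⟩ := nd_inj h <;>
    have h3 := (g.inj _ _ _ _ h1).2
  · have h4 : (i : ℕ) = 2 := by
      have := congrArg Fin.val h3
      rw [g.hi2] at this; simpa using this.symm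
    rw [if_pos h4, a] at h2
    revert h2; decide
  · have h4 : ¬ (i : ℕ) = 2 := by
      have := congrArg Fin.val h3
      simp at this; omega
    rw [if_neg h4] at h2
    exact a h2

lemma hst_ne_up {u l i} : g.hst u ≠ g.up l i := by
  intro h
  rcases g.hst_nd u with ⟨a, b⟩ | ⟨a, b⟩ <;> rw [b] at h <;> obtain ⟨h1, h2⟩ := nd_inj h
  · rw [a] at h2; revert h2; decide
  · have h3 := (g.inj _ _ _ _ h1).2
    exact Fin.succ_ne_zero _ h3.symm

lemma hst_in (u) : ∃ l i t, g.hst u = nd (g.pos l i) t := by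
  rcases g.hst_nd u with ⟨a, b⟩ | ⟨a, b⟩ <;> exact ⟨_, _, _, b⟩

def links : Finset (Sym2 (GNode R')) :=
  Finset.univ.image fun p : (Fin R × Fin 2) × Fin m => s(g.dn p.1 p.2, g.up p.1 p.2)

open Classical in
noncomputable def kills : Finset (GNode R') := (Finset.univ.filter fun σ => ¬ g.InR σ).image fun σ => nd σ 0

lemma mem_kills {u} : u ∈ g.kills ↔ ∃ σ, ¬ g.InR σ ∧ u = nd σ 0 := by
  simp [kills, eq_comm]

lemma mem_links {e} : e ∈ g.links ↔ ∃ l i, e = s(g.dn l i, g.up l i) := by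
  simp [links, eq_comm]

lemma hst_not_kill (u) : g.hst u ∉ g.kills := by
  intro h
  obtain ⟨σ, h1, h2⟩ := g.mem_kills.1 h
  obtain ⟨l, i, t, h3⟩ := g.hst_in u
  rw [h3] at h2
  exact h1 ⟨l, i, (nd_inj h2).1⟩

lemma hst_not_link (u) {e} (he : e ∈ g.links) : g.hst u ∉ e := by
  obtain ⟨l, i, rfl⟩ := g.mem_links.1 he
  rw [Sym2.mem_iff]
  rintro (h | h)
  · exact g.hst_ne_dn h
  · exact g.hst_ne_up h

lemma kill_not_link {u} (hu : u ∈ g.kills) {e} (he : e ∈ g.links) : u ∉ e := by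
  obtain ⟨σ, h1, rfl⟩ := g.mem_kills.1 hu
  obtain ⟨l, i, rfl⟩ := g.mem_links.1 he
  rw [Sym2.mem_iff]
  rintro (h | h)
  · exact h1 ⟨_, _, (nd_inj h).1.symm⟩
  · exact h1 ⟨_, _, (nd_inj h).1.symm⟩

lemma link_unique {e e'} (he : e ∈ g.links) (he' : e' ∈ g.links) {v} (hv : v ∈ e) (hv' : v ∈ e') : e = e' := by
  obtain ⟨l, i, rfl⟩ := g.mem_links.1 he
  obtain ⟨l', i', rfl⟩ := g.mem_links.1 he'
  rw [Sym2.mem_iff] at hv hv'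
  rcases hv with rfl | rfl <;> rcases hv' with h | h
  · obtain ⟨rfl, rfl⟩ := g.dn_inj h; rfl
  · exact absurd h g.dn_ne_up
  · exact absurd h.symm g.dn_ne_up
  · obtain ⟨rfl, rfl⟩ := g.up_inj h; rfl

noncomputable def SQ (S : Finset (GNode R)) : Finset (GNode R') := g.kills ∪ S.image g.hst
def EQ (E : Finset (Sym2 (GNode R))) : Finset (Sym2 (GNode R')) := g.links ∪ E.image (Sym2.map g.hst)

lemma valid_links : ValidDiagram g.kills g.links := by
  refine ⟨?_, fun u hu e he => g.kill_not_link hu he, fun e he e' he' hne v hv hv' => hne (g.link_unique he he' hv hv')⟩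
  intro e he
  obtain ⟨l, i, rfl⟩ := g.mem_links.1 he
  simpa using g.dn_ne_up

lemma valid_host {S : Finset (GNode R)} {E : Finset (Sym2 (GNode R))} (h : ValidDiagram S E) :
    ValidDiagram (S.image g.hst) (E.image (Sym2.map g.hst)) := by
  obtain ⟨h1, h2, h3⟩ := h
  refine ⟨?_, ?_, ?_⟩
  · intro e he
    obtain ⟨e, hem, rfl⟩ := Finset.mem_image.1 he
    have := h1 e hem
    induction e using Sym2.ind with | _ u w =>
    simp only [Sym2.map_mk, Sym2.mk_isDiag_iff] at this ⊢
    exact fun h => this (g.hst_inj h)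
  · intro v hv e he
    obtain ⟨e, hem, rfl⟩ := Finset.mem_image.1 he
    obtain ⟨u, hu, rfl⟩ := Finset.mem_image.1 hv
    intro h
    obtain ⟨u', hu', h'⟩ := Sym2.mem_map.1 h
    rw [g.hst_inj h'] at hu'
    exact h2 u hu e hem hu'
  · intro e he e' he' hne v hv hv'
    obtain ⟨e, hem, rfl⟩ := Finset.mem_image.1 he
    obtain ⟨e', hem', rfl⟩ := Finset.mem_image.1 he'
    obtain ⟨u, hu, rfl⟩ := Sym2.mem_map.1 hv
    obtain ⟨u', hu', h'⟩ := Sym2.mem_map.1 hv'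
    rw [g.hst_inj h'] at hu'
    exact h3 e hem e' hem' (fun h => hne (by rw [h])) u hu hu'

lemma valid_Q {S : Finset (GNode R)} {E : Finset (Sym2 (GNode R))} (h : ValidDiagram S E) :
    ValidDiagram (g.SQ S) (g.EQ E) := by
  obtain ⟨a1, a2, a3⟩ := g.valid_links
  obtain ⟨b1, b2, b3⟩ := g.valid_host h
  have hx : ∀ e ∈ g.links, ∀ e' ∈ E.image (Sym2.map g.hst), ∀ v, v ∈ e → v ∈ e' → False := by
    intro e he e' he' v hv hv'
    obtain ⟨e', hem', rfl⟩ := Finset.mem_image.1 he'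
    obtain ⟨u, hu, rfl⟩ := Sym2.mem_map.1 hv'
    exact g.hst_not_link u he hv
  refine ⟨?_, ?_, ?_⟩
  · intro e he
    rcases Finset.mem_union.1 he with he | he
    exacts [a1 e he, b1 e he]
  · intro v hv e he
    rcases Finset.mem_union.1 he with he | he <;> rcases Finset.mem_union.1 hv with hv | hv
    · exact a2 v hv e he
    · obtain ⟨u, hu, rfl⟩ := Finset.mem_image.1 hv
      exact g.hst_not_link u he
    · intro h
      obtain ⟨e, hem, rfl⟩ := Finset.mem_image.1 he
      obtain ⟨u, hu, rfl⟩ := Sym2.mem_map.1 h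
      exact g.hst_not_kill u hv
    · exact b2 v hv e he
  · intro e he e' he' hne v hv hv'
    rcases Finset.mem_union.1 he with he | he <;> rcases Finset.mem_union.1 he' with he' | he'
    · exact a3 e he e' he' hne v hv hv'
    · exact hx e he e' he' v hv hv'
    · exact hx e' he' e he v hv' hv
    · exact b3 e he e' he' hne v hv hv'

/-- the gadget one-body term and the original one-body term -/
noncomputable def aM : Matrix (GGV R') (GGV R') ℂ := A0 R' - (e1 : ℂ) • 1 + (hS g.kills + hE g.links)
noncomputable def oM (S : Finset (GNode R)) (E : Finset (Sym2 (GNode R))) : Matrix (GGV R') (GGV R') ℂ :=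
  hS (S.image g.hst) + hE (E.image (Sym2.map g.hst))

lemma hS_union {S S' : Finset (GNode R')} (h : Disjoint S S') : hS (S ∪ S') = hS S + hS S' := by
  ext p q
  simp only [hS, Matrix.add_apply, Matrix.of_apply, Finset.mem_union]
  by_cases h1 : p.1 ∈ S
  · have h2 : p.1 ∉ S' := Finset.disjoint_left.1 h h1
    simp [h1, h2]
  · simp [h1]

lemma AG_Q (S : Finset (GNode R)) (E : Finset (Sym2 (GNode R))) :
    AG (g.SQ S) (g.EQ E) - (e1 : ℂ) • 1 = g.aM + g.oM S E := by
  have d1 : Disjoint g.kills (S.image g.hst) := by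
    rw [Finset.disjoint_right]
    intro v hv
    obtain ⟨u, hu, rfl⟩ := Finset.mem_image.1 hv
    exact g.hst_not_kill u
  have d2 : Disjoint g.links (E.image (Sym2.map g.hst)) := by
    rw [Finset.disjoint_left]
    intro e he he'
    obtain ⟨e', hem', rfl⟩ := Finset.mem_image.1 he'
    induction e' using Sym2.ind with | _ u w =>
    exact g.hst_not_link u he (by simp)
  rw [AG_eq, SQ, EQ, hS_union d1, hE, Finset.sum_union d2, aM, oM]
  simp only [hE]
  abel

lemma Lf_J0 (κ : LL R' → ℂ) : qf (hS g.kills + hE g.links) (J0 R' *ᵥ κ) = (1 / 8) * g.Lk κ := by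
  classical
  rw [qf_add, qf_hS, qf_hE, kills, links, Finset.sum_image, Finset.sum_image]
  · rw [Lk, Finset.sum_add_distrib, mul_add, add_comm]
    congr 1
    · rw [Finset.sum_comm, Finset.mul_sum, Fintype.sum_prod_type]
      refine Finset.sum_congr rfl fun l _ => ?_
      rw [Finset.sum_comm, Finset.mul_sum]
      refine Finset.sum_congr rfl fun i _ => ?_
      rw [nE_mk, Fin.sum_univ_two, ← sum_modes]
      refine Finset.sum_congr rfl fun j _ => ?_
      rw [dn, up, nd, nd, J0_even _ _ _ _ (by split_ifs <;> simp), J0_even _ _ _ _ (by simp)]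
      congr 1
      ring
    · rw [Finset.sum_comm, Finset.mul_sum]
      refine Finset.sum_congr rfl fun σ _ => ?_
      rw [Fin.sum_univ_two, ← sum_modes, mm]
      refine Finset.sum_congr rfl fun j _ => ?_
      rw [nd, J0_even _ _ _ _ (by simp)]
  · rintro ⟨l, i⟩ _ ⟨l', i'⟩ _ h
    have h1 : g.dn l i ∈ s(g.dn l' i', g.up l' i') := by
      have : g.dn l i ∈ s(g.dn l i, g.up l i) := by simp
      rw [show s(g.dn l' i', g.up l' i') = s(g.dn l i, g.up l i) from h.symm]; exact this
    rw [Sym2.mem_iff] at h1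
    rcases h1 with h1 | h1
    · exact Prod.ext (g.dn_inj h1).1 (g.dn_inj h1).2
    · exact absurd h1 g.dn_ne_up
  · intro σ _ σ' _ h
    exact (nd_inj h).1

noncomputable def JJ : Matrix (GGV R') (LL R) ℂ := J0 R' * g.CC

lemma JJ_iso : g.JJᴴ * g.JJ = 1 := by
  rw [JJ, Matrix.conjTranspose_mul, Matrix.mul_assoc, ← Matrix.mul_assoc (J0 R')ᴴ, J0_iso, Matrix.one_mul, CC_iso]

lemma qf_aM (v : GGV R' → ℂ) : qf g.aM v = qf (A0 R') v - e1 * ns v + qf (hS g.kills + hE g.links) v := by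
  rw [aM, qf_add, qf_sub, qf_smul, qf_one]

lemma aM_gap (v : GGV R' → ℂ) : ns v - ns (g.JJᴴ *ᵥ v) ≤ 165 * (m + 1 : ℝ) ^ 2 * qf g.aM v := by
  set κ := (J0 R')ᴴ *ᵥ v with hκ
  have h1 := A0_gap v
  rw [← hκ] at h1
  have hp := ns_pyth J0_iso v
  rw [← hκ] at hp
  have h2 := (nn_hS g.kills |>.add (nn_hE g.links)).par' (J0 R' *ᵥ κ) v
  have h3 := diag_le g.valid_links (v - J0 R' *ᵥ κ)
  rw [hp] at h3
  have h4 := g.Lf_J0 κ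
  have h5 := g.Lk_gap κ
  have h6 : g.JJᴴ *ᵥ v = g.CCᴴ *ᵥ κ := by
    rw [JJ, Matrix.conjTranspose_mul, ← Matrix.mulVec_mulVec]
  have h7 := g.qf_aM v
  have h8 := (nn_hS g.kills |>.add (nn_hE g.links)) v
  rw [h6]
  have h9 : 0 ≤ ns v - ns κ := by rw [← hp]; exact ns_nonneg _
  have h10 : (1 : ℝ) ≤ (m + 1 : ℝ) ^ 2 := one_le_pow₀ (by linarith [(Nat.cast_nonneg m : (0 : ℝ) ≤ m)])
  have h11 : g.Lk κ ≤ 160 * qf g.aM v := by linarith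
  have h12 : 0 ≤ qf g.aM v := by linarith
  have h13 : ns v - ns κ ≤ 5 * qf g.aM v := by linarith
  nlinarith

lemma aM_JJ (c : LL R → ℂ) : qf g.aM (g.JJ *ᵥ c) = 0 := by
  rw [qf_aM, JJ, ← Matrix.mulVec_mulVec, A0_ground, Lf_J0, Lk_zero]; ring

lemma nn_aM : nn g.aM := by
  intro v
  have h1 := A0_gap v
  have h9 := ns_conj_le J0_iso v
  have h8 := (nn_hS g.kills |>.add (nn_hE g.links)) v
  rw [qf_aM]; linarith

lemma JJ_apply (u : GNode R') (j) (l : LL R) :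
    g.JJ (u, j) l = ∑ z, J1 (u.2.1, u.2.2, j) (z, l.2) * g.C0 (u.1, z) l.1 := by
  simp only [JJ, Matrix.mul_apply, J0_apply, CC, Matrix.of_apply]
  rw [sum_LL, Finset.sum_eq_single u.1]
  · rw [Fintype.sum_prod_type]
    refine Finset.sum_congr rfl fun z _ => ?_
    simp
  · intro b _ hb; exact Finset.sum_eq_zero fun _ _ => by simp [Ne.symm hb]
  · simp

lemma JJ_host (c : LL R → ℂ) (u : GNode R) (j) : (g.JJ *ᵥ c) (g.hst u, j) = rn m * (J0 R *ᵥ c) (u, j) := by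
  have hC : ∀ z l, g.C0 ((g.hst u).1, z) l = if l = (u.1, z) then rn m else 0 := by
    intro z l
    by_cases h : u.2.2 = 2
    · have : ((g.hst u).1, z) = g.pos (u.1, z) g.i2 := by rw [g.hB]; simp [hst, h]
      rw [this, C0_pos, g.hi2]; simp
    · have : ((g.hst u).1, z) = g.pos (u.1, z) 0 := by rw [g.hA]; simp [hst, h]
      rw [this, C0_pos]; simp
  have hu : (g.hst u).2 = u.2 := rfl
  simp only [Matrix.mulVec, dotProduct, JJ_apply, J0_apply, hC, hu, Finset.mul_sum]
  refine Finset.sum_congr rfl fun l _ => ?_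
  obtain ⟨⟨q, z⟩, a⟩ := l
  by_cases h : u.1 = q
  · subst h
    rw [if_pos rfl, Finset.sum_eq_single z]
    · simp; ring
    · intro b _ hb; simp [Ne.symm hb]
    · simp
  · rw [if_neg h, Finset.sum_eq_zero]
    · simp
    · intro b _; simp [Ne.symm h]

lemma oM_JJ (S : Finset (GNode R)) (E : Finset (Sym2 (GNode R))) (c : LL R → ℂ) :
    qf (g.oM S E) (g.JJ *ᵥ c) = (1 / (m + 1)) * qf (hS S + hE E) (J0 R *ᵥ c) := by
  rw [oM, qf_add, qf_add, qf_hS, qf_hS, qf_hE, qf_hE, Finset.sum_image (fun _ _ _ _ h => g.hst_inj h),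
    Finset.sum_image (fun _ _ _ _ h => Sym2.map.injective g.hst_inj h), mul_add, Finset.mul_sum, Finset.mul_sum]
  congr 1
  · refine Finset.sum_congr rfl fun u _ => ?_
    simp only [mm, JJ_host, map_mul, rn_normSq, Finset.mul_sum]
  · refine Finset.sum_congr rfl fun e _ => ?_
    induction e using Sym2.ind with | _ u w =>
    rw [Sym2.map_mk, nE_mk, nE_mk]
    simp only [JJ_host, ← mul_add, map_mul, rn_normSq, Finset.mul_sum]

end Gad
end OCL

open scoped Matrix
open GG
namespace OCL

lemma bil {α β : Type*} [Fintype α] [Fintype β] (u : α → ℂ) (D : α → β → ℂ) (f : β → β → ℂ) :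
    ∑ p : β × β, (∑ s, u s * D s p.1) * (∑ s, u s * D s p.2) * f p.1 p.2
      = ∑ q : α × α, u q.1 * u q.2 * ∑ p : β × β, D q.1 p.1 * D q.2 p.2 * f p.1 p.2 := by
  have : ∀ q : α × α, u q.1 * u q.2 * ∑ p : β × β, D q.1 p.1 * D q.2 p.2 * f p.1 p.2
      = ∑ p : β × β, u q.1 * u q.2 * (D q.1 p.1 * D q.2 p.2 * f p.1 p.2) := fun q => Finset.mul_sum _ _ _
  simp only [this]
  rw [Finset.sum_comm]
  refine Finset.sum_congr rfl fun p _ => ?_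
  rw [Finset.sum_mul_sum, Fintype.sum_prod_type, Finset.sum_mul]
  refine Finset.sum_congr rfl fun s _ => ?_
  rw [Finset.sum_mul]
  refine Finset.sum_congr rfl fun s' _ => ?_
  ring

namespace Gad
variable {R R' m : ℕ} {conf : Fin R → Fin R → Prop} (g : Gad R R' m conf)

noncomputable def DD (e : Fin R') (s : Fin 2 × Fin 2) (l : LL R) : ℂ :=
  if s.2 = l.2 then g.C0 (e, s.1) l.1 else 0

lemma JJ_DD (e x t j) (l : LL R) : g.JJ ((e, x, t), j) l = ∑ s, J1 (x, t, j) s * g.DD e s l := by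
  rw [JJ_apply, Fintype.sum_prod_type]
  refine Finset.sum_congr rfl fun z _ => ?_
  simp [DD]

noncomputable def FF (f : LL R → LL R → ℂ) (e : Fin R') : F4 :=
  fun s s' => ∑ p : LL R × LL R, g.DD e s p.1 * g.DD e s' p.2 * f p.1 p.2

lemma FF_symm {f : LL R → LL R → ℂ} (hf : ∀ a b, f a b = f b a) (e s s') : g.FF f e s s' = g.FF f e s' s := by
  unfold FF
  refine Fintype.sum_equiv (Equiv.prodComm _ _) _ _ fun p => ?_
  simp only [Equiv.prodComm_apply, Prod.fst_swap, Prod.snd_swap]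
  rw [hf p.1 p.2]; ring

lemma DD_pos (l i a) (p : LL R) : g.DD (g.pos l i).1 ((g.pos l i).2, a) p = if p = (l, a) then rn m * (-1) ^ (i : ℕ) else 0 := by
  obtain ⟨l', a'⟩ := p
  simp only [DD, Prod.mk.eta, C0_pos, Prod.mk.injEq]
  by_cases h : a = a'
  · subst h; simp
  · simp [h, Ne.symm h]

lemma FF_val (f : LL R → LL R → ℂ) {l i l' i'} (h : (g.pos l i).1 = (g.pos l' i').1) (a b) :
    Complex.normSq (g.FF f (g.pos l i).1 ((g.pos l i).2, a) ((g.pos l' i').2, b))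
      = (1 / (m + 1 : ℝ) ^ 2) * Complex.normSq (f (l, a) (l', b)) := by
  have : g.FF f (g.pos l i).1 ((g.pos l i).2, a) ((g.pos l' i').2, b)
      = (rn m * (-1) ^ (i : ℕ)) * (rn m * (-1) ^ (i' : ℕ)) * f (l, a) (l', b) := by
    unfold FF
    rw [Finset.sum_eq_single ((l, a), (l', b))]
    · rw [DD_pos, h, DD_pos]; simp
    · rintro ⟨p, p'⟩ _ hp
      rw [DD_pos, h, DD_pos]
      by_cases h1 : p = (l, a)
      · have h2 : p' ≠ (l', b) := fun h2 => hp (by rw [h1, h2])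
        simp [h2]
      · simp [h1]
    · simp
  rw [this]
  simp only [map_mul, rn_normSq, map_pow, Complex.normSq_neg, map_one, one_pow, mul_one]
  field_simp

def cf' (conf : Fin R → Fin R → Prop) (l l' : LL R) : Prop := conf l.1.1 l'.1.1

open Classical in
lemma two_body (f : LL R → LL R → ℂ) (hf : ∀ a b, f a b = f b a) :
    (1 / (512 * (m + 1 : ℝ) ^ 2)) * (∑ p : LL R × LL R, if cf' conf p.1 p.2 then Complex.normSq (f p.1 p.2) else 0)
      ≤ ∑ k : GGV R', Complex.normSq (∑ p : LL R × LL R, g.JJ k p.1 * g.JJ k p.2 * f p.1 p.2) := by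
  rw [sum_ggv]
  have h1 : ∀ e (k : G0V), ∑ p : LL R × LL R, g.JJ ((e, k.1, k.2.1), k.2.2) p.1 * g.JJ ((e, k.1, k.2.1), k.2.2) p.2 * f p.1 p.2
      = ∑ p : (Fin 2 × Fin 2) × (Fin 2 × Fin 2), J1 k p.1 * J1 k p.2 * g.FF f e p.1 p.2 := by
    intro e k
    simp only [JJ_DD]
    exact bil (J1 k) (g.DD e) f
  simp only [h1]
  refine le_trans ?_ (Finset.sum_le_sum fun e _ => local_int (g.FF f e) (g.FF_symm hf e))
  rw [← Finset.mul_sum, ← Fintype.sum_prod_type (f := fun q : Fin R' × ((Fin 2 × Fin 2) × (Fin 2 × Fin 2)) =>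
    Complex.normSq (g.FF f q.1 q.2.1 q.2.2))]
  rw [← Finset.sum_filter]
  have hw : ∀ p : LL R × LL R, ∃ ii : Fin (m + 1) × Fin (m + 1), cf' conf p.1 p.2 →
      (g.pos p.1.1 ii.1).1 = (g.pos p.2.1 ii.2).1 := by
    intro p
    by_cases hp : cf' conf p.1 p.2
    · obtain ⟨i, i', h⟩ := (g.cf p.1.1 p.2.1).2 hp
      exact ⟨(i, i'), fun _ => h⟩
    · exact ⟨(0, 0), fun h => absurd h hp⟩
  choose ii hii using hw
  let Φ : LL R × LL R → Fin R' × ((Fin 2 × Fin 2) × (Fin 2 × Fin 2)) := fun p =>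
    ((g.pos p.1.1 (ii p).1).1, (((g.pos p.1.1 (ii p).1).2, p.1.2), ((g.pos p.2.1 (ii p).2).2, p.2.2)))
  have hΦ : Set.InjOn Φ (Finset.univ.filter fun p : LL R × LL R => cf' conf p.1 p.2 : Finset _) := by
    rintro ⟨⟨l, a⟩, ⟨l', b⟩⟩ hp ⟨⟨l2, a2⟩, ⟨l2', b2⟩⟩ hq h
    have hp' := hii ((l, a), (l', b)) (by simpa using hp)
    have hq' := hii ((l2, a2), (l2', b2)) (by simpa using hq)
    simp only [Φ, Prod.mk.injEq] at h
    obtain ⟨k1, ⟨k2, k3⟩, k4, k5⟩ := h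
    have e1 := (g.inj _ _ _ _ (Prod.ext k1 k2)).1
    have k1' := k1
    rw [hp', hq'] at k1'
    have e2 := (g.inj _ _ _ _ (Prod.ext k1' k4)).1
    simp only at e1 e2
    rw [e1, e2, k3, k5]
  have h3 : ∑ q ∈ (Finset.univ.filter fun p : LL R × LL R => cf' conf p.1 p.2).image Φ,
      Complex.normSq (g.FF f q.1 q.2.1 q.2.2) ≤ ∑ q : Fin R' × ((Fin 2 × Fin 2) × (Fin 2 × Fin 2)), Complex.normSq (g.FF f q.1 q.2.1 q.2.2) :=
    Finset.sum_le_sum_of_subset_of_nonneg (Finset.subset_univ _) fun _ _ _ => Complex.normSq_nonneg _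
  rw [Finset.sum_image hΦ] at h3
  have h4 : ∀ p ∈ (Finset.univ.filter fun p : LL R × LL R => cf' conf p.1 p.2),
      Complex.normSq (g.FF f (Φ p).1 (Φ p).2.1 (Φ p).2.2) = (1 / (m + 1 : ℝ) ^ 2) * Complex.normSq (f p.1 p.2) := by
    intro p hp
    exact g.FF_val f (hii p (by simpa using hp)) _ _
  rw [Finset.sum_congr rfl h4, ← Finset.mul_sum] at h3
  calc _ = (1 / 512) * ((1 / (m + 1 : ℝ) ^ 2) * ∑ p ∈ (Finset.univ.filter fun p : LL R × LL R => cf' conf p.1 p.2),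
        Complex.normSq (f p.1 p.2)) := by rw [← mul_assoc]; congr 1; field_simp
    _ ≤ _ := mul_le_mul_of_nonneg_left h3 (by norm_num)

lemma JJ_ne {e x t j} {l : LL R} (h : g.JJ ((e, x, t), j) l ≠ 0) : ∃ i, (g.pos l.1 i).1 = e := by
  by_contra hc
  push Not at hc
  apply h
  rw [JJ_apply]
  refine Finset.sum_eq_zero fun z _ => ?_
  rw [C0, Finset.sum_eq_zero, mul_zero]
  intro i _
  rw [if_neg]
  intro h'
  exact hc i (by rw [h'])

lemma JJ_zero (k : GGV R') (l l' : LL R) (h : ¬ cf' conf l l') : g.JJ k l * g.JJ k l' = 0 := by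
  by_contra hc
  obtain ⟨⟨e, x, t⟩, j⟩ := k
  obtain ⟨i, hi⟩ := g.JJ_ne (left_ne_zero_of_mul hc)
  obtain ⟨i', hi'⟩ := g.JJ_ne (right_ne_zero_of_mul hc)
  exact h ((g.cf l.1 l'.1).1 ⟨i, i', by rw [hi, hi']⟩)

end Gad

lemma J0_zero {R : ℕ} (k : GGV R) (l l' : LL R) (h : l.1.1 ≠ l'.1.1) : J0 R k l * J0 R k l' = 0 := by
  rw [J0_apply, J0_apply]
  by_cases h1 : k.1.1 = l.1.1
  · rw [if_neg (fun h2 => h (h1.symm.trans h2)), mul_zero]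
  · rw [if_neg h1, zero_mul]

/-! ### existence of the gadget -/

section exist
variable {R : ℕ} (G : SimpleGraph (Fin R))

abbrev El (R : ℕ) := (Fin R × Fin 3) ⊕ ((Fin R × Fin 2) × (Fin R × Fin 2))

open Classical in
noncomputable def slot (l k : Fin R × Fin 2) : El R × Fin 2 :=
  if G.Adj l.1 k.1 ∧ k.1 < l.1 then (Sum.inr (k, l), 1) else (Sum.inr (l, k), 0)

lemma slot_inj {l k l' k'} (h : slot G l k = slot G l' k') : l = l' ∧ k = k' := by
  unfold slot at h
  split_ifs at h <;> simp at h <;> tauto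

lemma slot_cf {l k l' k'} (h : (slot G l k).1 = (slot G l' k').1) : l.1 = l'.1 ∨ G.Adj l.1 l'.1 := by
  unfold slot at h
  split_ifs at h with h1 h2 h2 <;> simp at h
  · left; rw [h.2]
  · right; rw [← h.1]; exact h1.1
  · right; rw [h.1]; exact h2.1.symm
  · left; rw [h.1]

lemma slot_adj {l k} (h : G.Adj l.1 k.1) : (slot G l k).1 = (slot G k l).1 := by
  unfold slot
  rcases lt_trichotomy l.1 k.1 with h1 | h1 | h1
  · rw [if_neg (fun h2 => lt_asymm h1 h2.2), if_pos ⟨h.symm, h1⟩]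
  · exact absurd h1 h.ne
  · rw [if_pos ⟨h, h1⟩, if_neg (fun h2 => lt_asymm h1 h2.2)]

noncomputable def ppos (l : Fin R × Fin 2) : Fin 3 ⊕ (Fin R × Fin 2) → El R × Fin 2
  | Sum.inl i => (Sum.inl (l.1, i), l.2)
  | Sum.inr k => slot G l k

lemma slot_ne_inl (l k x) : (slot G l k).1 ≠ Sum.inl x := by
  unfold slot; split_ifs <;> simp

lemma ppos_inj {l i l' i'} (h : ppos G l i = ppos G l' i') : l = l' ∧ i = i' := by
  rcases i with i | k <;> rcases i' with i' | k'
  · simp only [ppos, Prod.mk.injEq, Sum.inl.injEq] at h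
    exact ⟨Prod.ext h.1.1 h.2, by rw [h.1.2]⟩
  · exact absurd (congrArg Prod.fst h).symm (slot_ne_inl G _ _ _)
  · exact absurd (congrArg Prod.fst h) (slot_ne_inl G _ _ _)
  · have := slot_inj G h
    exact ⟨this.1, by rw [this.2]⟩

lemma ppos_cf (l l') : (∃ i i', (ppos G l i).1 = (ppos G l' i').1) ↔ (l.1 = l'.1 ∨ G.Adj l.1 l'.1) := by
  constructor
  · rintro ⟨i, i', h⟩
    rcases i with i | k <;> rcases i' with i' | k'
    · simp only [ppos, Prod.mk.injEq, Sum.inl.injEq] at h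
      exact Or.inl h.1
    · exact absurd h.symm (slot_ne_inl G _ _ _)
    · exact absurd h (slot_ne_inl G _ _ _)
    · exact slot_cf G h
  · rintro (h | h)
    · exact ⟨Sum.inl 0, Sum.inl 0, by simp [ppos, h]⟩
    · exact ⟨Sum.inr l', Sum.inr l, slot_adj G h⟩

lemma gad_exists : Nonempty (Gad R (3 * R + 4 * R ^ 2) (2 * R + 2) (fun q q' => q = q' ∨ G.Adj q q')) := by
  let eE : El R ≃ Fin (3 * R + 4 * R ^ 2) := Fintype.equivFinOfCardEq (by simp [El]; ring)
  let eL : Fin R × Fin 2 ≃ Fin (2 * R) := Fintype.equivFinOfCardEq (by simp; ring)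
  let eI : Fin (2 * R + 2 + 1) ≃ Fin 3 ⊕ (Fin R × Fin 2) :=
    (finCongr (by ring)).trans (finSumFinEquiv.symm.trans (Equiv.sumCongr (Equiv.refl (Fin 3)) eL.symm))
  have h0 : eI 0 = Sum.inl 0 := by
    rw [← Equiv.eq_symm_apply]; apply Fin.ext; simp [eI]
  have h2 : eI ⟨2, by omega⟩ = Sum.inl 2 := by
    rw [← Equiv.eq_symm_apply]; apply Fin.ext; simp [eI]
  refine ⟨{ pos := fun l i => (eE (ppos G l (eI i)).1, (ppos G l (eI i)).2)
            inj := ?_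
            cf := ?_
            A := fun q => eE (Sum.inl (q, 0))
            B := fun q => eE (Sum.inl (q, 2))
            i2 := ⟨2, by omega⟩
            hi2 := rfl
            hA := ?_
            hB := ?_ }⟩
  · intro l i l' i' h
    simp only [Prod.mk.injEq, EmbeddingLike.apply_eq_iff_eq] at h
    have := ppos_inj G (Prod.ext h.1 h.2)
    exact ⟨this.1, eI.injective this.2⟩
  · intro l l'
    rw [← ppos_cf]
    simp only [EmbeddingLike.apply_eq_iff_eq]
    constructor
    · rintro ⟨i, i', h⟩; exact ⟨_, _, h⟩
    · rintro ⟨i, i', h⟩; exact ⟨eI.symm i, eI.symm i', by simpa using h⟩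
  · intro q z; rw [h0]; rfl
  · intro q z; rw [h2]; rfl

end exist
end OCL

open scoped Matrix
open GG
namespace OCL

/-! ### symmetrized states -/
section sym
variable {α β : Type*} [Fintype α] [Fintype β] [DecidableEq α] [DecidableEq β] {N : ℕ}

lemma TT_symSt (J : Matrix α β ℂ) (φ : Fin N → β → ℂ) :
    (TT fun _ : Fin N => J) *ᵥ symSt N φ = symSt N (fun w => J *ᵥ φ w) := by
  ext x
  simp only [Matrix.mulVec, dotProduct, TT, Matrix.of_apply, symSt]
  simp only [mul_left_comm _ (((1 : ℝ) / Real.sqrt (N.factorial) : ℝ) : ℂ) _]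
  rw [← Finset.mul_sum]
  congr 1
  simp only [Finset.mul_sum]
  rw [Finset.sum_comm]
  refine Finset.sum_congr rfl fun σ _ => ?_
  rw [Finset.prod_univ_sum, Fintype.piFinset_univ]
  exact Finset.sum_congr rfl fun y _ => Finset.prod_mul_distrib.symm

lemma symSt_symm (φ : Fin N → β → ℂ) : symSt N φ ∈ BH.symmStates β N := by
  intro τ x
  simp only [symSt]
  congr 1
  refine Fintype.sum_equiv (Equiv.mulRight τ⁻¹) _ _ fun σ => ?_
  refine Fintype.prod_equiv τ _ _ fun w => ?_
  simp

lemma symSt_single (s : Fin N → β) (x : Fin N → β) :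
    symSt N (fun w => Pi.single (s w) (1 : ℂ)) x = ((1 : ℝ) / Real.sqrt (N.factorial) : ℝ) *
      ∑ σ : Equiv.Perm (Fin N), if x = s ∘ σ then 1 else 0 := by
  simp only [symSt]
  congr 1
  refine Finset.sum_congr rfl fun σ _ => ?_
  simp only [Pi.single_apply]
  rw [Finset.prod_ite_zero]
  simp [funext_iff]

lemma symm_decomp {c : (Fin N → β) → ℂ} (hc : c ∈ BH.symmStates β N) :
    ∃ r : ℂ, c = r • ∑ l, c l • symSt N (fun w => Pi.single (l w) (1 : ℂ)) := by
  have hf : (0 : ℝ) < N.factorial := by exact_mod_cast N.factorial_pos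
  have hs : Real.sqrt (N.factorial) * Real.sqrt (N.factorial) = N.factorial := Real.mul_self_sqrt hf.le
  have hs0 : Real.sqrt (N.factorial) ≠ 0 := by positivity
  refine ⟨((1 / Real.sqrt (N.factorial) : ℝ) : ℂ), ?_⟩
  ext x
  simp only [Pi.smul_apply, Finset.sum_apply, smul_eq_mul, symSt_single]
  have h1 : ∀ l, c l * ((((1 : ℝ) / Real.sqrt (N.factorial) : ℝ) : ℂ) * ∑ σ : Equiv.Perm (Fin N), if x = l ∘ σ then 1 else 0)
      = (((1 : ℝ) / Real.sqrt (N.factorial) : ℝ) : ℂ) * ∑ σ : Equiv.Perm (Fin N), if x = l ∘ σ then c x else 0 := by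
    intro l
    rw [mul_left_comm]
    congr 1
    rw [Finset.mul_sum]
    refine Finset.sum_congr rfl fun σ _ => ?_
    split_ifs with h
    · rw [h, hc]; ring
    · simp
  simp only [h1]
  rw [← Finset.mul_sum, Finset.sum_comm]
  have h2 : ∀ σ : Equiv.Perm (Fin N), ∑ l : Fin N → β, (if x = l ∘ σ then c x else 0) = c x := by
    intro σ
    rw [Finset.sum_eq_single (x ∘ σ.symm)]
    · rw [if_pos]; ext w; simp
    · intro l _ hl
      rw [if_neg]
      rintro rfl
      apply hl; ext w; simp
    · simp
  simp only [h2, Finset.sum_const, Finset.card_univ, Fintype.card_perm, Fintype.card_fin, nsmul_eq_mul]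
  have h3 : (((1 : ℝ) / Real.sqrt (N.factorial) : ℝ) : ℂ) * ((((1 : ℝ) / Real.sqrt (N.factorial) : ℝ) : ℂ) * (N.factorial : ℂ)) = 1 := by
    have : (1 / Real.sqrt (N.factorial)) * ((1 / Real.sqrt (N.factorial)) * (N.factorial : ℝ)) = 1 := by
      rw [← mul_assoc, div_mul_div_comm, hs, one_mul]; field_simp
    exact_mod_cast this
  linear_combination (- c x) * h3

end sym

/-! ### the occupancy subspace -/
section occ
variable {R N : ℕ} (G : SimpleGraph (Fin R))

def cfG (q q' : Fin R) : Prop := q = q' ∨ G.Adj q q'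
def bad (l : Fin N → LL R) : Prop := ∃ w w', w ≠ w' ∧ Gad.cf' (cfG G) (l w) (l w')

lemma J0_single (l : LL R) : J0 R *ᵥ Pi.single l (1 : ℂ) = psiQ l.1.1 l.1.2 l.2 := by
  ext p; simp [J0]

lemma occ_sub {Ψ : (Fin N → GGV R) → ℂ} (h : Ψ ∈ IoccSpace R N G) :
    ∃ c ∈ BH.symmStates (LL R) N, (∀ l, bad G l → c l = 0) ∧ Ψ = (TT fun _ : Fin N => J0 R) *ᵥ c := by
  unfold IoccSpace at h
  induction h using Submodule.span_induction with
  | mem v hv =>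
    obtain ⟨z, a, q, hq, hG, rfl⟩ := hv
    refine ⟨symSt N (fun w => Pi.single ((q w, z w), a w) (1 : ℂ)), symSt_symm _, ?_, ?_⟩
    · rintro l ⟨w, w', hw, hcf⟩
      rw [symSt_single (fun w => ((q w, z w), a w)), Finset.sum_eq_zero, mul_zero]
      intro σ _
      rw [if_neg]
      rintro rfl
      simp only [Gad.cf', cfG, Function.comp] at hcf
      have hne : σ w ≠ σ w' := fun h => hw (σ.injective h)
      rcases hcf with h | h
      · exact hne (hq h)
      · exact hG _ _ hne h
    · rw [TT_symSt]; simp only [J0_single]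
  | zero => exact ⟨0, fun _ _ => rfl, fun _ _ => rfl, by simp⟩
  | add x y _ _ hx hy =>
    obtain ⟨c, hc, hb, rfl⟩ := hx
    obtain ⟨c', hc', hb', rfl⟩ := hy
    exact ⟨c + c', symm_add hc hc', fun l hl => by simp [hb l hl, hb' l hl], by rw [Matrix.mulVec_add]⟩
  | smul r x _ hx =>
    obtain ⟨c, hc, hb, rfl⟩ := hx
    exact ⟨r • c, fun σ x => by simp [hc σ x], fun l hl => by simp [hb l hl], by rw [Matrix.mulVec_smul]⟩

lemma occ_sup {c : (Fin N → LL R) → ℂ} (hc : c ∈ BH.symmStates (LL R) N) (hb : ∀ l, bad G l → c l = 0) :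
    (TT fun _ : Fin N => J0 R) *ᵥ c ∈ IoccSpace R N G := by
  obtain ⟨r, hr⟩ := symm_decomp hc
  rw [hr, Matrix.mulVec_smul, Matrix.mulVec_sum]
  refine Submodule.smul_mem _ _ (Submodule.sum_mem _ fun l _ => ?_)
  rw [Matrix.mulVec_smul]
  by_cases hl : bad G l
  · rw [hb l hl, zero_smul]; exact Submodule.zero_mem _
  · refine Submodule.smul_mem _ _ (Submodule.subset_span ⟨fun w => (l w).1.2, fun w => (l w).2, fun w => (l w).1.1, ?_, ?_, ?_⟩)
    · intro w w' h
      by_contra hne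
      exact hl ⟨w, w', hne, Or.inl h⟩
    · intro w w' hne h
      exact hl ⟨w, w', hne, Or.inr h⟩
    · rw [TT_symSt]; simp only [J0_single]

end occ

/-! ### lifting one-body forms -/
section lift
variable {α β γ : Type*} [Fintype α] [Fintype β] [Fintype γ] [DecidableEq α] [DecidableEq β] [DecidableEq γ] {N : ℕ}

lemma onFactor_qf_congr {J : Matrix α γ ℂ} {J' : Matrix β γ ℂ} (hJ : Jᴴ * J = 1) (hJ' : J'ᴴ * J' = 1)
    {M : Matrix α α ℂ} {M' : Matrix β β ℂ} {r : ℝ} (h : ∀ c, qf M (J *ᵥ c) = r * qf M' (J' *ᵥ c)) (w : Fin N)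
    (c : (Fin N → γ) → ℂ) :
    qf (BH.onFactor N M w) ((TT fun _ : Fin N => J) *ᵥ c) = r * qf (BH.onFactor N M' w) ((TT fun _ : Fin N => J') *ᵥ c) := by
  rw [← qf_comp, ← qf_comp, compress_onFactor hJ, compress_onFactor hJ', ← qf_smul, ← onFactor_smul]
  apply le_antisymm <;>
  · refine qf_onFactor_mono (fun v => ?_) w c
    rw [qf_smul, qf_comp, qf_comp, h]

lemma qf_bh (A : Matrix α α ℂ) (e : ℝ) (ψ : (Fin N → α) → ℂ) :
    qf (BH.bhHam A N - ((N : ℂ) * (e : ℂ)) • 1) ψ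
      = ∑ w : Fin N, qf (BH.onFactor N (A - (e : ℂ) • 1) w) ψ + qf (BH.interaction α N) ψ := by
  have h1 : ∀ w : Fin N, qf (BH.onFactor N (A - (e : ℂ) • 1) w) ψ = qf (BH.onFactor N A w) ψ - e * ns ψ := by
    intro w
    have : A - (e : ℂ) • 1 = A + ((-e : ℝ) : ℂ) • 1 := by push_cast; rw [neg_smul, sub_eq_add_neg]
    rw [this, onFactor_add, onFactor_smul, onFactor_one, qf_add, qf_smul, qf_one]; ring
  have h2 : ((N : ℂ) * (e : ℂ)) = ((N * e : ℝ) : ℂ) := by push_cast; rfl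
  simp only [h1]
  rw [qf_sub, BH.bhHam, qf_add, qf_sum, h2, qf_smul, qf_one, Finset.sum_sub_distrib]
  simp only [Finset.sum_const, Finset.card_univ, Fintype.card_fin, nsmul_eq_mul]
  ring

lemma onFactor_le {M : Matrix α α ℂ} {r : ℝ} (h : ∀ v, qf M v ≤ r * ns v) (w : Fin N) (ψ : (Fin N → α) → ℂ) :
    qf (BH.onFactor N M w) ψ ≤ r * ns ψ := by
  have := qf_onFactor_mono (M := M) (M' := (r : ℂ) • 1) (fun v => by rw [qf_smul, qf_one]; exact h v) w ψ
  rwa [onFactor_smul, onFactor_one, qf_smul, qf_one] at this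

end lift
end OCL

open scoped Matrix
open GG
namespace OCL

section final
variable {R R' m N : ℕ} {G : SimpleGraph (Fin R)}

/-- Diagram energy of the lifted coefficient state. -/
noncomputable def ED (S : Finset (GNode R)) (E : Finset (Sym2 (GNode R))) (c : (Fin N → LL R) → ℂ) : ℝ :=
  ∑ w : Fin N, qf (BH.onFactor N (hS S + hE E) w) ((TT fun _ : Fin N => J0 R) *ᵥ c)

/-- Matrix of the diagram energy. -/
noncomputable def EDM (N : ℕ) (S : Finset (GNode R)) (E : Finset (Sym2 (GNode R))) :
    Matrix (Fin N → GGV R) (Fin N → GGV R) ℂ := ∑ w : Fin N, BH.onFactor N (hS S + hE E) w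

lemma ED_eq (S : Finset (GNode R)) (E : Finset (Sym2 (GNode R))) (c : (Fin N → LL R) → ℂ) :
    ED S E c = qf (EDM N S E) ((TT fun _ : Fin N => J0 R) *ᵥ c) := by
  rw [ED, EDM, qf_sum]

lemma nn_EDM (S : Finset (GNode R)) (E : Finset (Sym2 (GNode R))) : nn (EDM N S E) :=
  nn.sum fun w _ => nn_onFactor ((nn_hS S).add (nn_hE E)) w

lemma EDM_le {S : Finset (GNode R)} {E : Finset (Sym2 (GNode R))} (h : ValidDiagram S E)
    (ψ : (Fin N → GGV R) → ℂ) : qf (EDM N S E) ψ ≤ 2 * N * ns ψ := by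
  rw [EDM, qf_sum]
  calc _ ≤ ∑ _w : Fin N, 2 * ns ψ := Finset.sum_le_sum fun w _ => onFactor_le (diag_le h) w ψ
    _ = _ := by simp; ring

lemma onFactor_zero_form {α γ : Type*} [Fintype α] [Fintype γ] [DecidableEq α] [DecidableEq γ]
    {J : Matrix α γ ℂ} (hJ : Jᴴ * J = 1) {M : Matrix α α ℂ} (h : ∀ c, qf M (J *ᵥ c) = 0) (w : Fin N)
    (c : (Fin N → γ) → ℂ) : qf (BH.onFactor N M w) ((TT fun _ : Fin N => J) *ᵥ c) = 0 := by
  have := onFactor_qf_congr hJ hJ (M := M) (M' := 1) (r := 0) (fun c => by rw [h c]; ring) w c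
  rw [this]; ring

lemma energy_G (S : Finset (GNode R)) (E : Finset (Sym2 (GNode R))) (c : (Fin N → LL R) → ℂ) :
    qf (BH.bhHam (AG S E) N - ((N : ℂ) * (e1 : ℂ)) • 1) ((TT fun _ : Fin N => J0 R) *ᵥ c)
      = ED S E c + qf (BH.interaction (GGV R) N) ((TT fun _ : Fin N => J0 R) *ᵥ c) := by
  rw [qf_bh, ED]
  refine congrArg₂ (· + ·) (Finset.sum_congr rfl fun w _ => ?_) rfl
  have h : AG S E - (e1 : ℂ) • 1 = (A0 R - (e1 : ℂ) • 1) + (hS S + hE E) := by rw [AG_eq]; abel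
  rw [h, onFactor_add, qf_add, onFactor_zero_form J0_iso, zero_add]
  intro c
  rw [qf_sub, qf_smul, qf_one, A0_ground, sub_self]

lemma energy_good (S : Finset (GNode R)) (E : Finset (Sym2 (GNode R))) {c : (Fin N → LL R) → ℂ}
    (hb : ∀ l, bad G l → c l = 0) :
    qf (BH.bhHam (AG S E) N - ((N : ℂ) * (e1 : ℂ)) • 1) ((TT fun _ : Fin N => J0 R) *ᵥ c) = ED S E c := by
  rw [energy_G, int_zero (conf := Gad.cf' (cfG G)) _ hb, add_zero]
  intro k a b h
  exact J0_zero k a b fun h' => h (Or.inl h')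

variable (g : Gad R R' m (cfG G))

/-- The perturbation part of the many-body Hamiltonian. -/
noncomputable def BB (N : ℕ) (S : Finset (GNode R)) (E : Finset (Sym2 (GNode R))) :
    Matrix (Fin N → GGV R') (Fin N → GGV R') ℂ :=
  ∑ w : Fin N, BH.onFactor N (g.oM S E) w + BH.interaction (GGV R') N

lemma nn_oM (S : Finset (GNode R)) (E : Finset (Sym2 (GNode R))) : nn (g.oM S E) :=
  (nn_hS _).add (nn_hE _)

lemma nn_BB (S : Finset (GNode R)) (E : Finset (Sym2 (GNode R))) : nn (BB g N S E) :=
  (nn.sum fun w _ => nn_onFactor (nn_oM g S E) w).add nn_interaction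

lemma BB_le {S : Finset (GNode R)} {E : Finset (Sym2 (GNode R))} (h : ValidDiagram S E)
    (ψ : (Fin N → GGV R') → ℂ) : qf (BB g N S E) ψ ≤ (2 * N + (N : ℝ) ^ 2) * ns ψ := by
  rw [BB, qf_add, qf_sum, add_mul]
  refine add_le_add ?_ (interaction_le ψ)
  calc _ ≤ ∑ _w : Fin N, 2 * ns ψ :=
        Finset.sum_le_sum fun w _ => onFactor_le (diag_le (g.valid_host h)) w ψ
    _ = _ := by simp; ring

lemma energy_Q (S : Finset (GNode R)) (E : Finset (Sym2 (GNode R))) (ψ : (Fin N → GGV R') → ℂ) :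
    qf (BH.bhHam (AG (g.SQ S) (g.EQ E)) N - ((N : ℂ) * (e1 : ℂ)) • 1) ψ
      = ∑ w : Fin N, qf (BH.onFactor N g.aM w) ψ + qf (BB g N S E) ψ := by
  rw [qf_bh, g.AG_Q, BB, qf_add, qf_sum, ← add_assoc, ← Finset.sum_add_distrib]
  congr 1
  refine Finset.sum_congr rfl fun w _ => ?_
  rw [onFactor_add, qf_add]

lemma BB_T (S : Finset (GNode R)) (E : Finset (Sym2 (GNode R))) (c : (Fin N → LL R) → ℂ) :
    qf (BB g N S E) ((TT fun _ : Fin N => g.JJ) *ᵥ c)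
      = (1 / (m + 1 : ℝ)) * ED S E c + qf (BH.interaction (GGV R') N) ((TT fun _ : Fin N => g.JJ) *ᵥ c) := by
  rw [BB, qf_add, qf_sum, ED, Finset.mul_sum]
  congr 1
  refine Finset.sum_congr rfl fun w _ => ?_
  exact onFactor_qf_congr g.JJ_iso J0_iso (g.oM_JJ S E) w c

lemma energy_Q_good (S : Finset (GNode R)) (E : Finset (Sym2 (GNode R))) {c : (Fin N → LL R) → ℂ}
    (hb : ∀ l, bad G l → c l = 0) :
    qf (BH.bhHam (AG (g.SQ S) (g.EQ E)) N - ((N : ℂ) * (e1 : ℂ)) • 1) ((TT fun _ : Fin N => g.JJ) *ᵥ c)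
      = (1 / (m + 1 : ℝ)) * ED S E c := by
  rw [energy_Q, BB_T, int_zero (conf := Gad.cf' (cfG G)) g.JJ_zero hb,
    Finset.sum_eq_zero fun w _ => onFactor_zero_form g.JJ_iso g.aM_JJ w c]
  ring

lemma energy_Q_nonneg (S : Finset (GNode R)) (E : Finset (Sym2 (GNode R))) (ψ : (Fin N → GGV R') → ℂ) :
    0 ≤ qf (BH.bhHam (AG (g.SQ S) (g.EQ E)) N - ((N : ℂ) * (e1 : ℂ)) • 1) ψ := by
  rw [energy_Q]
  exact add_nonneg (Finset.sum_nonneg fun w _ => nn_onFactor g.nn_aM w ψ) (nn_BB g S E ψ)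

lemma ED_nonneg (S : Finset (GNode R)) (E : Finset (Sym2 (GNode R))) (c : (Fin N → LL R) → ℂ) : 0 ≤ ED S E c := by
  rw [ED_eq]; exact nn_EDM S E _

/-- One-particle ground energy of the new gate graph. -/
lemma mu_Q (hR : 2 ≤ R) {S : Finset (GNode R)} {E : Finset (Sym2 (GNode R))} (he1 : BH.mu (AG S E) = e1) :
    BH.mu (AG (g.SQ S) (g.EQ E)) = e1 := by
  have hform : ∀ v, qf (AG (g.SQ S) (g.EQ E)) v = e1 * ns v + qf g.aM v + qf (g.oM S E) v := by
    intro v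
    have := congrArg (fun M => qf M v) (g.AG_Q S E)
    simp only [qf_sub, qf_smul, qf_one, qf_add] at this
    linarith
  have hlow : ∀ ψ ∈ (Set.univ : Set (GGV R' → ℂ)), ns ψ = 1 → e1 ≤ qf (AG (g.SQ S) (g.EQ E)) ψ := by
    intro ψ _ h1
    rw [hform, h1]
    linarith [g.nn_aM ψ, nn_oM g S E ψ]
  have : Nonempty (GGV R) := ⟨((⟨0, by omega⟩, 0, 0), 0)⟩
  obtain ⟨v, hv1, hv2⟩ := ge_attained (AG S E)
  have hv3 : qf (AG S E) v = e1 := by rw [hv2]; exact he1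
  rw [AG_eq, add_assoc, qf_add] at hv3
  have hgap := A0_gap v
  have hD := ((nn_hS S).add (nn_hE E)) v
  have hle := ns_conj_le J0_iso v
  have hp := ns_pyth J0_iso v
  rw [hv1] at hgap hle hp
  have hc1 : ns ((J0 R)ᴴ *ᵥ v) = 1 := by linarith
  have hD0 : qf (hS S + hE E) v = 0 := by linarith
  rw [hc1, sub_self, ns_zero_iff, sub_eq_zero] at hp
  set c := (J0 R)ᴴ *ᵥ v with hc
  have hn : ns (g.JJ *ᵥ c) = 1 := by rw [ns_isometry g.JJ_iso, hc1]
  refine le_antisymm ?_ (le_ge hlow ⟨g.JJ *ᵥ c, trivial, hn⟩)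
  have := ge_le hlow (Set.mem_univ (g.JJ *ᵥ c)) hn
  rw [hform, g.aM_JJ, g.oM_JJ, ← hp, hD0, hn] at this
  unfold BH.mu
  linarith

/-- Interaction lower bound on bad configurations. -/
lemma int_lower (c : (Fin N → LL R) → ℂ) (hc : c ∈ BH.symmStates (LL R) N) [DecidablePred (bad (N := N) G)] :
    (1 / (512 * (m + 1 : ℝ) ^ 2)) * ∑ l : Fin N → LL R, (if bad G l then Complex.normSq (c l) else 0)
      ≤ qf (BH.interaction (GGV R') N) ((TT fun _ : Fin N => g.JJ) *ᵥ c) := by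
  classical
  rw [qf_interaction]
  have h1 : ∀ p : Fin N × Fin N, (1 / (512 * (m + 1 : ℝ) ^ 2)) * (if p.1 ≠ p.2 then
      ∑ l : Fin N → LL R, (if Gad.cf' (cfG G) (l p.1) (l p.2) then Complex.normSq (c l) else 0) else 0)
      ≤ if p.1 ≠ p.2 then intPair p.1 p.2 ((TT fun _ : Fin N => g.JJ) *ᵥ c) else 0 := by
    intro p
    split_ifs with h
    · exact intPair_lower g.JJ_iso h (fun f hf => by
        have := g.two_body f hf
        convert this) hc
    · simp
  refine le_trans ?_ (Finset.sum_le_sum fun p _ => h1 p)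
  rw [← Finset.mul_sum]
  refine mul_le_mul_of_nonneg_left ?_ (by positivity)
  have h2 : ∀ p : Fin N × Fin N, (if p.1 ≠ p.2 then
      ∑ l : Fin N → LL R, (if Gad.cf' (cfG G) (l p.1) (l p.2) then Complex.normSq (c l) else 0) else 0)
      = ∑ l : Fin N → LL R, (if p.1 ≠ p.2 ∧ Gad.cf' (cfG G) (l p.1) (l p.2) then Complex.normSq (c l) else 0) := by
    intro p
    by_cases h : p.1 ≠ p.2
    · rw [if_pos h]; refine Finset.sum_congr rfl fun l _ => ?_
      simp only [h, true_and, ne_eq, not_false_eq_true]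
    · rw [if_neg h]; symm; refine Finset.sum_eq_zero fun l _ => ?_
      rw [if_neg fun h' => h h'.1]
  simp only [h2]
  rw [Finset.sum_comm]
  refine Finset.sum_le_sum fun l _ => ?_
  have hnn : ∀ p : Fin N × Fin N, 0 ≤ (if p.1 ≠ p.2 ∧ Gad.cf' (cfG G) (l p.1) (l p.2) then Complex.normSq (c l) else 0) := by
    intro p; split_ifs; exacts [Complex.normSq_nonneg _, le_rfl]
  split_ifs with hb
  · obtain ⟨w, w', hw, hcf⟩ := hb
    refine le_trans ?_ (Finset.single_le_sum (fun p _ => hnn p) (Finset.mem_univ (w, w')))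
    rw [if_pos ⟨hw, hcf⟩]
  · exact Finset.sum_nonneg fun p _ => hnn p

/-- Leakage bound out of the one-particle ground spaces. -/
lemma leak (ψ : (Fin N → GGV R') → ℂ) :
    ns ψ - ns ((TT fun _ : Fin N => g.JJ)ᴴ *ᵥ ψ)
      ≤ 165 * (m + 1 : ℝ) ^ 2 * ∑ w : Fin N, qf (BH.onFactor N g.aM w) ψ := by
  have h1 : (g.JJ * g.JJᴴ)ᴴ = g.JJ * g.JJᴴ := by simp [Matrix.conjTranspose_mul]
  have h2 : (g.JJ * g.JJᴴ) * (g.JJ * g.JJᴴ) = g.JJ * g.JJᴴ := by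
    rw [Matrix.mul_assoc, ← Matrix.mul_assoc g.JJᴴ, g.JJ_iso, Matrix.one_mul]
  have h := proj_union h1 h2 ψ
  have h3 : (TT fun _ : Fin N => g.JJ * g.JJᴴ) = (TT fun _ : Fin N => g.JJ) * (TT fun _ : Fin N => g.JJ)ᴴ := by
    rw [TT_conj, TT_mul]
  rw [h3, qf_mul_conjT] at h
  refine h.trans ?_
  rw [Finset.mul_sum]
  refine Finset.sum_le_sum fun w _ => ?_
  have h4 := qf_onFactor_mono (M := 1) (M' := ((165 * (m + 1 : ℝ) ^ 2 : ℝ) : ℂ) • g.aM + g.JJ * g.JJᴴ)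
    (fun v => by rw [qf_one, qf_add, qf_smul, qf_mul_conjT]; linarith [g.aM_gap v]) w ψ
  rw [onFactor_one, qf_one, onFactor_add, onFactor_smul, qf_add, qf_smul] at h4
  linarith

end final

section arith

lemma arith1 {r n N b c1 c2 e1' e2 ec i eb ebT ea d : ℝ} (hr : 2 ≤ r) (hn : n = 2 * r + 3) (hN0 : 0 ≤ N) (hN : N ≤ r)
    (hb0 : 0 ≤ b) (hb1 : b ≤ 1) (hc2 : 0 ≤ c2) (hec : 0 ≤ ec) (hi0 : 0 ≤ i) (heb : 0 ≤ eb) (hea : 0 ≤ ea)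
    (h1 : b * c1 ≤ e1') (h2 : e1' ≤ 2 * ec + 2 * e2) (h3 : e2 ≤ 2 * N * c2)
    (h4 : 1 / (512 * n ^ 2) * c2 ≤ i) (h5 : ebT = 1 / n * ec + i)
    (h6 : ebT ≤ 2 * eb + 2 * ((2 * N + N ^ 2) * d)) (h7 : d = 1 - (c1 + c2)) (h8 : d ≤ 165 * n ^ 2 * ea) :
    b / (13 * r) ^ 9 ≤ ea + eb := by
  have hn0 : 0 < n := by linarith
  have hnr : n ≤ 7 / 2 * r := by linarith
  have hr0 : 0 ≤ r := by linarith
  have hn2 : n ^ 2 ≤ 49 / 4 * r ^ 2 := by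
    calc n ^ 2 ≤ (7 / 2 * r) ^ 2 := by gcongr
      _ = _ := by ring
  have h4' : c2 ≤ 512 * n ^ 2 * i := by
    have : 0 < 512 * n ^ 2 := by positivity
    rw [one_div, inv_mul_le_iff₀ this] at h4; exact h4
  have hec' : ec = n * (ebT - i) := by rw [h5]; field_simp; ring
  have hX : b * (c1 + c2) ≤ 28224 * r ^ 3 * ebT := by
    have hA : b * (c1 + c2) ≤ 2 * ec + (4 * N + 1) * c2 := by nlinarith
    have hB : (4 * N + 1) * c2 ≤ (9 / 2 * r) * (512 * (49 / 4 * r ^ 2) * i) := by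
      have e1 : 4 * N + 1 ≤ 9 / 2 * r := by linarith
      have e2 : c2 ≤ 512 * (49 / 4 * r ^ 2) * i := h4'.trans (by gcongr)
      exact mul_le_mul e1 e2 hc2 (by positivity)
    have hC : 2 * ec ≤ 7 * r * (ebT - i) := by
      have : 0 ≤ ebT - i := by rw [h5]; have : 0 ≤ 1 / n * ec := by positivity
                               linarith
      rw [hec']; nlinarith
    have hD : 7 * r * (ebT - i) ≤ 28224 * r ^ 3 * (ebT - i) := by
      have : 0 ≤ ebT - i := by rw [h5]; have : 0 ≤ 1 / n * ec := by positivity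
                               linarith
      refine mul_le_mul_of_nonneg_right ?_ this
      nlinarith [pow_le_pow_left₀ (by norm_num : (0:ℝ) ≤ 2) hr 2, mul_nonneg hr0 (sq_nonneg r)]
    nlinarith
  have hd : d ≤ 2022 * r ^ 2 * ea := by
    refine h8.trans (mul_le_mul_of_nonneg_right ?_ hea)
    nlinarith [sq_nonneg r]
  have hd' : 2 * ((2 * N + N ^ 2) * d) ≤ 8088 * r ^ 4 * ea := by
    have e1 : 2 * N + N ^ 2 ≤ 2 * r ^ 2 := by nlinarith
    have e2 : 0 ≤ 2022 * r ^ 2 * ea := by positivity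
    have e3 : (2 * N + N ^ 2) * d ≤ (2 * r ^ 2) * (2022 * r ^ 2 * ea) := by
      calc _ ≤ (2 * N + N ^ 2) * (2022 * r ^ 2 * ea) := by gcongr
        _ ≤ _ := by gcongr
    linarith
  have hbd : b ≤ b * (c1 + c2) + 2022 * r ^ 2 * ea := by
    have e0 : b * d ≤ b * (2022 * r ^ 2 * ea) := by gcongr
    have e2 : b * (2022 * r ^ 2 * ea) ≤ 1 * (2022 * r ^ 2 * ea) := by gcongr
    rw [h7] at e0; linarith
  have hfin : b ≤ 28224 * r ^ 3 * (2 * eb + 8088 * r ^ 4 * ea) + 2022 * r ^ 2 * ea := by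
    have : 28224 * r ^ 3 * ebT ≤ 28224 * r ^ 3 * (2 * eb + 8088 * r ^ 4 * ea) := by
      gcongr; linarith
    linarith
  rw [div_le_iff₀ (by positivity)]
  have hr1 : 1 ≤ r := by linarith
  have p3 : r ^ 3 ≤ r ^ 9 := pow_le_pow_right₀ hr1 (by norm_num)
  have p7 : r ^ 7 ≤ r ^ 9 := pow_le_pow_right₀ hr1 (by norm_num)
  have p2 : r ^ 2 ≤ r ^ 9 := pow_le_pow_right₀ hr1 (by norm_num)
  have q3 := mul_le_mul_of_nonneg_right p3 heb
  have q7 := mul_le_mul_of_nonneg_right p7 hea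
  have q2 := mul_le_mul_of_nonneg_right p2 hea
  have z1 : 0 ≤ r ^ 9 * ea := by positivity
  have z2 : 0 ≤ r ^ 9 * eb := by positivity
  have : (ea + eb) * (13 * r) ^ 9 = 13 ^ 9 * (r ^ 9 * ea) + 13 ^ 9 * (r ^ 9 * eb) := by ring
  rw [this]
  have : 28224 * r ^ 3 * (2 * eb + 8088 * r ^ 4 * ea) + 2022 * r ^ 2 * ea
    = 56448 * (r ^ 3 * eb) + 228275712 * (r ^ 7 * ea) + 2022 * (r ^ 2 * ea) := by ring
  rw [this] at hfin
  norm_num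
  linarith

end arith

section main
variable {R R' N : ℕ} {G : SimpleGraph (Fin R)}

lemma occ_lower {S : Finset (GNode R)} {E : Finset (Sym2 (GNode R))} :
    ∀ ψ ∈ (IoccSpace R N G : Set ((Fin N → GGV R) → ℂ)), ns ψ = 1 →
      0 ≤ qf (BH.bhHam (AG S E) N - ((N : ℂ) * (e1 : ℂ)) • 1) ψ := by
  intro ψ h _
  obtain ⟨c, -, hb, rfl⟩ := occ_sub G h
  rw [energy_good S E hb]; exact ED_nonneg S E c

lemma part2 (hR : 2 ≤ R) (hNR : N ≤ R) (g : Gad R R' (2 * R + 2) (cfG G))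
    {S : Finset (GNode R)} {E : Finset (Sym2 (GNode R))} (hv : ValidDiagram S E) {b : ℝ} (hb0 : 0 ≤ b) (hb1 : b ≤ 1)
    (hb : b ≤ BH.groundEnergy (BH.bhHam (AG S E) N - ((N : ℂ) * (e1 : ℂ)) • 1)
      (IoccSpace R N G : Set ((Fin N → GGV R) → ℂ)))
    {ψ : (Fin N → GGV R') → ℂ} (hψ : ψ ∈ BH.symmStates (GGV R') N) (h1 : ns ψ = 1) :
    b / (13 * R : ℝ) ^ 9 ≤ qf (BH.bhHam (AG (g.SQ S) (g.EQ E)) N - ((N : ℂ) * (e1 : ℂ)) • 1) ψ := by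
  classical
  set T := (TT fun _ : Fin N => g.JJ) with hT
  have hTi : Tᴴ * T = 1 := TT_isometry g.JJ_iso
  set c := Tᴴ *ᵥ ψ with hc
  have hcs : c ∈ BH.symmStates (LL R) N := by
    rw [hc, hT, TT_conj]; exact symm_TT _ hψ
  set c1 : (Fin N → LL R) → ℂ := fun l => if bad G l then 0 else c l with hc1
  set c2 : (Fin N → LL R) → ℂ := fun l => if bad G l then c l else 0 with hc2
  have hbad : ∀ (σ : Equiv.Perm (Fin N)) (l : Fin N → LL R), bad G (l ∘ σ) ↔ bad G l := by
    intro σ l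
    constructor
    · rintro ⟨w, w', h, h'⟩
      exact ⟨σ w, σ w', fun e => h (σ.injective e), h'⟩
    · rintro ⟨w, w', h, h'⟩
      exact ⟨σ.symm w, σ.symm w', fun e => h (σ.symm.injective e), by simpa using h'⟩
  have hc1s : c1 ∈ BH.symmStates (LL R) N := by
    intro σ l
    simp only [hc1, hbad, hcs σ l]
  have hc1b : ∀ l, bad G l → c1 l = 0 := fun l h => by simp [hc1, h]
  have hns : ns c = ns c1 + ns c2 := by
    simp only [ns, ← Finset.sum_add_distrib]
    refine Finset.sum_congr rfl fun l _ => ?_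
    by_cases h : bad G l <;> simp [hc1, hc2, h]
  have hns2 : ns c2 = ∑ l : Fin N → LL R, (if bad G l then Complex.normSq (c l) else 0) := by
    simp only [ns]
    refine Finset.sum_congr rfl fun l _ => ?_
    by_cases h : bad G l <;> simp [hc2, h]
  have hdiff : (TT fun _ : Fin N => J0 R) *ᵥ c - (TT fun _ : Fin N => J0 R) *ᵥ c1 = (TT fun _ : Fin N => J0 R) *ᵥ c2 := by
    rw [← Matrix.mulVec_sub]
    congr 1
    ext l
    by_cases h : bad G l <;> simp [hc1, hc2, h]
  have hJ0 : (TT fun _ : Fin N => J0 R)ᴴ * (TT fun _ : Fin N => J0 R) = 1 := TT_isometry J0_iso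
  have k1 : b * ns c1 ≤ ED S E c1 := by
    have := ge_homog (occ_lower (S := S) (E := E) (G := G) (N := N)) hb (occ_sup G hc1s hc1b)
    rwa [ns_isometry hJ0, energy_good S E hc1b] at this
  have k2 : ED S E c1 ≤ 2 * ED S E c + 2 * ED S E c2 := by
    have := (nn_EDM (N := N) S E).par' ((TT fun _ : Fin N => J0 R) *ᵥ c1) ((TT fun _ : Fin N => J0 R) *ᵥ c)
    rwa [hdiff, ← ED_eq, ← ED_eq, ← ED_eq] at this
  have k3 : ED S E c2 ≤ 2 * N * ns c2 := by
    rw [ED_eq, ← ns_isometry hJ0 c2]; exact EDM_le hv _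
  have k4 := int_lower g c hcs
  rw [← hns2] at k4
  have k5 := BB_T g S E c
  have k6 : qf (BB g N S E) (T *ᵥ c) ≤ 2 * qf (BB g N S E) ψ + 2 * ((2 * N + (N : ℝ) ^ 2) * ns (ψ - T *ᵥ c)) := by
    have a1 := (nn_BB (N := N) g S E).par' (T *ᵥ c) ψ
    have a2 := BB_le g hv (ψ - T *ᵥ c)
    linarith
  have k7 := ns_pyth hTi ψ
  rw [← hc, h1, hns] at k7
  have k8 := leak g ψ
  rw [← hT, ← hc, h1, hns, ← k7] at k8
  have hm : ((2 * R + 2 : ℕ) : ℝ) + 1 = 2 * (R : ℝ) + 3 := by push_cast; ring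
  rw [energy_Q]
  exact arith1 (n := ((2 * R + 2 : ℕ) : ℝ) + 1) (N := N) (by exact_mod_cast hR) hm (by positivity) (by exact_mod_cast hNR) hb0 hb1
    (ns_nonneg c2) (ED_nonneg S E c) (nn_interaction _) (nn_BB g S E ψ)
    (Finset.sum_nonneg fun w _ => nn_onFactor g.nn_aM w ψ) k1 k2 k3 k4 k5 k6 k7 k8


lemma main_lemma (hR : 2 ≤ R) (hNR : N ≤ R) {S : Finset (GNode R)} {E : Finset (Sym2 (GNode R))}
    (hv : ValidDiagram S E) (he1 : BH.mu (AG S E) = e1) (hne : IoccSpace R N G ≠ ⊥)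
    (g : Gad R R' (2 * R + 2) (cfG G)) :
    BH.lambda1 (AG (g.SQ S) (g.EQ E)) N ≤ lambdaOcc R N S E G / R
      ∧ (∀ b : ℝ, 0 ≤ b → b ≤ 1 → b ≤ lambdaOcc R N S E G →
          b / ((13 * R : ℝ)) ^ 9 ≤ BH.lambda1 (AG (g.SQ S) (g.EQ E)) N) := by
  unfold BH.lambda1 lambdaOcc
  rw [mu_Q g hR he1, he1]
  have hR0 : (0 : ℝ) < R := by exact_mod_cast (by omega : 0 < R)
  obtain ⟨Ψ, hΨ, hΨ1⟩ : ∃ Ψ ∈ (IoccSpace R N G : Set ((Fin N → GGV R) → ℂ)), ns Ψ = 1 := by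
    obtain ⟨v, hv, hv0⟩ := (Submodule.ne_bot_iff _).1 hne
    obtain ⟨r, -, hr, -⟩ := exists_unit hv0
    exact ⟨_, Submodule.smul_mem _ _ hv, hr⟩
  have hJ0 : (TT fun _ : Fin N => J0 R)ᴴ * (TT fun _ : Fin N => J0 R) = 1 := TT_isometry J0_iso
  have hJJ : (TT fun _ : Fin N => g.JJ)ᴴ * (TT fun _ : Fin N => g.JJ) = 1 := TT_isometry g.JJ_iso
  constructor
  · rw [le_div_iff₀ hR0]
    refine le_ge ?_ ⟨Ψ, hΨ, hΨ1⟩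
    intro φ hφ hφ1
    obtain ⟨c, hcs, hb, rfl⟩ := occ_sub G hφ
    rw [ns_isometry hJ0] at hφ1
    rw [energy_good S E hb]
    have h := ge_le (B := 0) (fun ψ _ _ => energy_Q_nonneg g S E ψ) (symm_TT g.JJ hcs)
      (by rw [ns_isometry hJJ, hφ1])
    rw [energy_Q_good g S E hb] at h
    have hE := ED_nonneg S E c
    have hm : ((2 * R + 2 : ℕ) : ℝ) + 1 = 2 * (R : ℝ) + 3 := by push_cast; ring
    rw [hm] at h
    have h2 : 1 / (2 * (R : ℝ) + 3) * ED S E c * R ≤ ED S E c := by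
      have : 1 / (2 * (R : ℝ) + 3) * R ≤ 1 := by
        rw [one_div, inv_mul_le_iff₀ (by positivity)]; linarith
      calc _ = (1 / (2 * (R : ℝ) + 3) * R) * ED S E c := by ring
        _ ≤ 1 * ED S E c := mul_le_mul_of_nonneg_right this hE
        _ = _ := one_mul _
    exact (mul_le_mul_of_nonneg_right h hR0.le).trans h2
  · intro b hb0 hb1 hb
    refine le_ge (fun ψ hψ h1 => part2 hR hNR g hv hb0 hb1 hb hψ h1) ?_
    obtain ⟨c, hcs, -, rfl⟩ := occ_sub G hΨ
    rw [ns_isometry hJ0] at hΨ1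
    exact ⟨_, symm_TT g.JJ hcs, by rw [ns_isometry hJJ, hΨ1]⟩

end main
end OCL

/-- **Occupancy Constraints Lemma.** Let `G` be an `e₁`-gate graph with
`R ≥ 2` diagram elements, let `N ∈ {1,…,R}`, and let `G^occ` be a simple graph on the
vertex set `[R]` such that the subspace `I(G, G^occ, N)` is nonzero.  Then there exists
an `e₁`-gate graph `G^□` with at most `7R²` diagram elements such that:
(1) `λ_N^1(G^□) ≤ λ_N^1(G, G^occ)/R`; and
(2) for every `b ∈ [0,1]`, if `λ_N^1(G, G^occ) ≥ b` then `λ_N^1(G^□) ≥ b/(13R)⁹`. -/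
theorem occupancy_constraints_lemma
    (R : ℕ) (hR : 2 ≤ R)
    (S : Finset (GNode R)) (E : Finset (Sym2 (GNode R)))
    (hvalid : ValidDiagram S E)
    (he1 : BH.mu (AG S E) = e1)
    (N : ℕ) (hN1 : 1 ≤ N) (hNR : N ≤ R)
    (Gocc : SimpleGraph (Fin R))
    (hne : IoccSpace R N Gocc ≠ ⊥) :
    ∃ (R' : ℕ) (S' : Finset (GNode R')) (E' : Finset (Sym2 (GNode R'))),
      R' ≤ 7 * R ^ 2
      ∧ ValidDiagram S' E'
      ∧ BH.mu (AG S' E') = e1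
      ∧ BH.lambda1 (AG S' E') N ≤ lambdaOcc R N S E Gocc / R
      ∧ (∀ b : ℝ, 0 ≤ b → b ≤ 1 → b ≤ lambdaOcc R N S E Gocc →
          b / ((13 * R : ℝ)) ^ 9 ≤ BH.lambda1 (AG S' E') N) := by
  obtain ⟨g⟩ := OCL.gad_exists Gocc
  have h := OCL.main_lemma (G := Gocc) hR hNR hvalid he1 hne g
  exact ⟨3 * R + 4 * R ^ 2, g.SQ S, g.EQ E, by nlinarith, g.valid_Q hvalid, OCL.mu_Q g hR he1, h.1, h.2⟩
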